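/- Let α > 0 be a non-integer, k ≥ 3 an integer, δ > 0, h ≥ 1, 2 < q ≤ X, and V ≤ M < M₁ ≤ 2M ≤ 2V² with V = X^{1/3}, X < Y ≤ 2X, Z ∈ {X, max(Vm, X)}. Let (β_n) satisfy |β_n| ≤ Λ(n) or |β_n| ≤ 1, and let S(M) = Σ_{M < m ≤ M₁} Σ_{Z/m ≤ n₁ < n₂ < Y/m, mn_i ≡ a (mod q) for i=1,2} β_{n₁} β_{n₂} e( h m^α (n₁^α − n₂^α) ), where gcd(a,q)=1. Then S(M) ≪_{k,δ} (X/q)^{2δ} · (X²/(Mq²)) · ( T₄ + T₅ + T₆ ), where T₄ = (2h q^k X^α / M^k)^{1/(k(k−1))}, T₅ = (q/M)^{1/(k(k−1))}, and T₆ = (2h X^α)^{−2/(k²(k−1))}. -/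

import Mathlib

open scoped Classical

open ArithmeticFunction

/-- `e(x) = e^{2πix}`. -/
noncomputable def e (x : ℝ) : ℂ := Complex.exp (2 * Real.pi * Complex.I * x)

/-- Hölder's inequality with natural exponents. -/
theorem sum_pow_le_of_pow_le {ι : Type*} (s : Finset ι) {x y z : ι → ℝ}
    (hx : ∀ t ∈ s, 0 ≤ x t) (hy : ∀ t ∈ s, 0 ≤ y t) (hz : ∀ t ∈ s, 0 ≤ z t) {i j : ℕ}
    (hij : 0 < i + j) (h : ∀ t ∈ s, z t ^ (i + j) ≤ x t ^ i * y t ^ j) :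
    (∑ t ∈ s, z t) ^ (i + j) ≤ (∑ t ∈ s, x t) ^ i * (∑ t ∈ s, y t) ^ j := by
  rcases Nat.eq_zero_or_pos i with rfl | hi
  · simp only [zero_add, pow_zero, one_mul] at *
    gcongr with t ht
    · exact Finset.sum_nonneg hz
    · exact le_of_pow_le_pow_left₀ hij.ne' (hy t ht) (h t ht)
  rcases Nat.eq_zero_or_pos j with rfl | hj
  · simp only [add_zero, pow_zero, mul_one] at *
    gcongr with t ht
    · exact Finset.sum_nonneg hz
    · exact le_of_pow_le_pow_left₀ hij.ne' (hx t ht) (h t ht)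
  have hi' : (0 : ℝ) < i := by exact_mod_cast hi
  have hj' : (0 : ℝ) < j := by exact_mod_cast hj
  have hs : (0 : ℝ) < i + j := by positivity
  have hpq : ((i + j : ℝ) / i).HolderConjugate ((i + j : ℝ) / j) := by
    rw [Real.holderConjugate_iff]
    constructor
    · rw [lt_div_iff₀ hi']; linarith
    · field_simp
  have key := Real.inner_le_Lp_mul_Lq_of_nonneg s (f := fun t => x t ^ ((i : ℝ) / (i + j)))
    (g := fun t => y t ^ ((j : ℝ) / (i + j))) hpq
    (fun t ht => Real.rpow_nonneg (hx t ht) _) (fun t ht => Real.rpow_nonneg (hy t ht) _)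
  have e1 : ∑ t ∈ s, (x t ^ ((i : ℝ) / (i + j))) ^ ((i + j : ℝ) / i) = ∑ t ∈ s, x t := by
    refine Finset.sum_congr rfl fun t ht => ?_
    rw [← Real.rpow_mul (hx t ht)]
    rw [show (i : ℝ) / (i + j) * ((i + j) / i) = 1 by field_simp, Real.rpow_one]
  have e2 : ∑ t ∈ s, (y t ^ ((j : ℝ) / (i + j))) ^ ((i + j : ℝ) / j) = ∑ t ∈ s, y t := by
    refine Finset.sum_congr rfl fun t ht => ?_
    rw [← Real.rpow_mul (hy t ht)]
    rw [show (j : ℝ) / (i + j) * ((i + j) / j) = 1 by field_simp, Real.rpow_one]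
  rw [e1, e2] at key
  have hz' : ∑ t ∈ s, z t ≤ ∑ t ∈ s, x t ^ ((i : ℝ) / (i + j)) * y t ^ ((j : ℝ) / (i + j)) := by
    refine Finset.sum_le_sum fun t ht => ?_
    have h0 : 0 ≤ x t ^ ((i : ℝ) / (i + j)) * y t ^ ((j : ℝ) / (i + j)) :=
      mul_nonneg (Real.rpow_nonneg (hx t ht) _) (Real.rpow_nonneg (hy t ht) _)
    refine le_of_pow_le_pow_left₀ hij.ne' h0 ((h t ht).trans_eq ?_)
    rw [mul_pow, ← Real.rpow_mul_natCast (hx t ht), ← Real.rpow_mul_natCast (hy t ht)]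
    push_cast
    rw [div_mul_cancel₀ _ hs.ne', div_mul_cancel₀ _ hs.ne', Real.rpow_natCast, Real.rpow_natCast]
  have hX : 0 ≤ ∑ t ∈ s, x t := Finset.sum_nonneg hx
  have hY : 0 ≤ ∑ t ∈ s, y t := Finset.sum_nonneg hy
  calc (∑ t ∈ s, z t) ^ (i + j)
      ≤ ((∑ t ∈ s, x t) ^ (1 / ((i + j : ℝ) / i)) * (∑ t ∈ s, y t) ^ (1 / ((i + j : ℝ) / j))) ^ (i + j) :=
        pow_le_pow_left₀ (Finset.sum_nonneg hz) (hz'.trans key) _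
    _ = _ := by
        rw [mul_pow, ← Real.rpow_mul_natCast hX, ← Real.rpow_mul_natCast hY]
        push_cast
        rw [one_div_div, one_div_div, div_mul_cancel₀ _ hs.ne', div_mul_cancel₀ _ hs.ne',
          Real.rpow_natCast, Real.rpow_natCast]

/-- The weighted `ℓ^Q` norm of a nonnegative function on a finite type. -/
noncomputable def wnorm {Ω : Type*} [Fintype Ω] (w : Ω → ℝ) (Q : ℕ) (g : Ω → ℝ) : ℝ :=
  (∑ ω, w ω * g ω ^ Q) ^ ((Q : ℝ)⁻¹)

section wnorm

variable {Ω : Type*} [Fintype Ω] {w : Ω → ℝ} {Q : ℕ}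

theorem wnorm_nonneg (hw : ∀ ω, 0 ≤ w ω) {g : Ω → ℝ} (hg : ∀ ω, 0 ≤ g ω) : 0 ≤ wnorm w Q g :=
  Real.rpow_nonneg (Finset.sum_nonneg fun ω _ => mul_nonneg (hw ω) (pow_nonneg (hg ω) _)) _

theorem wnorm_pow (hQ : Q ≠ 0) (hw : ∀ ω, 0 ≤ w ω) {g : Ω → ℝ} (hg : ∀ ω, 0 ≤ g ω) :
    wnorm w Q g ^ Q = ∑ ω, w ω * g ω ^ Q :=
  Real.rpow_inv_natCast_pow
    (Finset.sum_nonneg fun ω _ => mul_nonneg (hw ω) (pow_nonneg (hg ω) _)) hQ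

theorem wnorm_mono (hw : ∀ ω, 0 ≤ w ω) {f g : Ω → ℝ} (hf : ∀ ω, 0 ≤ f ω) (h : ∀ ω, f ω ≤ g ω) :
    wnorm w Q f ≤ wnorm w Q g := by
  refine Real.rpow_le_rpow
    (Finset.sum_nonneg fun ω _ => mul_nonneg (hw ω) (pow_nonneg (hf ω) _)) ?_ (by positivity)
  exact Finset.sum_le_sum fun ω _ =>
    mul_le_mul_of_nonneg_left (pow_le_pow_left₀ (hf ω) (h ω) _) (hw ω)

theorem wnorm_zero (hQ : Q ≠ 0) : wnorm w Q (fun _ => 0) = 0 := by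
  simp [wnorm, hQ]

theorem wnorm_const_mul (hQ : Q ≠ 0) (hw : ∀ ω, 0 ≤ w ω) {g : Ω → ℝ} (hg : ∀ ω, 0 ≤ g ω) {c : ℝ}
    (hc : 0 ≤ c) : wnorm w Q (fun ω => c * g ω) = c * wnorm w Q g := by
  refine (pow_left_inj₀ (wnorm_nonneg hw fun ω => mul_nonneg hc (hg ω))
    (mul_nonneg hc (wnorm_nonneg hw hg)) hQ).1 ?_
  rw [wnorm_pow hQ hw fun ω => mul_nonneg hc (hg ω), mul_pow, wnorm_pow hQ hw hg, Finset.mul_sum]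
  exact Finset.sum_congr rfl fun ω _ => by ring

theorem wnorm_add_le (hQ : Q ≠ 0) (hw : ∀ ω, 0 ≤ w ω) {f g : Ω → ℝ} (hf : ∀ ω, 0 ≤ f ω)
    (hg : ∀ ω, 0 ≤ g ω) : wnorm w Q (fun ω => f ω + g ω) ≤ wnorm w Q f + wnorm w Q g := by
  have hQ1 : (1 : ℝ) ≤ Q := by exact_mod_cast Nat.one_le_iff_ne_zero.2 hQ
  have hroot : ∀ ω, 0 ≤ w ω ^ ((Q : ℝ)⁻¹) := fun ω => Real.rpow_nonneg (hw ω) _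
  have key := Real.Lp_add_le_of_nonneg Finset.univ (f := fun ω => w ω ^ ((Q : ℝ)⁻¹) * f ω)
    (g := fun ω => w ω ^ ((Q : ℝ)⁻¹) * g ω) hQ1 (fun ω _ => mul_nonneg (hroot ω) (hf ω))
    (fun ω _ => mul_nonneg (hroot ω) (hg ω))
  have e1 : ∀ u : Ω → ℝ, ∑ ω, (w ω ^ ((Q : ℝ)⁻¹) * u ω) ^ (Q : ℝ) = ∑ ω, w ω * u ω ^ Q := by
    intro u
    refine Finset.sum_congr rfl fun ω _ => ?_
    rw [Real.rpow_natCast, mul_pow, Real.rpow_inv_natCast_pow (hw ω) hQ]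
  simp only [← mul_add] at key
  rw [e1, e1, e1] at key
  simpa [wnorm, one_div] using key

theorem wnorm_sum_le (hQ : Q ≠ 0) (hw : ∀ ω, 0 ≤ w ω) {ι : Type*} (s : Finset ι) {f : ι → Ω → ℝ}
    (hf : ∀ i ω, 0 ≤ f i ω) :
    wnorm w Q (fun ω => ∑ i ∈ s, f i ω) ≤ ∑ i ∈ s, wnorm w Q (f i) := by
  induction s using Finset.induction_on with
  | empty => simp [wnorm_zero hQ]
  | insert a s ha ih =>
    simp only [Finset.sum_insert ha]
    exact (wnorm_add_le hQ hw (hf a) fun ω => Finset.sum_nonneg fun i _ => hf i ω).trans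
      (by gcongr)

end wnorm

/-- The value at `x` of the polynomial with coefficient vector `ω`. -/
def polyEval {k N : ℕ} (ω : Fin (k + 1) → ZMod N) (x : ℤ) : ZMod N :=
  ∑ j, ω j * (x : ZMod N) ^ (j : ℕ)

theorem polyEval_add {k N : ℕ} (ω τ : Fin (k + 1) → ZMod N) (x : ℤ) :
    polyEval (ω + τ) x = polyEval ω x + polyEval τ x := by
  simp [polyEval, add_mul, Finset.sum_add_distrib]

/-- The exponential sum over `s` with coefficients `c` and polynomial phase `ω`. -/
noncomputable def expSum {k N : ℕ} [NeZero N] (c : ℤ → ℂ) (s : Finset ℤ)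
    (ω : Fin (k + 1) → ZMod N) : ℂ :=
  ∑ x ∈ s, c x * ZMod.stdAddChar (polyEval ω x)

/-- The part of `s` lying in the residue class `r` modulo `N`. -/
noncomputable def resClass (s : Finset ℤ) (N : ℕ) (r : ZMod N) : Finset ℤ :=
  s.filter fun x => (x : ZMod N) = r

theorem norm_stdAddChar {N : ℕ} [NeZero N] (a : ZMod N) : ‖(ZMod.stdAddChar a : ℂ)‖ = 1 :=
  AddChar.norm_apply _ _

theorem sum_resClass {M : Type*} [AddCommMonoid M] (s : Finset ℤ) (N : ℕ) [NeZero N] (f : ℤ → M) :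
    ∑ r : ZMod N, ∑ x ∈ resClass s N r, f x = ∑ x ∈ s, f x :=
  Finset.sum_fiberwise s (fun x : ℤ => (x : ZMod N)) f

theorem expSum_eq_sum_resClass {k N : ℕ} [NeZero N] (c : ℤ → ℂ) (s : Finset ℤ)
    (ω : Fin (k + 1) → ZMod N) (N' : ℕ) [NeZero N'] :
    expSum c s ω = ∑ r : ZMod N', expSum c (resClass s N' r) ω :=
  (sum_resClass s _ _).symm

/-- Half the critical exponent of the moment curve of degree `k`. -/
def tri (k : ℕ) : ℕ := k * (k + 1) / 2

theorem two_mul_tri (k : ℕ) : 2 * tri k = k * (k + 1) :=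
  Nat.mul_div_cancel' (Nat.even_mul_succ_self k).two_dvd

theorem tri_succ (k : ℕ) : tri (k + 1) = tri k + (k + 1) := by
  have h1 := two_mul_tri k
  have h2 := two_mul_tri (k + 1)
  nlinarith

theorem tri_pos {k : ℕ} (hk : 0 < k) : 0 < tri k := by
  have h1 := two_mul_tri k
  have : 0 < k * (k + 1) := by positivity
  omega

theorem tri_mono : Monotone tri :=
  monotone_nat_of_le_succ fun k => by rw [tri_succ]; omega

/-- The decoupling inequality for the `p`-adic moment curve of degree `k` at scale `p ^ n`. -/
def Decoupling (p : ℕ) [Fact p.Prime] (k n : ℕ) (D : ℝ) : Prop :=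
  ∀ (c : ℤ → ℂ) (s : Finset ℤ),
    wnorm 1 (tri k) (fun ω : Fin (k + 1) → ZMod (p ^ (n * k)) => ‖expSum c s ω‖ ^ 2) ≤
      D * ∑ r : ZMod (p ^ n), wnorm 1 (tri k)
        (fun ω : Fin (k + 1) → ZMod (p ^ (n * k)) => ‖expSum c (resClass s (p ^ n) r) ω‖ ^ 2)

theorem wnorm_le_of_shift {Ω H ι : Type*} [Fintype Ω] [AddCommGroup Ω] [Fintype H] [Nonempty H]
    {Q : ℕ} (hQ : Q ≠ 0) {w : Ω → ℝ} (hw : ∀ ω, 0 ≤ w ω) (τ : H → Ω)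
    (hτ : ∀ h ω, w (ω + τ h) = w ω) (s : Finset ι) {F : Ω → ℝ} {g : ι → Ω → ℝ}
    (hF : ∀ ω, 0 ≤ F ω) (hg : ∀ i ω, 0 ≤ g i ω) {D : ℝ} (hD : 0 ≤ D)
    (hdec : ∀ ω, wnorm 1 Q (fun h => F (ω + τ h)) ≤
      D * ∑ i ∈ s, wnorm 1 Q (fun h => g i (ω + τ h))) :
    wnorm w Q F ≤ D * ∑ i ∈ s, wnorm w Q (g i) := by
  have h1 : ∀ h : H, (0 : ℝ) ≤ (1 : H → ℝ) h := fun _ => zero_le_one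
  have avg : ∀ u : Ω → ℝ, (∀ ω, 0 ≤ u ω) →
      ∑ ω, w ω * (wnorm 1 Q (fun h => u (ω + τ h))) ^ Q =
        (Fintype.card H : ℝ) * ∑ ω, w ω * u ω ^ Q := by
    intro u hu
    calc ∑ ω, w ω * (wnorm 1 Q (fun h => u (ω + τ h))) ^ Q
        = ∑ ω, ∑ h, w (ω + τ h) * u (ω + τ h) ^ Q := by
          refine Finset.sum_congr rfl fun ω _ => ?_
          rw [wnorm_pow hQ h1 fun h => hu _, Finset.mul_sum]
          exact Finset.sum_congr rfl fun h _ => by rw [hτ]; simp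
      _ = ∑ h : H, ∑ ω, w ω * u ω ^ Q := by
          rw [Finset.sum_comm]
          exact Finset.sum_congr rfl fun h _ =>
            Fintype.sum_equiv (Equiv.addRight (τ h)) _ _ fun ω => rfl
      _ = _ := by simp
  have hc : (0 : ℝ) < Fintype.card H := by exact_mod_cast Fintype.card_pos
  set κ : ℝ := (Fintype.card H : ℝ) ^ ((Q : ℝ)⁻¹) with hκ
  have hκ0 : 0 < κ := Real.rpow_pos_of_pos hc _
  have avg' : ∀ u : Ω → ℝ, (∀ ω, 0 ≤ u ω) →
      wnorm w Q (fun ω => wnorm 1 Q (fun h => u (ω + τ h))) = κ * wnorm w Q u := by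
    intro u hu
    rw [wnorm, avg u hu, Real.mul_rpow hc.le
      (Finset.sum_nonneg fun ω _ => mul_nonneg (hw ω) (pow_nonneg (hu ω) _))]
    rfl
  have hG : ∀ i ω, 0 ≤ wnorm 1 Q (fun h => g i (ω + τ h)) := fun i ω =>
    wnorm_nonneg h1 fun h => hg i _
  have : κ * wnorm w Q F ≤ κ * (D * ∑ i ∈ s, wnorm w Q (g i)) := by
    rw [← avg' F hF]
    calc _ ≤ wnorm w Q (fun ω => D * ∑ i ∈ s, wnorm 1 Q (fun h => g i (ω + τ h))) :=
          wnorm_mono hw (fun ω => wnorm_nonneg h1 fun h => hF _) hdec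
      _ = D * wnorm w Q (fun ω => ∑ i ∈ s, wnorm 1 Q (fun h => g i (ω + τ h))) :=
          wnorm_const_mul hQ hw (fun ω => Finset.sum_nonneg fun i _ => hG i ω) hD
      _ ≤ D * ∑ i ∈ s, wnorm w Q (fun ω => wnorm 1 Q (fun h => g i (ω + τ h))) := by
          gcongr
          exact wnorm_sum_le hQ hw s hG
      _ = _ := by
          simp only [avg' _ (hg _), ← Finset.mul_sum]
          ring
  exact le_of_mul_le_mul_left this hκ0

theorem wnorm_expSum_le_of_shift {p : ℕ} [Fact p.Prime] {k l m n M : ℕ} (hl : 0 < l) (hmn : m ≤ n)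
    {D : ℝ} (hD : 0 ≤ D) (hdec : Decoupling p l (n - m) D)
    {w : (Fin (k + 1) → ZMod (p ^ M)) → ℝ} (hw : ∀ ω, 0 ≤ w ω)
    (τ : (Fin (l + 1) → ZMod (p ^ ((n - m) * l))) → Fin (k + 1) → ZMod (p ^ M))
    (hτ : ∀ h ω, w (ω + τ h) = w ω) (s : Finset ℤ) (x₀ : ℤ)
    (hs : ∀ x ∈ s, (p : ℤ) ^ m ∣ x - x₀)
    (hphase : ∀ h, ∃ θ : ℂ, ‖θ‖ = 1 ∧ ∀ z : ℤ, x₀ + (p : ℤ) ^ m * z ∈ s →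
      ZMod.stdAddChar (polyEval (τ h) (x₀ + (p : ℤ) ^ m * z)) =
        θ * ZMod.stdAddChar (polyEval h z)) (c : ℤ → ℂ) :
    wnorm w (tri l) (fun ω => ‖expSum c s ω‖ ^ 2) ≤
      D * ∑ r : ZMod (p ^ n), wnorm w (tri l)
        (fun ω => ‖expSum c (resClass s (p ^ n) r) ω‖ ^ 2) := by
  have hp0 : (p : ℤ) ^ m ≠ 0 := pow_ne_zero _ (by exact_mod_cast (Fact.out : p.Prime).ne_zero)
  refine wnorm_le_of_shift (tri_pos hl).ne' hw τ hτ Finset.univ (fun ω => by positivity)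
    (fun r ω => by positivity) hD fun ω => ?_
  set φ : ℤ → ℤ := fun z => x₀ + (p : ℤ) ^ m * z with hφ
  have hinj : Function.Injective φ := fun a b hab => by
    simpa [hφ, hp0] using hab
  set s' : Finset ℤ := s.preimage φ hinj.injOn with hs'
  have himg : s'.image φ = s := by
    ext x
    simp only [hs', Finset.mem_image, Finset.mem_preimage]
    constructor
    · rintro ⟨z, hz, rfl⟩
      exact hz
    · intro hx
      obtain ⟨z, hz⟩ := hs x hx
      have : φ z = x := by simp only [hφ]; linarith
      exact ⟨z, this ▸ hx, this⟩
  set c' : ℤ → ℂ := fun z => c (φ z) * ZMod.stdAddChar (polyEval ω (φ z)) with hc'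
  have hnorm : ∀ t ⊆ s', ∀ h, ‖expSum c (t.image φ) (ω + τ h)‖ = ‖expSum c' t h‖ := by
    intro t ht h
    obtain ⟨θ, hθ, hph⟩ := hphase h
    have : expSum c (t.image φ) (ω + τ h) = θ * expSum c' t h := by
      rw [expSum, Finset.sum_image hinj.injOn, expSum, Finset.mul_sum]
      refine Finset.sum_congr rfl fun z hz => ?_
      have hzs : φ z ∈ s := by
        have := ht hz
        rwa [hs', Finset.mem_preimage] at this
      rw [polyEval_add, AddChar.map_add_eq_mul, hph z hzs, hc']
      ring
    rw [this, norm_mul, hθ, one_mul]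
  set ρ : ZMod (p ^ (n - m)) → ZMod (p ^ n) := fun r => ((φ (r.val : ℤ) : ℤ) : ZMod (p ^ n)) with hρ
  have hmem : ∀ (z : ℤ) (r : ZMod (p ^ (n - m))),
      ((φ z : ℤ) : ZMod (p ^ n)) = ρ r ↔ (z : ZMod (p ^ (n - m))) = r := by
    intro z r
    have hr : r = (((r.val : ℕ) : ℤ) : ZMod (p ^ (n - m))) := by simp
    conv_rhs => rw [hr]
    rw [hρ, eq_comm, ZMod.intCast_eq_intCast_iff_dvd_sub, eq_comm,
      ZMod.intCast_eq_intCast_iff_dvd_sub]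
    have : φ z - φ (r.val : ℤ) = (p : ℤ) ^ m * (z - (r.val : ℤ)) := by simp only [hφ]; ring
    rw [this]
    push_cast
    have hn : (p : ℤ) ^ n = (p : ℤ) ^ m * (p : ℤ) ^ (n - m) := by
      rw [← pow_add, Nat.add_sub_cancel' hmn]
    rw [hn]
    exact mul_dvd_mul_iff_left hp0
  have hρinj : Function.Injective ρ := by
    intro a b hab
    have h1 := (hmem (a.val : ℤ) b).1 (by rw [← hab])
    simpa using h1
  have hcls : ∀ r, (resClass s' (p ^ (n - m)) r).image φ = resClass s (p ^ n) (ρ r) := by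
    intro r
    rw [← himg, resClass, resClass, Finset.filter_image]
    congr 1
    ext z
    simp only [Finset.mem_filter, hmem]
  have hmain := hdec c' s'
  have e0 : (fun h => ‖expSum c s (ω + τ h)‖ ^ 2) = fun h => ‖expSum c' s' h‖ ^ 2 := by
    funext h
    rw [← hnorm s' subset_rfl h, himg]
  rw [e0]
  refine hmain.trans (mul_le_mul_of_nonneg_left ?_ hD)
  have e1 : ∀ r, wnorm 1 (tri l) (fun h : Fin (l + 1) → ZMod (p ^ ((n - m) * l)) =>
        ‖expSum c' (resClass s' (p ^ (n - m)) r) h‖ ^ 2) =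
      wnorm 1 (tri l) (fun h => ‖expSum c (resClass s (p ^ n) (ρ r)) (ω + τ h)‖ ^ 2) := by
    intro r
    congr 1
    funext h
    rw [← hcls, hnorm (resClass s' (p ^ (n - m)) r) (Finset.filter_subset _ _) h]
  rw [Finset.sum_congr rfl fun r _ => e1 r, ← Finset.sum_image (f := fun r : ZMod (p ^ n) => wnorm 1 (tri l)
    (fun h => ‖expSum c (resClass s (p ^ n) r) (ω + τ h)‖ ^ 2)) hρinj.injOn]
  exact Finset.sum_le_univ_sum_of_nonneg fun r =>
    wnorm_nonneg (fun _ => zero_le_one) fun h => by positivity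

theorem stdAddChar_pow_mul {p : ℕ} [Fact p.Prime] {m M : ℕ} (hm : m ≤ M) (a : ℤ) :
    (ZMod.stdAddChar (((p : ℤ) ^ (M - m) * a : ℤ) : ZMod (p ^ M)) : ℂ) =
      ZMod.stdAddChar (a : ZMod (p ^ m)) := by
  have hp : (p : ℂ) ≠ 0 := by exact_mod_cast (Fact.out : p.Prime).ne_zero
  rw [ZMod.stdAddChar_coe, ZMod.stdAddChar_coe]
  congr 1
  have : (p : ℂ) ^ M = (p : ℂ) ^ (M - m) * (p : ℂ) ^ m := by
    rw [← pow_add, Nat.sub_add_cancel hm]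
  push_cast
  rw [this]
  field_simp

open Polynomial in
theorem polyEval_coeff {k N : ℕ} (P : (ZMod N)[X]) (hP : P.natDegree ≤ k) (x : ℤ) :
    polyEval (fun j : Fin (k + 1) => P.coeff j) x = P.eval (x : ZMod N) := by
  rw [eval_eq_sum_range' (Nat.lt_succ_of_le hP), polyEval,
    Fin.sum_univ_eq_sum_range (fun j => P.coeff j * (x : ZMod N) ^ j)]

open Polynomial in
/-- The polynomial phase attached to `W`, centred at `x₀` and divisible by `p ^ e`. -/
noncomputable def shiftPhase (p k M e : ℕ) (W : (ZMod (p ^ M))[X]) (x₀ : ℤ) :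
    Fin (k + 1) → ZMod (p ^ M) :=
  fun j => (C ((p : ZMod (p ^ M)) ^ e) * W.comp (X - C (x₀ : ZMod (p ^ M)))).coeff j

open Polynomial in
theorem polyEval_shiftPhase {p k M e : ℕ} {W : (ZMod (p ^ M))[X]} (hW : W.natDegree ≤ k)
    (x₀ x : ℤ) :
    polyEval (shiftPhase p k M e W x₀) x =
      (p : ZMod (p ^ M)) ^ e * W.eval ((x - x₀ : ℤ) : ZMod (p ^ M)) := by
  unfold shiftPhase
  rw [polyEval_coeff]
  · simp [eval_comp]
  · refine (natDegree_C_mul_le _ _).trans (natDegree_comp_le.trans ?_)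
    calc W.natDegree * (X - C (x₀ : ZMod (p ^ M))).natDegree ≤ W.natDegree * 1 :=
          Nat.mul_le_mul_left _ (natDegree_X_sub_C_le _)
      _ ≤ k := by omega

theorem pow_prime_eq_zero {p M e : ℕ} (h : M ≤ e) : (p : ZMod (p ^ M)) ^ e = 0 := by
  have h1 : ((p ^ e : ℕ) : ZMod (p ^ M)) = 0 :=
    (ZMod.natCast_eq_zero_iff _ _).2 (pow_dvd_pow p h)
  exact_mod_cast h1

open Polynomial in
theorem stdAddChar_shiftPhase {p : ℕ} [Fact p.Prime] {k l c m M : ℕ} {W : (ZMod (p ^ M))[X]}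
    (hW : W.natDegree ≤ k) (hlk : l ≤ k) (hM : m + c * l ≤ M) (hc : m ≤ c ∨ l = k)
    (h : Fin (l + 1) → ZMod (p ^ m))
    (hcoef : ∀ j : Fin (l + 1), (j : ℕ) ≠ 0 →
      W.coeff j = ((h j).val : ZMod (p ^ M)) * (p : ZMod (p ^ M)) ^ (c * (l - j))) (x₀ : ℤ) :
    ∃ θ : ℂ, ‖θ‖ = 1 ∧ ∀ z : ℤ,
      ZMod.stdAddChar (polyEval (shiftPhase p k M (M - m - c * l) W x₀) (x₀ + (p : ℤ) ^ c * z)) =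
        θ * ZMod.stdAddChar (polyEval h z) := by
  set e := M - m - c * l with he
  refine ⟨ZMod.stdAddChar ((p : ZMod (p ^ M)) ^ e * W.coeff 0 - (p : ZMod (p ^ M)) ^ (M - m) * ((h 0).val : ZMod (p ^ M))),
    norm_stdAddChar _, fun z => ?_⟩
  have hh : polyEval h z = ((∑ j : Fin (l + 1), ((h j).val : ℤ) * z ^ (j : ℕ) : ℤ) : ZMod (p ^ m)) := by
    simp [polyEval]
  rw [hh, ← stdAddChar_pow_mul (by omega : m ≤ M), ← AddChar.map_add_eq_mul]
  congr 1
  have hx : ((x₀ + (p : ℤ) ^ c * z - x₀ : ℤ) : ZMod (p ^ M)) = (p : ZMod (p ^ M)) ^ c * (z : ZMod (p ^ M)) := by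
    push_cast
    ring
  rw [polyEval_shiftPhase hW, hx, eval_eq_sum_range' (Nat.lt_succ_of_le hW),
    show k.succ = (l + 1) + (k - l) by omega, Finset.sum_range_add]
  have htail : (p : ZMod (p ^ M)) ^ e * ∑ x ∈ Finset.range (k - l), W.coeff (l + 1 + x) *
      ((p : ZMod (p ^ M)) ^ c * (z : ZMod (p ^ M))) ^ (l + 1 + x) = 0 := by
    rcases hc with hc | hc
    · rw [Finset.mul_sum]
      refine Finset.sum_eq_zero fun x _ => ?_
      have : (p : ZMod (p ^ M)) ^ (e + c * (l + 1 + x)) = 0 := pow_prime_eq_zero (by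
        have : c * (l + 1 + x) = c * l + c + c * x := by ring
        omega)
      rw [pow_add, pow_mul] at this
      rw [mul_pow]
      linear_combination W.coeff (l + 1 + x) * (z : ZMod (p ^ M)) ^ (l + 1 + x) * this
    · simp [hc]
  rw [mul_add, htail, add_zero, Finset.sum_range_succ', ← Fin.sum_univ_eq_sum_range (fun j =>
    W.coeff (j + 1) * ((p : ZMod (p ^ M)) ^ c * (z : ZMod (p ^ M))) ^ (j + 1)), Fin.sum_univ_succ]
  have hterm : ∀ j : Fin l, (p : ZMod (p ^ M)) ^ e * (W.coeff ((j : ℕ) + 1) *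
      ((p : ZMod (p ^ M)) ^ c * (z : ZMod (p ^ M))) ^ ((j : ℕ) + 1)) =
      (p : ZMod (p ^ M)) ^ (M - m) * (((h j.succ).val : ZMod (p ^ M)) * (z : ZMod (p ^ M)) ^ ((j : ℕ) + 1)) := by
    intro j
    have h1 := hcoef j.succ (by simp)
    rw [Fin.val_succ] at h1
    have h2 : (p : ZMod (p ^ M)) ^ (M - m) = (p : ZMod (p ^ M)) ^ e * (p : ZMod (p ^ M)) ^ (c * (l - ((j : ℕ) + 1))) *
        ((p : ZMod (p ^ M)) ^ c) ^ ((j : ℕ) + 1) := by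
      rw [← pow_mul, ← pow_add, ← pow_add]
      congr 1
      have h3 : c * (l - ((j : ℕ) + 1)) + c * ((j : ℕ) + 1) = c * l := by
        rw [← mul_add]
        congr 1
        omega
      omega
    rw [h1, h2]
    ring
  rw [mul_add, Finset.mul_sum, Finset.sum_congr rfl fun j _ => hterm j, ← Finset.mul_sum]
  push_cast
  simp only [Fin.val_succ, Fin.val_zero]
  ring

theorem wnorm_expSum_le_of_class {p : ℕ} [Fact p.Prime] {k m n M : ℕ} (hk : 0 < k) (hmn : m ≤ n)
    (hM : n * k ≤ M) {D : ℝ} (hD : 0 ≤ D) (hdec : Decoupling p k (n - m) D) (s : Finset ℤ) (x₀ : ℤ)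
    (hs : ∀ x ∈ s, (p : ℤ) ^ m ∣ x - x₀) (c : ℤ → ℂ) :
    wnorm 1 (tri k) (fun ω : Fin (k + 1) → ZMod (p ^ M) => ‖expSum c s ω‖ ^ 2) ≤
      D * ∑ r : ZMod (p ^ n), wnorm 1 (tri k)
        (fun ω : Fin (k + 1) → ZMod (p ^ M) => ‖expSum c (resClass s (p ^ n) r) ω‖ ^ 2) := by
  have hM' : (n - m) * k + m * k ≤ M := by rwa [← add_mul, Nat.sub_add_cancel hmn]
  have key : ∀ h : Fin (k + 1) → ZMod (p ^ ((n - m) * k)), ∃ W : Polynomial (ZMod (p ^ M)),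
      W.natDegree ≤ k ∧ ∀ j : Fin (k + 1), (j : ℕ) ≠ 0 →
        W.coeff j = ((h j).val : ZMod (p ^ M)) * (p : ZMod (p ^ M)) ^ (m * (k - j)) := by
    intro h
    refine ⟨∑ j : Fin (k + 1), Polynomial.monomial (j : ℕ)
      (((h j).val : ZMod (p ^ M)) * (p : ZMod (p ^ M)) ^ (m * (k - j))), ?_, ?_⟩
    · exact Polynomial.natDegree_sum_le_of_forall_le _ _ fun j _ =>
        (Polynomial.natDegree_monomial_le _).trans (Nat.lt_succ_iff.1 j.2)
    · intro j _
      simp [Polynomial.finsetSum_coeff, Polynomial.coeff_monomial, Fin.val_inj]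
  choose W hW hcoef using key
  refine wnorm_expSum_le_of_shift hk hmn hD hdec (fun _ => zero_le_one)
    (fun h => shiftPhase p k M (M - (n - m) * k - m * k) (W h) x₀) (fun _ _ => rfl) s x₀ hs
    (fun h => ?_) c
  obtain ⟨θ, h1, h2⟩ := stdAddChar_shiftPhase (hW h) le_rfl hM' (Or.inr rfl) h (hcoef h) x₀
  exact ⟨θ, h1, fun z _ => h2 z⟩

theorem wnorm_expSum_le_trivial {k N N' Q : ℕ} [NeZero N] [NeZero N'] (hQ : Q ≠ 0)
    {w : (Fin (k + 1) → ZMod N) → ℝ} (hw : ∀ ω, 0 ≤ w ω) (c : ℤ → ℂ) (s : Finset ℤ) :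
    wnorm w Q (fun ω => ‖expSum c s ω‖ ^ 2) ≤
      N' * ∑ r : ZMod N', wnorm w Q (fun ω => ‖expSum c (resClass s N' r) ω‖ ^ 2) := by
  have h0 : ∀ (r : ZMod N') (ω : Fin (k + 1) → ZMod N), 0 ≤ ‖expSum c (resClass s N' r) ω‖ ^ 2 :=
    fun r ω => by positivity
  calc wnorm w Q (fun ω => ‖expSum c s ω‖ ^ 2)
      ≤ wnorm w Q (fun ω => N' * ∑ r : ZMod N', ‖expSum c (resClass s N' r) ω‖ ^ 2) := by
        refine wnorm_mono hw (fun ω => by positivity) fun ω => ?_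
        rw [expSum_eq_sum_resClass c s ω N']
        calc _ ≤ (∑ r : ZMod N', ‖expSum c (resClass s N' r) ω‖) ^ 2 := by
              gcongr
              exact norm_sum_le _ _
          _ ≤ _ := by
              have := sq_sum_le_card_mul_sum_sq (s := (Finset.univ : Finset (ZMod N')))
                (f := fun r => ‖expSum c (resClass s N' r) ω‖)
              simpa [ZMod.card] using this
    _ = N' * wnorm w Q (fun ω => ∑ r : ZMod N', ‖expSum c (resClass s N' r) ω‖ ^ 2) :=
        wnorm_const_mul hQ hw (fun ω => Finset.sum_nonneg fun r _ => h0 r ω) (by positivity)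
    _ ≤ _ := by
        gcongr
        exact wnorm_sum_le hQ hw _ h0

theorem sum_norm_expSum_sq {N : ℕ} [NeZero N] (c : ℤ → ℂ) (s : Finset ℤ) :
    ∑ ω : Fin (1 + 1) → ZMod N, ‖expSum c s ω‖ ^ 2 =
      ∑ r : ZMod N, ∑ ω : Fin (1 + 1) → ZMod N, ‖expSum c (resClass s N r) ω‖ ^ 2 := by
  have key : ∀ (A : Finset ℤ), ∑ ω : Fin (1 + 1) → ZMod N, ((‖expSum c A ω‖ ^ 2 : ℝ) : ℂ) =
      ∑ x ∈ A, ∑ y ∈ A, c x * starRingEnd ℂ (c y) *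
        (if (x : ZMod N) = (y : ZMod N) then (N : ℂ) * N else 0) := by
    intro A
    have h1 : ∀ ω : Fin (1 + 1) → ZMod N, ((‖expSum c A ω‖ ^ 2 : ℝ) : ℂ) =
        ∑ x ∈ A, ∑ y ∈ A, c x * starRingEnd ℂ (c y) *
          ZMod.stdAddChar (ω 1 * ((x : ZMod N) - (y : ZMod N))) := by
      intro ω
      rw [Complex.ofReal_pow, ← Complex.mul_conj', expSum, map_sum, Finset.sum_mul_sum]
      refine Finset.sum_congr rfl fun x _ => Finset.sum_congr rfl fun y _ => ?_
      rw [map_mul, ← AddChar.map_neg_eq_conj, mul_mul_mul_comm, ← AddChar.map_add_eq_mul]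
      congr 2
      simp [polyEval, Fin.sum_univ_two]
      ring
    simp only [h1]
    rw [Finset.sum_comm]
    refine Finset.sum_congr rfl fun x _ => ?_
    rw [Finset.sum_comm]
    refine Finset.sum_congr rfl fun y _ => ?_
    rw [← Finset.mul_sum]
    congr 1
    calc ∑ ω : Fin (1 + 1) → ZMod N, (ZMod.stdAddChar (ω 1 * ((x : ZMod N) - (y : ZMod N))) : ℂ)
        = ∑ v : ZMod N × ZMod N, (ZMod.stdAddChar (v.2 * ((x : ZMod N) - (y : ZMod N))) : ℂ) :=
          Fintype.sum_equiv (finTwoArrowEquiv (ZMod N)) _ _ fun ω => rfl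
      _ = _ := by
          rw [Fintype.sum_prod_type]
          simp only [AddChar.sum_mulShift _ (ZMod.isPrimitive_stdAddChar N), sub_eq_zero]
          split_ifs <;> simp
  have h2 : ((∑ ω : Fin (1 + 1) → ZMod N, ‖expSum c s ω‖ ^ 2 : ℝ) : ℂ) =
      ((∑ r : ZMod N, ∑ ω : Fin (1 + 1) → ZMod N, ‖expSum c (resClass s N r) ω‖ ^ 2 : ℝ) : ℂ) := by
    rw [Complex.ofReal_sum, key, Complex.ofReal_sum]
    simp only [Complex.ofReal_sum, key]
    rw [← sum_resClass s N]
    refine Finset.sum_congr rfl fun r _ => Finset.sum_congr rfl fun x hx => ?_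
    rw [resClass, Finset.sum_filter]
    refine Finset.sum_congr rfl fun y _ => ?_
    have : (x : ZMod N) = r := (Finset.mem_filter.1 hx).2
    rw [this]
    by_cases h : (y : ZMod N) = r
    · simp [h]
    · simp [h, Ne.symm h]
  exact_mod_cast h2

theorem decoupling_one (p : ℕ) [Fact p.Prime] (n : ℕ) : Decoupling p 1 n 1 := by
  intro c s
  have gen : ∀ (N N' : ℕ) [NeZero N] [NeZero N'], N = N' →
      ∑ ω : Fin (1 + 1) → ZMod N, ‖expSum c s ω‖ ^ 2 =
      ∑ r : ZMod N', ∑ ω : Fin (1 + 1) → ZMod N, ‖expSum c (resClass s N' r) ω‖ ^ 2 := by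
    intro N N' _ _ h
    subst h
    exact sum_norm_expSum_sq c s
  have h1 := gen (p ^ (n * 1)) (p ^ n) (by rw [mul_one])
  have h2 : tri 1 = 1 := rfl
  simpa [wnorm, h2] using h1.le

open Polynomial in
theorem exists_poly_coeff {p : ℕ} [Fact p.Prime] {k l M : ℕ} (hpk : k < p) (hl : 0 < l)
    (hlk : l ≤ k) (hM : 0 < M) {u : ZMod (p ^ M)} (hu : IsUnit u) (v : Fin l → ZMod (p ^ M)) :
    ∃ G : (ZMod (p ^ M))[X], ((X - C u) ^ (k - l + 1) * G).natDegree ≤ k ∧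
      ∀ j : Fin l, ((X - C u) ^ (k - l + 1) * G).coeff (j + 1) = v j := by
  have hp : p.Prime := Fact.out
  have : Fact (1 < p ^ M) := ⟨Nat.one_lt_pow hM.ne' hp.one_lt⟩
  set d := k - l + 1 with hd
  let G : (Fin l → ZMod (p ^ M)) → (ZMod (p ^ M))[X] := fun g => ∑ i : Fin l, monomial (i : ℕ) (g i)
  have hGdeg : ∀ g, (G g).natDegree ≤ l - 1 := fun g =>
    natDegree_sum_le_of_forall_le _ _ fun i _ => (natDegree_monomial_le _).trans (by omega)
  have hGcoeff : ∀ g (i : Fin l), (G g).coeff i = g i := fun g i => by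
    simp [G, finsetSum_coeff, coeff_monomial, Fin.val_inj]
  have hmon : ∀ n : ℕ, ((X - C u) ^ n : (ZMod (p ^ M))[X]).Monic := fun n =>
    (monic_X_sub_C u).pow n
  have hWdeg : ∀ g, ((X - C u) ^ d * G g).natDegree ≤ k := fun g => by
    refine natDegree_mul_le.trans ?_
    rw [(monic_X_sub_C u).natDegree_pow, natDegree_X_sub_C]
    have := hGdeg g
    omega
  let Φ : (Fin l → ZMod (p ^ M)) →+ (Fin l → ZMod (p ^ M)) :=
    AddMonoidHom.mk' (fun g j => ((X - C u) ^ d * G g).coeff (j + 1)) fun a b => by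
      funext j
      have : G (a + b) = G a + G b := by simp [G, Finset.sum_add_distrib]
      simp [this, mul_add]
  have hinj : Function.Injective Φ := by
    rw [injective_iff_map_eq_zero]
    intro g hg
    set W := (X - C u) ^ d * G g with hW
    have hco : ∀ j < l, W.coeff (j + 1) = 0 := fun j hj => congrFun hg ⟨j, hj⟩
    have h1 : X ^ l ∣ derivative W := by
      rw [X_pow_dvd_iff]
      intro j hj
      rw [coeff_derivative, hco j hj, zero_mul]
    have h2 : (X - C u) ^ (d - 1) ∣ derivative W :=
      pow_sub_one_dvd_derivative_of_pow_dvd (dvd_mul_right _ _)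
    have hcop : IsCoprime (X : (ZMod (p ^ M))[X]) (X - C u) := by
      obtain ⟨a, ha⟩ := hu.exists_left_inv
      refine ⟨C a, -C a, ?_⟩
      have : C a * C u = (1 : (ZMod (p ^ M))[X]) := by rw [← C_mul, ha, C_1]
      linear_combination this
    have h3 : X ^ l * (X - C u) ^ (d - 1) ∣ derivative W := (hcop.pow).mul_dvd h1 h2
    have hk : 0 < k := hl.trans_le hlk
    have hder : derivative W = 0 := by
      by_contra hne
      refine ((monic_X_pow l).mul (hmon (d - 1))).not_dvd_of_natDegree_lt hne ?_ h3
      rw [(monic_X_pow l).natDegree_mul (hmon _), natDegree_X_pow, (monic_X_sub_C u).natDegree_pow,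
        natDegree_X_sub_C]
      have h5 := natDegree_derivative_le W
      have h6 : W.natDegree ≤ k := hWdeg g
      omega
    have hW0 : W = C (W.coeff 0) := by
      refine eq_C_of_natDegree_le_zero (natDegree_le_iff_coeff_eq_zero.2 fun j hj => ?_)
      rcases lt_or_ge k j with hj' | hj'
      · exact coeff_eq_zero_of_natDegree_lt ((hWdeg g).trans_lt hj')
      · have h4 : (derivative W).coeff (j - 1) = 0 := by rw [hder, coeff_zero]
        rw [coeff_derivative, Nat.sub_add_cancel hj, ← Nat.cast_add_one, Nat.sub_add_cancel hj] at h4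
        have hj1 : IsUnit (j : ZMod (p ^ M)) := by
          rw [ZMod.isUnit_iff_coprime]
          exact (Nat.coprime_of_lt_prime hj.ne' (by omega) hp).symm.pow_right M
        exact (hj1.mul_left_eq_zero).1 h4
    have hWz : W = 0 := by
      by_contra hne
      refine (hmon 1).not_dvd_of_natDegree_lt hne ?_
        ((pow_dvd_pow _ (by omega : 1 ≤ d)).trans (dvd_mul_right _ (G g)))
      rw [hW0, natDegree_C, (monic_X_sub_C u).natDegree_pow, natDegree_X_sub_C]
      norm_num
    have hG0 : G g = 0 := (hmon d).mul_right_eq_zero_iff.1 hWz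
    funext i
    rw [← hGcoeff g i, hG0, coeff_zero, Pi.zero_apply]
  obtain ⟨g, hg⟩ := Finite.injective_iff_surjective.1 hinj v
  exact ⟨G g, hWdeg g, fun j => congrFun hg j⟩

theorem expSum_empty {k N : ℕ} [NeZero N] (c : ℤ → ℂ) (ω : Fin (k + 1) → ZMod N) :
    expSum c ∅ ω = 0 := Finset.sum_empty

open Polynomial in
theorem wnorm_expSum_le_of_lower {p : ℕ} [Fact p.Prime] {k l a t b M : ℕ} (hpk : k < p)
    (hl : 0 < l) (hlk : l ≤ k) (hM : 0 < M) (hat : a ≤ t) (h1 : t * l ≤ a * (l + 1))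
    (h2 : t * l ≤ b * (k - l + 1)) (h3 : b * (k - l + 1) ≤ M) {D : ℝ} (hD : 0 ≤ D)
    (hdec : Decoupling p l (t - a) D) (c : ℤ → ℂ) (s s' : Finset ℤ) (x₀ y₀ : ℤ)
    (hs : ∀ x ∈ s, (p : ℤ) ^ a ∣ x - x₀) (hs' : ∀ y ∈ s', (p : ℤ) ^ b ∣ y - y₀)
    (hxy : ¬ (p : ℤ) ∣ y₀ - x₀) (E : ℕ) :
    wnorm (fun ω : Fin (k + 1) → ZMod (p ^ M) => ‖expSum c s' ω‖ ^ E) (tri l)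
        (fun ω => ‖expSum c s ω‖ ^ 2) ≤
      D * ∑ r : ZMod (p ^ t),
        wnorm (fun ω : Fin (k + 1) → ZMod (p ^ M) => ‖expSum c s' ω‖ ^ E) (tri l)
          (fun ω => ‖expSum c (resClass s (p ^ t) r) ω‖ ^ 2) := by
  have hp : p.Prime := Fact.out
  have hu : IsUnit ((y₀ - x₀ : ℤ) : ZMod (p ^ M)) := by
    rw [ZMod.coe_int_isUnit_iff_isCoprime]
    push_cast
    exact ((Nat.prime_iff_prime_int.1 hp).coprime_iff_not_dvd.2 hxy).pow_left
  have key : ∀ h : Fin (l + 1) → ZMod (p ^ ((t - a) * l)), ∃ G : (ZMod (p ^ M))[X],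
      ((X - C ((y₀ - x₀ : ℤ) : ZMod (p ^ M))) ^ (k - l + 1) * G).natDegree ≤ k ∧
      ∀ j : Fin (l + 1), (j : ℕ) ≠ 0 →
        ((X - C ((y₀ - x₀ : ℤ) : ZMod (p ^ M))) ^ (k - l + 1) * G).coeff j =
          ((h j).val : ZMod (p ^ M)) * (p : ZMod (p ^ M)) ^ (a * (l - j)) := by
    intro h
    obtain ⟨G, hG1, hG2⟩ := exists_poly_coeff hpk hl hlk hM hu
      (fun j : Fin l => ((h j.succ).val : ZMod (p ^ M)) * (p : ZMod (p ^ M)) ^ (a * (l - (j + 1))))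
    refine ⟨G, hG1, fun j hj => ?_⟩
    obtain ⟨i, rfl⟩ := Fin.exists_succ_eq.2 (fun h0 : j = 0 => hj (by rw [h0]; rfl))
    exact hG2 i
  choose G hG1 hG2 using key
  have htl : (t - a) * l + a * l = t * l := by rw [← add_mul, Nat.sub_add_cancel hat]
  refine wnorm_expSum_le_of_shift hl hat hD hdec (fun ω => by positivity)
    (fun h => shiftPhase p k M (M - (t - a) * l - a * l)
      ((X - C ((y₀ - x₀ : ℤ) : ZMod (p ^ M))) ^ (k - l + 1) * G h) x₀)
    (fun h ω => ?_) s x₀ hs (fun h => ?_) c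
  · congr 2
    refine Finset.sum_congr rfl fun y hy => ?_
    congr 2
    rw [polyEval_add, polyEval_shiftPhase (hG1 h), add_eq_left]
    obtain ⟨z, hz⟩ := hs' y hy
    have h4 : ((y - x₀ : ℤ) : ZMod (p ^ M)) - ((y₀ - x₀ : ℤ) : ZMod (p ^ M)) =
        (p : ZMod (p ^ M)) ^ b * (z : ZMod (p ^ M)) := by
      have : y - x₀ - (y₀ - x₀) = (p : ℤ) ^ b * z := by rw [← hz]; ring
      rw [← Int.cast_sub, this]
      push_cast
      rfl
    have h5 : (p : ZMod (p ^ M)) ^ (M - (t - a) * l - a * l + b * (k - l + 1)) = 0 :=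
      pow_prime_eq_zero (by omega)
    rw [pow_add, pow_mul] at h5
    rw [eval_mul, eval_pow, eval_sub, eval_X, eval_C, h4, mul_pow]
    linear_combination (z : ZMod (p ^ M)) ^ (k - l + 1) *
      (G h).eval ((y - x₀ : ℤ) : ZMod (p ^ M)) * h5
  · obtain ⟨θ, hθ, hph⟩ := stdAddChar_shiftPhase (hG1 h) hlk (by omega : (t - a) * l + a * l ≤ M)
      (Or.inl (by
        have : a * (l + 1) = a * l + a := by ring
        omega)) h (hG2 h) x₀
    exact ⟨θ, hθ, fun z _ => hph z⟩

theorem sum_resClass_resClass {N N' : ℕ} [NeZero N] [NeZero N'] (hN : N ∣ N') (s : Finset ℤ)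
    {g : Finset ℤ → ℝ} (hg : g ∅ = 0) :
    ∑ r : ZMod N, ∑ r' : ZMod N', g (resClass (resClass s N r) N' r') =
      ∑ r' : ZMod N', g (resClass s N' r') := by
  rw [Finset.sum_comm]
  refine Finset.sum_congr rfl fun r' _ => ?_
  have hcast : ∀ x ∈ resClass s N' r', (x : ZMod N) = ZMod.castHom hN (ZMod N) r' := by
    intro x hx
    rw [← (Finset.mem_filter.1 hx).2, map_intCast]
  rw [Finset.sum_eq_single (ZMod.castHom hN (ZMod N) r')]
  · congr 1
    ext x
    have := hcast x
    simp only [resClass, Finset.mem_filter] at this ⊢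
    tauto
  · intro r _ hr
    have : resClass (resClass s N r) N' r' = ∅ := by
      refine Finset.eq_empty_of_forall_notMem fun x hx => hr ?_
      simp only [resClass, Finset.mem_filter] at hx
      rw [← hx.1.2]
      exact hcast x (by simp only [resClass, Finset.mem_filter]; tauto)
    rw [this, hg]
  · simp

theorem exists_lower_decoupling {p : ℕ} [Fact p.Prime] {k l : ℕ} (hpk : k < p) (hl : 0 < l)
    (hlk : l ≤ k) (hD : ∀ P : ℝ, 1 < P → ∃ C : ℝ, 0 < C ∧ ∀ n, Decoupling p l n (C * P ^ n))
    {P : ℝ} (hP : 1 < P) :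
    ∃ K : ℝ, 1 ≤ K ∧ ∀ (t b M : ℕ), t * l ≤ b * (k - l + 1) → b * (k - l + 1) ≤ M → 0 < M →
      ∀ (c : ℤ → ℂ) (s s' : Finset ℤ) (x₀ y₀ : ℤ) (E : ℕ), (∀ x ∈ s, (p : ℤ) ∣ x - x₀) →
        (∀ y ∈ s', (p : ℤ) ^ b ∣ y - y₀) → ¬ (p : ℤ) ∣ y₀ - x₀ →
        wnorm (fun ω : Fin (k + 1) → ZMod (p ^ M) => ‖expSum c s' ω‖ ^ E) (tri l)
            (fun ω => ‖expSum c s ω‖ ^ 2) ≤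
          K * P ^ t * ∑ r : ZMod (p ^ t),
            wnorm (fun ω : Fin (k + 1) → ZMod (p ^ M) => ‖expSum c s' ω‖ ^ E) (tri l)
              (fun ω => ‖expSum c (resClass s (p ^ t) r) ω‖ ^ 2) := by
  have hp : p.Prime := Fact.out
  have hp1 : (1 : ℝ) ≤ p := by exact_mod_cast hp.one_le
  have htri : tri l ≠ 0 := (tri_pos hl).ne'
  set R := Real.sqrt P with hR
  have hR1 : 1 < R := by rw [hR, Real.lt_sqrt]; simpa using hP; norm_num
  have hRP : R ^ 2 = P := Real.sq_sqrt (by linarith)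
  obtain ⟨C, hC, hdec⟩ := hD R hR1
  obtain ⟨N₀, hN₀⟩ := pow_unbounded_of_one_lt C hR1
  set t₀ := (N₀ + 1) * (l + 1) with ht₀
  refine ⟨(p : ℝ) ^ t₀, one_le_pow₀ hp1, fun t => ?_⟩
  induction t using Nat.strong_induction_on with
  | _ t ih =>
  intro b M h1 h2 hM c s s' x₀ y₀ E hs hs' hxy
  have hw : ∀ ω : Fin (k + 1) → ZMod (p ^ M), 0 ≤ ‖expSum c s' ω‖ ^ E := fun ω => by positivity
  set g : Finset ℤ → ℝ := fun u =>
    wnorm (fun ω : Fin (k + 1) → ZMod (p ^ M) => ‖expSum c s' ω‖ ^ E) (tri l)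
      (fun ω => ‖expSum c u ω‖ ^ 2) with hg
  have hg0 : ∀ u, 0 ≤ g u := fun u => wnorm_nonneg hw fun ω => by positivity
  have hge : g ∅ = 0 := by
    simp only [hg, expSum_empty, norm_zero, ne_eq, OfNat.ofNat_ne_zero, not_false_eq_true, zero_pow]
    exact wnorm_zero htri
  have hsum0 : 0 ≤ ∑ r : ZMod (p ^ t), g (resClass s (p ^ t) r) := Finset.sum_nonneg fun r _ => hg0 _
  change g s ≤ (p : ℝ) ^ t₀ * P ^ t * ∑ r : ZMod (p ^ t), g (resClass s (p ^ t) r)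
  rcases lt_or_ge t t₀ with ht | ht
  · have h3 := wnorm_expSum_le_trivial (N' := p ^ t) htri hw c s
    refine h3.trans (mul_le_mul_of_nonneg_right ?_ hsum0)
    push_cast
    calc (p : ℝ) ^ t ≤ (p : ℝ) ^ t₀ := pow_le_pow_right₀ hp1 ht.le
      _ ≤ (p : ℝ) ^ t₀ * P ^ t := le_mul_of_one_le_right (by positivity) (one_le_pow₀ hP.le)
  · set a := t - t / (l + 1) with ha
    have hq : N₀ + 1 ≤ t / (l + 1) := by rwa [Nat.le_div_iff_mul_le (by omega)]
    have hqle : t / (l + 1) ≤ t := Nat.div_le_self _ _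
    have hqmul : t / (l + 1) * (l + 1) ≤ t := Nat.div_mul_le_self _ _
    have hat : a < t := by omega
    have hta : t - a = t / (l + 1) := by omega
    have ha0 : 0 < a := by
      have : t / (l + 1) * 2 ≤ t / (l + 1) * (l + 1) := Nat.mul_le_mul_left _ (by omega)
      omega
    have hal : t * l ≤ a * (l + 1) := by
      have : a + t / (l + 1) = t := by omega
      nlinarith
    have h4 := ih a hat b M ((Nat.mul_le_mul_right l hat.le).trans h1) h2 hM c s s' x₀ y₀ E hs hs' hxy
    change g s ≤ (p : ℝ) ^ t₀ * P ^ a * ∑ r : ZMod (p ^ a), g (resClass s (p ^ a) r) at h4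
    have h5 : ∀ r : ZMod (p ^ a), g (resClass s (p ^ a) r) ≤ C * R ^ (t - a) *
        ∑ r' : ZMod (p ^ t), g (resClass (resClass s (p ^ a) r) (p ^ t) r') := by
      intro r
      rcases (resClass s (p ^ a) r).eq_empty_or_nonempty with he | ⟨x₁, hx₁⟩
      · rw [he, hge]
        have : 0 ≤ ∑ r' : ZMod (p ^ t), g (resClass ∅ (p ^ t) r') :=
          Finset.sum_nonneg fun r _ => hg0 _
        positivity
      · have hx := Finset.mem_filter.1 hx₁
        refine wnorm_expSum_le_of_lower hpk hl hlk hM hat.le hal h1 h2 (by positivity) (hdec _) c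
          _ s' x₁ y₀ (fun x hx' => ?_) hs' (fun hd => hxy ?_) E
        · have hx' := Finset.mem_filter.1 hx'
          have := (ZMod.intCast_eq_intCast_iff_dvd_sub x₁ x (p ^ a)).1 (by rw [hx.2, hx'.2])
          exact_mod_cast this
        · have := dvd_add hd (hs x₁ hx.1)
          simpa using this
    have h6 : ∑ r : ZMod (p ^ a), g (resClass s (p ^ a) r) ≤
        C * R ^ (t - a) * ∑ r' : ZMod (p ^ t), g (resClass s (p ^ t) r') := by
      rw [← sum_resClass_resClass (pow_dvd_pow p hat.le) s hge, Finset.mul_sum]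
      exact Finset.sum_le_sum fun r _ => h5 r
    have h7 : C ≤ R ^ (t - a) :=
      hN₀.le.trans (pow_le_pow_right₀ hR1.le (by omega))
    generalize ∑ r' : ZMod (p ^ t), g (resClass s (p ^ t) r') = S at h6 hsum0 ⊢
    generalize ∑ r : ZMod (p ^ a), g (resClass s (p ^ a) r) = S₁ at h4 h6
    have hP0 : 0 < P := by linarith
    have hR0 : 0 < R := by linarith
    calc g s ≤ (p : ℝ) ^ t₀ * P ^ a * S₁ := h4
      _ ≤ (p : ℝ) ^ t₀ * P ^ a * (C * R ^ (t - a) * S) := by gcongr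
      _ ≤ (p : ℝ) ^ t₀ * P ^ a * (R ^ (t - a) * R ^ (t - a) * S) := by gcongr
      _ = (p : ℝ) ^ t₀ * (P ^ a * P ^ (t - a)) * S := by
          rw [← hRP, ← mul_pow, ← sq]
          ring
      _ = _ := by rw [← pow_add, Nat.add_sub_cancel' hat.le]

/-- The right hand side of the decoupling inequality at scale `p ^ n`. -/
noncomputable def decSum (p : ℕ) [Fact p.Prime] (k n : ℕ) (c : ℤ → ℂ) (s : Finset ℤ) : ℝ :=
  ∑ r : ZMod (p ^ n), wnorm 1 (tri k)
    (fun ω : Fin (k + 1) → ZMod (p ^ (n * k)) => ‖expSum c (resClass s (p ^ n) r) ω‖ ^ 2)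

/-- The mixed moment of two exponential sums of degree `k` at the critical exponent. -/
noncomputable def bilMoment (N k l : ℕ) [NeZero N] (c : ℤ → ℂ) (s s' : Finset ℤ) : ℝ :=
  ∑ ω : Fin (k + 1) → ZMod N,
    ‖expSum c s ω‖ ^ (2 * tri l) * ‖expSum c s' ω‖ ^ (2 * (tri k - tri l))

/-- The exponents gained by `t` rounds of the bilinear iteration. -/
noncomputable def gain (k : ℕ) : ℕ → ℕ → ℝ
  | 0, l => if l = 0 then 1 else 0
  | _ + 1, 0 => 1
  | t + 1, l + 1 =>
    ((k : ℝ) - (l + 1)) / ((k : ℝ) - l) * gain k t l + gain k t (k - (l + 1)) / (l + 1)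

theorem gain_zero_right (k t : ℕ) : gain k t 0 = 1 := by
  cases t <;> simp [gain]

theorem decSum_nonneg {p : ℕ} [Fact p.Prime] (k n : ℕ) (c : ℤ → ℂ) (s : Finset ℤ) :
    0 ≤ decSum p k n c s :=
  Finset.sum_nonneg fun _ _ => wnorm_nonneg (fun _ => zero_le_one) fun _ => by positivity

theorem bilMoment_nonneg (N k l : ℕ) [NeZero N] (c : ℤ → ℂ) (s s' : Finset ℤ) :
    0 ≤ bilMoment N k l c s s' :=
  Finset.sum_nonneg fun _ _ => by positivity

theorem sum_decSum_resClass {p : ℕ} [Fact p.Prime] {k n a : ℕ} (hk : 0 < k) (ha : a ≤ n)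
    (c : ℤ → ℂ) (s : Finset ℤ) :
    ∑ r : ZMod (p ^ a), decSum p k n c (resClass s (p ^ a) r) = decSum p k n c s :=
  sum_resClass_resClass (pow_dvd_pow p ha) s
    (g := fun u => wnorm 1 (tri k) fun ω : Fin (k + 1) → ZMod (p ^ (n * k)) => ‖expSum c u ω‖ ^ 2)
    (by
      simp only [expSum_empty, norm_zero, ne_eq, OfNat.ofNat_ne_zero, not_false_eq_true, zero_pow]
      exact wnorm_zero (tri_pos hk).ne')

theorem tri_exponent_identities (l d : ℕ) :
    tri (l + 1) * (d + 1) = tri l * d + (tri (l + 1 + d) - tri d) ∧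
      (tri (l + 1 + d) - tri (l + 1)) * (d + 1) = (tri (l + 1 + d) - tri l) * d + tri d := by
  obtain ⟨a, ha⟩ := Nat.exists_eq_add_of_le (tri_mono (by omega : d ≤ l + 1 + d))
  obtain ⟨b, hb⟩ := Nat.exists_eq_add_of_le (tri_mono (by omega : l + 1 ≤ l + 1 + d))
  obtain ⟨e, he⟩ := Nat.exists_eq_add_of_le (tri_mono (by omega : l ≤ l + 1 + d))
  have h1 := two_mul_tri (l + 1 + d)
  have h2 := two_mul_tri d
  have h3 := two_mul_tri (l + 1)
  have h4 := two_mul_tri l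
  have ea : tri (l + 1 + d) - tri d = a := by omega
  have eb : tri (l + 1 + d) - tri (l + 1) = b := by omega
  have ee : tri (l + 1 + d) - tri l = e := by omega
  rw [ea, eb, ee]
  zify at *
  constructor <;> nlinarith

theorem bilMoment_pow_le (N l d : ℕ) [NeZero N] (c : ℤ → ℂ) (s s' : Finset ℤ) :
    bilMoment N (l + 1 + d) (l + 1) c s s' ^ (d + 1) ≤
      bilMoment N (l + 1 + d) l c s s' ^ d * bilMoment N (l + 1 + d) d c s' s := by
  obtain ⟨h1, h2⟩ := tri_exponent_identities l d
  have := sum_pow_le_of_pow_le (Finset.univ : Finset (Fin (l + 1 + d + 1) → ZMod N))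
    (x := fun ω => ‖expSum c s ω‖ ^ (2 * tri l) *
      ‖expSum c s' ω‖ ^ (2 * (tri (l + 1 + d) - tri l)))
    (y := fun ω => ‖expSum c s' ω‖ ^ (2 * tri d) *
      ‖expSum c s ω‖ ^ (2 * (tri (l + 1 + d) - tri d)))
    (z := fun ω => ‖expSum c s ω‖ ^ (2 * tri (l + 1)) *
      ‖expSum c s' ω‖ ^ (2 * (tri (l + 1 + d) - tri (l + 1))))
    (fun _ _ => by positivity) (fun _ _ => by positivity) (fun _ _ => by positivity)
    (i := d) (j := 1) (by omega) fun ω _ => le_of_eq (by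
      rw [mul_pow, mul_pow, ← pow_mul, ← pow_mul, ← pow_mul, ← pow_mul, mul_assoc 2, mul_assoc 2,
        h1, h2]
      ring)
  simpa [bilMoment] using this

theorem bilMoment_zero {N k : ℕ} [NeZero N] (hk : 0 < k) (c : ℤ → ℂ) (s s' : Finset ℤ) :
    bilMoment N k 0 c s s' =
      wnorm 1 (tri k) (fun ω : Fin (k + 1) → ZMod N => ‖expSum c s' ω‖ ^ 2) ^ tri k := by
  rw [wnorm_pow (w := 1) (tri_pos hk).ne' (fun _ => zero_le_one) (fun _ => by positivity)]
  have : tri 0 = 0 := rfl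
  simp [bilMoment, this, pow_mul]

theorem bilMoment_eq_wnorm_pow {N k l : ℕ} [NeZero N] (hl : 0 < l) (c : ℤ → ℂ) (s s' : Finset ℤ) :
    bilMoment N k l c s s' =
      wnorm (fun ω : Fin (k + 1) → ZMod N => ‖expSum c s' ω‖ ^ (2 * (tri k - tri l))) (tri l)
        (fun ω => ‖expSum c s ω‖ ^ 2) ^ tri l := by
  rw [wnorm_pow (tri_pos hl).ne' (fun _ => by positivity) (fun _ => by positivity)]
  exact Finset.sum_congr rfl fun ω _ => by rw [← pow_mul, mul_comm]

theorem bilMoment_le_of_decoupling {p : ℕ} [Fact p.Prime] {k l n : ℕ} (hk : 0 < k) (hl : l ≤ k)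
    {D : ℝ} (hD : 0 ≤ D) (hdec : Decoupling p k n D) (c : ℤ → ℂ) (s s' : Finset ℤ) :
    bilMoment (p ^ (n * k)) k l c s s' ≤
      D ^ tri k * decSum p k n c s ^ tri l * decSum p k n c s' ^ (tri k - tri l) := by
  have hQ := tri_pos hk
  have hle := tri_mono hl
  have h1 : ∀ u, ∑ ω : Fin (k + 1) → ZMod (p ^ (n * k)), ‖expSum c u ω‖ ^ (2 * tri k) ≤
      (D * decSum p k n c u) ^ tri k := by
    intro u
    have h2 := wnorm_pow (w := 1) hQ.ne' (fun _ => zero_le_one)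
      (g := fun ω : Fin (k + 1) → ZMod (p ^ (n * k)) => ‖expSum c u ω‖ ^ 2)
      (fun _ => by positivity)
    simp only [Pi.one_apply, one_mul, ← pow_mul] at h2
    rw [← h2]
    exact pow_le_pow_left₀ (wnorm_nonneg (fun _ => zero_le_one) fun _ => by positivity) (hdec c u) _
  have key := sum_pow_le_of_pow_le (Finset.univ : Finset (Fin (k + 1) → ZMod (p ^ (n * k))))
    (x := fun ω => ‖expSum c s ω‖ ^ (2 * tri k)) (y := fun ω => ‖expSum c s' ω‖ ^ (2 * tri k))
    (z := fun ω => ‖expSum c s ω‖ ^ (2 * tri l) * ‖expSum c s' ω‖ ^ (2 * (tri k - tri l)))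
    (fun _ _ => by positivity) (fun _ _ => by positivity) (fun _ _ => by positivity)
    (i := tri l) (j := tri k - tri l) (by omega) fun ω _ => le_of_eq (by
      rw [Nat.add_sub_cancel' hle]
      ring)
  rw [Nat.add_sub_cancel' hle] at key
  have hs := decSum_nonneg (p := p) k n c s
  have hs' := decSum_nonneg (p := p) k n c s'
  refine le_of_pow_le_pow_left₀ hQ.ne' (by positivity) (key.trans ?_)
  calc _ ≤ ((D * decSum p k n c s) ^ tri k) ^ tri l *
        ((D * decSum p k n c s') ^ tri k) ^ (tri k - tri l) := by
        gcongr
        · exact h1 s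
        · exact h1 s'
    _ = _ := by
        have : (D ^ tri k) ^ tri k = (D ^ tri k) ^ tri l * (D ^ tri k) ^ (tri k - tri l) := by
          rw [← pow_add, Nat.add_sub_cancel' hle]
        rw [mul_pow, mul_pow, mul_pow _ _ (tri k), mul_pow _ _ (tri k), mul_pow _ _ (tri k), this]
        ring

theorem dvd_sub_of_mem_resClass {p a : ℕ} {s : Finset ℤ} {r : ZMod (p ^ a)} {x y : ℤ}
    (hx : x ∈ resClass s (p ^ a) r) (hy : y ∈ resClass s (p ^ a) r) : (p : ℤ) ^ a ∣ y - x := by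
  have := (ZMod.intCast_eq_intCast_iff_dvd_sub x y (p ^ a)).1
    (by rw [(Finset.mem_filter.1 hx).2, (Finset.mem_filter.1 hy).2])
  exact_mod_cast this

/-- Summation of bounds for mixed moments over the residue classes of the first sum. -/
theorem bilMoment_le_of_resClass {p : ℕ} [Fact p.Prime] {k l n a : ℕ} (hk : 0 < k) (hl : 0 < l)
    (ha : a ≤ n) (c : ℤ → ℂ) (s s' : Finset ℤ) {D U : ℝ} (hD : 0 ≤ D) (hU : 0 ≤ U)
    (hdec : wnorm (fun ω : Fin (k + 1) → ZMod (p ^ (n * k)) =>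
        ‖expSum c s' ω‖ ^ (2 * (tri k - tri l))) (tri l) (fun ω => ‖expSum c s ω‖ ^ 2) ≤
      D * ∑ r : ZMod (p ^ a), wnorm (fun ω : Fin (k + 1) → ZMod (p ^ (n * k)) =>
        ‖expSum c s' ω‖ ^ (2 * (tri k - tri l))) (tri l)
          (fun ω => ‖expSum c (resClass s (p ^ a) r) ω‖ ^ 2))
    (hr : ∀ r : ZMod (p ^ a), (resClass s (p ^ a) r).Nonempty →
      bilMoment (p ^ (n * k)) k l c (resClass s (p ^ a) r) s' ≤
        U * decSum p k n c (resClass s (p ^ a) r) ^ tri l) :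
    bilMoment (p ^ (n * k)) k l c s s' ≤ D ^ tri l * (U * decSum p k n c s ^ tri l) := by
  have hQ : tri l ≠ 0 := (tri_pos hl).ne'
  set V : ℝ := U ^ ((tri l : ℝ)⁻¹) with hV
  have hV0 : 0 ≤ V := Real.rpow_nonneg hU _
  have hVU : V ^ tri l = U := Real.rpow_inv_natCast_pow hU hQ
  set g : Finset ℤ → ℝ := fun u => wnorm (fun ω : Fin (k + 1) → ZMod (p ^ (n * k)) =>
    ‖expSum c s' ω‖ ^ (2 * (tri k - tri l))) (tri l) (fun ω => ‖expSum c u ω‖ ^ 2) with hg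
  have hg0 : ∀ u, 0 ≤ g u := fun u => wnorm_nonneg (fun _ => by positivity) fun _ => by positivity
  have hdec0 : ∀ u, 0 ≤ decSum p k n c u := fun u => decSum_nonneg k n c u
  have hgr : ∀ r : ZMod (p ^ a), g (resClass s (p ^ a) r) ≤
      V * decSum p k n c (resClass s (p ^ a) r) := by
    intro r
    rcases (resClass s (p ^ a) r).eq_empty_or_nonempty with he | hne
    · have : g ∅ = 0 := by
        simp only [hg, expSum_empty, norm_zero, ne_eq, OfNat.ofNat_ne_zero, not_false_eq_true,
          zero_pow]
        exact wnorm_zero hQ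
      rw [he, this]
      exact mul_nonneg hV0 (hdec0 _)
    · refine le_of_pow_le_pow_left₀ hQ (mul_nonneg hV0 (hdec0 _)) ?_
      rw [mul_pow, hVU, ← bilMoment_eq_wnorm_pow hl]
      exact hr r hne
  have h1 : g s ≤ D * (V * decSum p k n c s) := by
    rw [← sum_decSum_resClass hk ha c s, Finset.mul_sum]
    exact hdec.trans (mul_le_mul_of_nonneg_left (Finset.sum_le_sum fun r _ => hgr r) hD)
  rw [bilMoment_eq_wnorm_pow hl]
  refine (pow_le_pow_left₀ (hg0 s) h1 _).trans_eq ?_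
  rw [mul_pow, mul_pow, hVU]

theorem bilMoment_le_gain {p : ℕ} [Fact p.Prime] {k : ℕ} (hpk : k < p)
    (hlow : ∀ l, 0 < l → l < k → ∀ P : ℝ, 1 < P → ∃ C : ℝ, 0 < C ∧ ∀ n, Decoupling p l n (C * P ^ n))
    {H C₀ : ℝ} (hH : 1 ≤ H) (hC₀ : 0 < C₀) (hdec : ∀ n, Decoupling p k n (C₀ * H ^ n)) (t : ℕ) :
    ∀ l < k, ∀ P : ℝ, 1 < P → ∃ C : ℝ, 1 ≤ C ∧ ∀ n b : ℕ, 0 < b → k.factorial ^ t ∣ b →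
      b * k ^ t ≤ n → ∀ (c : ℤ → ℂ) (s s' : Finset ℤ) (x₀ y₀ : ℤ), (∀ x ∈ s, (p : ℤ) ∣ x - x₀) →
        (∀ y ∈ s', (p : ℤ) ^ b ∣ y - y₀) → ¬ (p : ℤ) ∣ y₀ - x₀ →
        bilMoment (p ^ (n * k)) k l c s s' ≤
          (C * P ^ n * H ^ ((n : ℝ) - gain k t l * b)) ^ tri k *
            decSum p k n c s ^ tri l * decSum p k n c s' ^ (tri k - tri l) := by
  have hH0 : 0 < H := by linarith
  have hzero : ∀ t, 0 < k → ∀ P : ℝ, 1 < P → ∃ C : ℝ, 1 ≤ C ∧ ∀ n b : ℕ, 0 < b →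
      k.factorial ^ t ∣ b →
      b * k ^ t ≤ n → ∀ (c : ℤ → ℂ) (s s' : Finset ℤ) (x₀ y₀ : ℤ), (∀ x ∈ s, (p : ℤ) ∣ x - x₀) →
        (∀ y ∈ s', (p : ℤ) ^ b ∣ y - y₀) → ¬ (p : ℤ) ∣ y₀ - x₀ →
        bilMoment (p ^ (n * k)) k 0 c s s' ≤
          (C * P ^ n * H ^ ((n : ℝ) - gain k t 0 * b)) ^ tri k *
            decSum p k n c s ^ tri 0 * decSum p k n c s' ^ (tri k - tri 0) := by
    intro t hk P hP
    refine ⟨max C₀ 1, le_max_right _ _, ?_⟩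
    intro n b hb _ hbn c s s' x₀ y₀ _ hs' _
    have hbn' : b ≤ n := (Nat.le_mul_of_pos_right b (by positivity)).trans hbn
    have h0 := decSum_nonneg (p := p) k n c s'
    rw [bilMoment_zero hk, gain_zero_right, one_mul]
    have ht0 : tri 0 = 0 := rfl
    rw [ht0, pow_zero, mul_one, Nat.sub_zero, ← mul_pow]
    refine pow_le_pow_left₀ (wnorm_nonneg (fun _ => zero_le_one) fun _ => by positivity) ?_ _
    refine (wnorm_expSum_le_of_class hk hbn' le_rfl (by positivity) (hdec (n - b)) s' y₀ hs' c).trans ?_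
    refine mul_le_mul_of_nonneg_right ?_ h0
    rw [← Nat.cast_sub hbn', Real.rpow_natCast]
    gcongr
    calc C₀ ≤ max C₀ 1 := le_max_left _ _
      _ ≤ max C₀ 1 * P ^ n := le_mul_of_one_le_right (by positivity) (one_le_pow₀ hP.le)
  induction t with
  | zero =>
    intro l hlk P hP
    rcases Nat.eq_zero_or_pos l with rfl | hl
    · exact hzero 0 hlk P hP
    refine ⟨max C₀ 1, le_max_right _ _, ?_⟩
    intro n b hb _ hbn c s s' x₀ y₀ _ hs' _
    have h1 := bilMoment_le_of_decoupling (hl.trans hlk) hlk.le (by positivity) (hdec n) c s s'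
    refine h1.trans ?_
    have hs0 := decSum_nonneg (p := p) k n c s
    have hs0' := decSum_nonneg (p := p) k n c s'
    have hg : gain k 0 l = 0 := by simp [gain, hl.ne']
    rw [hg, zero_mul, sub_zero, Real.rpow_natCast]
    gcongr
    calc C₀ ≤ max C₀ 1 := le_max_left _ _
      _ ≤ max C₀ 1 * P ^ n := le_mul_of_one_le_right (by positivity) (one_le_pow₀ hP.le)
  | succ t ih =>
    intro l hlk P hP
    rcases l with _ | l
    · exact hzero (t + 1) hlk P hP
    obtain ⟨d, rfl⟩ : ∃ d, k = l + 1 + d := Nat.exists_eq_add_of_le hlk.le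
    have hd : 0 < d := by omega
    set k := l + 1 + d with hk
    have hk0 : 0 < k := by omega
    set R := Real.sqrt P with hR
    have hR1 : 1 < R := by rw [hR, Real.lt_sqrt]; simpa using hP; norm_num
    have hRP : R ^ 2 = P := Real.sq_sqrt (by linarith)
    obtain ⟨K, hK1, hK⟩ := exists_lower_decoupling hpk (by omega : 0 < l + 1) hlk.le
      (hlow (l + 1) (by omega : 0 < l + 1) hlk) hR1
    obtain ⟨C₁, hC₁, ih₁⟩ := ih l (by omega) R hR1
    obtain ⟨C₂, hC₂, ih₂⟩ := ih d (by omega) R hR1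
    refine ⟨K * (C₁ * C₂), one_le_mul_of_one_le_of_one_le hK1
      (one_le_mul_of_one_le_of_one_le hC₁ hC₂), ?_⟩
    intro n b hb hdvd hbn c s s' x₀ y₀ hs hs' hxy
    have hlfac : k.factorial ^ t * (l + 1) ∣ b :=
      (mul_dvd_mul_left _ (Nat.dvd_factorial (by omega : 0 < l + 1) hlk.le)).trans
        (by rwa [pow_succ] at hdvd)
    obtain ⟨b', hb'⟩ := hlfac
    set a := k.factorial ^ t * b' * (d + 1) with ha
    have hal : a * (l + 1) = b * (d + 1) := by rw [ha, hb']; ring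
    have hak : a ≤ b * k := by
      have h1 : d + 1 ≤ k := by omega
      calc a ≤ a * (l + 1) := Nat.le_mul_of_pos_right _ (by omega)
        _ = b * (d + 1) := hal
        _ ≤ b * k := Nat.mul_le_mul_left _ h1
    have ha0 : 0 < a := by
      have : 0 < a * (l + 1) := by rw [hal]; positivity
      exact Nat.pos_of_mul_pos_right this
    have hakn : a * k ^ t ≤ n := by
      calc a * k ^ t ≤ b * k * k ^ t := Nat.mul_le_mul_right _ hak
        _ = b * k ^ (t + 1) := by ring
        _ ≤ n := hbn
    have han : a ≤ n := (Nat.le_mul_of_pos_right a (by positivity)).trans hakn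
    have hbkn : b * k ≤ n := by
      calc b * k ≤ b * k * k ^ t := Nat.le_mul_of_pos_right _ (by positivity)
        _ = b * k ^ (t + 1) := by ring
        _ ≤ n := hbn
    have hbtn : b * k ^ t ≤ n := by
      calc b * k ^ t ≤ b * k ^ t * k := Nat.le_mul_of_pos_right _ hk0
        _ = b * k ^ (t + 1) := by ring
        _ ≤ n := hbn
    have hbdvd : k.factorial ^ t ∣ b := (pow_dvd_pow _ (Nat.le_succ t)).trans hdvd
    have hadvd : k.factorial ^ t ∣ a := ⟨b' * (d + 1), by rw [ha]; ring⟩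
    have hkl : k - (l + 1) + 1 = d + 1 := by omega
    set S := decSum p k n c s with hS
    set S' := decSum p k n c s' with hS'
    have hS0 : 0 ≤ S := decSum_nonneg k n c s
    have hS0' : 0 ≤ S' := decSum_nonneg k n c s'
    set G : ℝ := C₁ * C₂ * R ^ n * H ^ ((n : ℝ) - gain k (t + 1) (l + 1) * b) with hG
    have hR0 : 0 < R := by linarith
    have hG0 : 0 ≤ G := by positivity
    have hgain : (H ^ ((n : ℝ) - gain k t l * b)) ^ d * H ^ ((n : ℝ) - gain k t d * a) =
        (H ^ ((n : ℝ) - gain k (t + 1) (l + 1) * b)) ^ (d + 1) := by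
      rw [← Real.rpow_mul_natCast hH0.le, ← Real.rpow_mul_natCast hH0.le, ← Real.rpow_add hH0]
      congr 1
      have h1 : (a : ℝ) * (l + 1) = b * (d + 1) := by exact_mod_cast hal
      have h2 : (a : ℝ) = b * (d + 1) / (l + 1) := by rw [← h1]; field_simp
      have h3 : (k : ℝ) = l + 1 + d := by rw [hk]; push_cast; ring
      have h4 : k - (l + 1) = d := by omega
      rw [gain, h4, h2, h3]
      push_cast
      have h5 : (l : ℝ) + 1 + d - l = d + 1 := by ring
      have h6 : (l : ℝ) + 1 + d - (l + 1) = d := by ring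
      rw [h5, h6]
      field_simp
      ring
    have hmain := bilMoment_le_of_resClass hk0 (by omega : 0 < l + 1) han c s s'
      (D := K * R ^ a) (U := G ^ tri k * S' ^ (tri k - tri (l + 1))) (by positivity) (by positivity)
      (hK a b (n * k) (by rw [hkl, hal]) (by
          rw [hkl]
          calc b * (d + 1) ≤ b * k := Nat.mul_le_mul_left _ (by omega)
            _ ≤ n := hbkn
            _ ≤ n * k := Nat.le_mul_of_pos_right _ hk0) (by
          have : 0 < n := ha0.trans_le han
          positivity) c s s' x₀ y₀ _ hs hs' hxy)
      (by
        rintro r ⟨x₁, hx₁⟩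
        have hx₁s : x₁ ∈ s := (Finset.mem_filter.1 hx₁).1
        set u := resClass s (p ^ a) r with hu
        have hus : ∀ x ∈ u, x ∈ s := fun x hx => (Finset.mem_filter.1 hx).1
        have hua : ∀ x ∈ u, (p : ℤ) ^ a ∣ x - x₁ := fun x hx => dvd_sub_of_mem_resClass hx₁ hx
        have hsy : ∀ y ∈ s', (p : ℤ) ∣ y - y₀ := fun y hy =>
          (dvd_pow_self _ hb.ne').trans (hs' y hy)
        have hxy₁ : ¬ (p : ℤ) ∣ x₁ - y₀ := fun hd => hxy (by
          have := dvd_sub (hs x₁ hx₁s) hd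
          have e1 : x₁ - x₀ - (x₁ - y₀) = y₀ - x₀ := by ring
          rwa [e1] at this)
        have j1 := ih₁ n b hb hbdvd hbtn c u s' x₀ y₀ (fun x hx => hs x (hus x hx)) hs' hxy
        have j2 := ih₂ n a ha0 hadvd hakn c s' u y₀ x₁ hsy hua hxy₁
        have hu0 : 0 ≤ decSum p k n c u := decSum_nonneg k n c u
        have j3 := bilMoment_pow_le (p ^ (n * k)) l d c u s'
        obtain ⟨i1, i2⟩ := tri_exponent_identities l d
        refine le_of_pow_le_pow_left₀ ((by omega : d + 1 ≠ 0)) (by positivity) (j3.trans ?_)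
        calc _ ≤ ((C₁ * R ^ n * H ^ ((n : ℝ) - gain k t l * b)) ^ tri k *
              decSum p k n c u ^ tri l * S' ^ (tri k - tri l)) ^ d *
              ((C₂ * R ^ n * H ^ ((n : ℝ) - gain k t d * a)) ^ tri k *
                S' ^ tri d * decSum p k n c u ^ (tri k - tri d)) := by
              gcongr
              · exact bilMoment_nonneg _ _ _ _ _ _
              · exact bilMoment_nonneg _ _ _ _ _ _
          _ = (C₁ ^ d * C₂ * (R ^ n) ^ (d + 1) * ((H ^ ((n : ℝ) - gain k t l * b)) ^ d *
                H ^ ((n : ℝ) - gain k t d * a))) ^ tri k *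
                decSum p k n c u ^ (tri l * d + (tri k - tri d)) *
                S' ^ ((tri k - tri l) * d + tri d) := by
              rw [pow_add (decSum p k n c u), pow_mul (decSum p k n c u), pow_add S', pow_mul S']
              ring
          _ ≤ (C₁ ^ (d + 1) * C₂ ^ (d + 1) * (R ^ n) ^ (d + 1) *
                (H ^ ((n : ℝ) - gain k (t + 1) (l + 1) * b)) ^ (d + 1)) ^ tri k *
                decSum p k n c u ^ (tri (l + 1) * (d + 1)) *
                S' ^ ((tri k - tri (l + 1)) * (d + 1)) := by
              rw [hgain, ← i1, ← i2]
              gcongr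
              · omega
              · exact le_self_pow₀ hC₂ (by omega)
          _ = _ := by
              rw [hG]
              ring)
    refine hmain.trans ?_
    have hle : tri (l + 1) ≤ tri k := tri_mono hlk.le
    calc (K * R ^ a) ^ tri (l + 1) * (G ^ tri k * S' ^ (tri k - tri (l + 1)) * S ^ tri (l + 1))
        ≤ (K * R ^ n) ^ tri k * (G ^ tri k * S' ^ (tri k - tri (l + 1)) * S ^ tri (l + 1)) := by
          refine mul_le_mul_of_nonneg_right ?_ (by positivity)
          calc (K * R ^ a) ^ tri (l + 1) ≤ (K * R ^ n) ^ tri (l + 1) := by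
                gcongr
                exact hR1.le
            _ ≤ _ := pow_le_pow_right₀
                (one_le_mul_of_one_le_of_one_le hK1 (one_le_pow₀ hR1.le)) hle
      _ = _ := by
          rw [hG, ← hRP]
          ring

theorem gain_nonneg {k : ℕ} (t : ℕ) : ∀ l ≤ k, 0 ≤ gain k t l := by
  induction t with
  | zero =>
    intro l _
    rw [gain]
    split_ifs <;> norm_num
  | succ t ih =>
    intro l hl
    rcases l with _ | l
    · simp [gain]
    · have h1 := ih l (by omega)
      have h2 := ih (k - (l + 1)) (by omega)
      have h3 : ((l : ℝ) + 1) ≤ k := by exact_mod_cast hl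
      have h4 : 0 ≤ (k : ℝ) - (l + 1) := by linarith
      have h5 : 0 ≤ (k : ℝ) - l := by linarith
      rw [gain]
      positivity

theorem sum_gain_succ (m t : ℕ) :
    ∑ i ∈ Finset.range m, gain (m + 1) (t + 1) (i + 1) =
      (m : ℝ) / (m + 1) + ∑ i ∈ Finset.range m, gain (m + 1) t (i + 1) := by
  have h1 : ∑ i ∈ Finset.range m, ((m : ℝ) - i) / (m + 1 - i) * gain (m + 1) t i =
      (m : ℝ) / (m + 1) +
        ∑ i ∈ Finset.range m, ((m : ℝ) - (i + 1)) / (m - i) * gain (m + 1) t (i + 1) := by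
    have h2 := Finset.sum_range_succ
      (fun i : ℕ => ((m : ℝ) - i) / (m + 1 - i) * gain (m + 1) t i) m
    have h3 := Finset.sum_range_succ'
      (fun i : ℕ => ((m : ℝ) - i) / (m + 1 - i) * gain (m + 1) t i) m
    simp only [sub_self, zero_div, zero_mul, add_zero] at h2
    rw [← h2, h3, gain_zero_right]
    simp only [Nat.cast_add, Nat.cast_one, Nat.cast_zero, sub_zero, mul_one]
    rw [add_comm]
    congr 1
    refine Finset.sum_congr rfl fun i _ => ?_
    congr 2
    ring
  have h4 : ∑ i ∈ Finset.range m, gain (m + 1) t (m - i) / ((i : ℝ) + 1) =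
      ∑ i ∈ Finset.range m, gain (m + 1) t (i + 1) / ((m : ℝ) - i) := by
    rw [← Finset.sum_range_reflect]
    refine Finset.sum_congr rfl fun i hi => ?_
    have hi' := Finset.mem_range.1 hi
    have e1 : m - (m - 1 - i) = i + 1 := by omega
    have e2 : (((m - 1 - i : ℕ) : ℝ) + 1) = m - i := by
      rw [← Nat.cast_add_one, show m - 1 - i + 1 = m - i by omega, Nat.cast_sub hi'.le]
    rw [e1, e2]
  calc ∑ i ∈ Finset.range m, gain (m + 1) (t + 1) (i + 1)
      = ∑ i ∈ Finset.range m, (((m : ℝ) - i) / (m + 1 - i) * gain (m + 1) t i +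
          gain (m + 1) t (m - i) / ((i : ℝ) + 1)) := by
        refine Finset.sum_congr rfl fun i _ => ?_
        rw [gain, Nat.add_sub_add_right]
        push_cast
        congr 3
        ring
    _ = _ := by
        rw [Finset.sum_add_distrib, h1, h4, add_assoc, ← Finset.sum_add_distrib]
        congr 1
        refine Finset.sum_congr rfl fun i hi => ?_
        have hi' : (i : ℝ) < m := by exact_mod_cast Finset.mem_range.1 hi
        have : (m : ℝ) - i ≠ 0 := by linarith
        field_simp
        ring

theorem exists_gain_ge {k : ℕ} (hk : 2 ≤ k) (A : ℝ) : ∃ t l, 0 < l ∧ l < k ∧ A ≤ gain k t l := by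
  obtain ⟨m, rfl⟩ : ∃ m, k = m + 1 := ⟨k - 1, by omega⟩
  have hm : 0 < (m : ℝ) := by exact_mod_cast (by omega : 0 < m)
  have hsum : ∀ t : ℕ, t * ((m : ℝ) / (m + 1)) ≤
      ∑ i ∈ Finset.range m, gain (m + 1) t (i + 1) := by
    intro t
    induction t with
    | zero =>
      rw [Nat.cast_zero, zero_mul]
      exact Finset.sum_nonneg fun i hi => gain_nonneg _ _ (by
        have := Finset.mem_range.1 hi
        omega)
    | succ t ih =>
      rw [sum_gain_succ]
      push_cast
      linarith
  obtain ⟨t, ht⟩ := exists_nat_gt (m * A / ((m : ℝ) / (m + 1)))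
  rw [div_lt_iff₀ (by positivity)] at ht
  by_contra! hcon
  have := Finset.sum_le_sum (s := Finset.range m) (f := fun i => gain (m + 1) t (i + 1))
    (g := fun _ => A) fun i hi => (hcon t (i + 1) (by omega) (by
      have := Finset.mem_range.1 hi
      omega)).le
  rw [Finset.sum_const, Finset.card_range, nsmul_eq_mul] at this
  linarith [hsum t]

/-- Fine decomposition of the second sum in a mixed moment. -/
theorem bilMoment_le_of_fine {p : ℕ} [Fact p.Prime] {k l n b : ℕ} (hk : 0 < k) (hlk : l < k)
    (hb : b ≤ n) (c : ℤ → ℂ) (s s' : Finset ℤ) {G : ℝ} (hG : 0 ≤ G)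
    (hfine : ∀ r : ZMod (p ^ b), (resClass s' (p ^ b) r).Nonempty →
      bilMoment (p ^ (n * k)) k l c s (resClass s' (p ^ b) r) ≤ G ^ tri k *
        decSum p k n c s ^ tri l * decSum p k n c (resClass s' (p ^ b) r) ^ (tri k - tri l)) :
    bilMoment (p ^ (n * k)) k l c s s' ≤ ((p : ℝ) ^ (2 * b) * G) ^ tri k *
      decSum p k n c s ^ tri l * decSum p k n c s' ^ (tri k - tri l) := by
  have hp1 : (1 : ℝ) ≤ p := by exact_mod_cast (Fact.out : p.Prime).one_lt.le
  have hp : (0 : ℝ) < p := by linarith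
  have hlt : tri l < tri k := (by rw [tri_succ]; omega : tri l < tri (l + 1)).trans_le
    (tri_mono hlk)
  obtain ⟨E, hE⟩ : ∃ E, tri k - tri l = E + 1 := ⟨tri k - tri l - 1, by omega⟩
  have hdec0 : ∀ u, 0 ≤ decSum p k n c u := fun u => decSum_nonneg k n c u
  have hpoint : ∀ ω : Fin (k + 1) → ZMod (p ^ (n * k)), ‖expSum c s' ω‖ ^ (2 * (tri k - tri l)) ≤
      (p : ℝ) ^ (2 * b * tri k) *
        ∑ r : ZMod (p ^ b), ‖expSum c (resClass s' (p ^ b) r) ω‖ ^ (2 * (tri k - tri l)) := by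
    intro ω
    have h1 : ‖expSum c s' ω‖ ≤ ∑ r : ZMod (p ^ b), ‖expSum c (resClass s' (p ^ b) r) ω‖ := by
      rw [expSum_eq_sum_resClass c s' ω (p ^ b)]
      exact norm_sum_le _ _
    obtain ⟨F, hF⟩ : ∃ F, 2 * (tri k - tri l) = F + 1 := ⟨2 * (tri k - tri l) - 1, by omega⟩
    rw [hF]
    refine (pow_le_pow_left₀ (norm_nonneg _) h1 _).trans ?_
    have h6 := pow_sum_le_card_mul_sum_pow (s := (Finset.univ : Finset (ZMod (p ^ b))))
      (f := fun r => ‖expSum c (resClass s' (p ^ b) r) ω‖) (fun r _ => norm_nonneg _) F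
    rw [Finset.card_univ, ZMod.card] at h6
    refine h6.trans ?_
    refine mul_le_mul_of_nonneg_right ?_ (Finset.sum_nonneg fun r _ => by positivity)
    push_cast
    rw [← pow_mul]
    refine pow_le_pow_right₀ hp1 ?_
    have h5 : F ≤ 2 * tri k := by omega
    calc b * F ≤ b * (2 * tri k) := Nat.mul_le_mul_left _ h5
      _ = 2 * b * tri k := by ring
  have h2 : bilMoment (p ^ (n * k)) k l c s s' ≤ (p : ℝ) ^ (2 * b * tri k) *
      ∑ r : ZMod (p ^ b), bilMoment (p ^ (n * k)) k l c s (resClass s' (p ^ b) r) := by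
    simp only [bilMoment]
    rw [Finset.sum_comm, Finset.mul_sum]
    refine Finset.sum_le_sum fun ω _ => ?_
    rw [← Finset.mul_sum, mul_left_comm]
    exact mul_le_mul_of_nonneg_left (hpoint ω) (by positivity)
  have h3 : ∀ r : ZMod (p ^ b), bilMoment (p ^ (n * k)) k l c s (resClass s' (p ^ b) r) ≤
      G ^ tri k * decSum p k n c s ^ tri l *
        decSum p k n c (resClass s' (p ^ b) r) ^ (tri k - tri l) := by
    intro r
    rcases (resClass s' (p ^ b) r).eq_empty_or_nonempty with he | hne
    · have : bilMoment (p ^ (n * k)) k l c s ∅ = 0 := by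
        refine Finset.sum_eq_zero fun ω _ => ?_
        rw [expSum_empty, norm_zero, zero_pow (by omega), mul_zero]
      rw [he, this]
      have h4 := hdec0 s
      have h5 := hdec0 ∅
      positivity
    · exact hfine r hne
  have h4 : ∑ r : ZMod (p ^ b), decSum p k n c (resClass s' (p ^ b) r) ^ (tri k - tri l) ≤
      decSum p k n c s' ^ (tri k - tri l) := by
    rw [← sum_decSum_resClass hk hb c s', hE]
    rw [pow_succ', Finset.sum_mul]
    refine Finset.sum_le_sum fun r hr => ?_
    rw [pow_succ']
    refine mul_le_mul_of_nonneg_left (pow_le_pow_left₀ (hdec0 _) ?_ _) (hdec0 _)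
    exact Finset.single_le_sum (f := fun r => decSum p k n c (resClass s' (p ^ b) r))
      (fun r _ => hdec0 _) hr
  have h5 := hdec0 s
  calc _ ≤ (p : ℝ) ^ (2 * b * tri k) *
        ∑ r : ZMod (p ^ b), G ^ tri k * decSum p k n c s ^ tri l *
          decSum p k n c (resClass s' (p ^ b) r) ^ (tri k - tri l) :=
        h2.trans (mul_le_mul_of_nonneg_left (Finset.sum_le_sum fun r _ => h3 r) (by positivity))
    _ ≤ (p : ℝ) ^ (2 * b * tri k) * (G ^ tri k * decSum p k n c s ^ tri l *
          decSum p k n c s' ^ (tri k - tri l)) := by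
        rw [← Finset.mul_sum]
        gcongr
    _ = _ := by
        rw [pow_mul, mul_pow]
        ring

theorem wnorm_mul_le_of_bilMoment {N k l : ℕ} [NeZero N] (hk : 0 < k) (hl : l ≤ k) (c : ℤ → ℂ)
    (s s' : Finset ℤ) {G S S' : ℝ} (hG : 0 ≤ G) (hS : 0 ≤ S) (hS' : 0 ≤ S')
    (h : bilMoment N k l c s s' ≤ G ^ tri k * S ^ tri l * S' ^ (tri k - tri l))
    (h' : bilMoment N k l c s' s ≤ G ^ tri k * S' ^ tri l * S ^ (tri k - tri l)) :
    wnorm 1 (tri k) (fun ω : Fin (k + 1) → ZMod N => ‖expSum c s ω‖ * ‖expSum c s' ω‖) ≤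
      G * ((S + S') / 2) := by
  have hQ := (tri_pos hk).ne'
  have hle := tri_mono hl
  obtain ⟨E, hE⟩ := Nat.exists_eq_add_of_le hle
  have hE' : tri k - tri l = E := by omega
  refine le_of_pow_le_pow_left₀ (n := tri k * 2) (by omega) (by positivity) ?_
  rw [pow_mul, wnorm_pow (w := 1) hQ (fun _ => zero_le_one) (fun _ => by positivity)]
  have key := sum_pow_le_of_pow_le (Finset.univ : Finset (Fin (k + 1) → ZMod N))
    (x := fun ω => ‖expSum c s ω‖ ^ (2 * tri l) * ‖expSum c s' ω‖ ^ (2 * (tri k - tri l)))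
    (y := fun ω => ‖expSum c s' ω‖ ^ (2 * tri l) * ‖expSum c s ω‖ ^ (2 * (tri k - tri l)))
    (z := fun ω => (1 : (Fin (k + 1) → ZMod N) → ℝ) ω *
      (‖expSum c s ω‖ * ‖expSum c s' ω‖) ^ tri k)
    (fun _ _ => by positivity) (fun _ _ => by positivity)
    (fun _ _ => by simp only [Pi.one_apply]; positivity) (i := 1) (j := 1) (by norm_num)
    (fun ω _ => by
      rw [hE', hE, Pi.one_apply]
      refine le_of_eq ?_
      ring)
  simp only [pow_one] at key
  have h0 := bilMoment_nonneg N k l c s s'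
  have h0' := bilMoment_nonneg N k l c s' s
  calc _ ≤ bilMoment N k l c s s' * bilMoment N k l c s' s := key
    _ ≤ (G ^ tri k * S ^ tri l * S' ^ (tri k - tri l)) *
        (G ^ tri k * S' ^ tri l * S ^ (tri k - tri l)) := mul_le_mul h h' h0' (by positivity)
    _ = (G ^ 2 * (S * S')) ^ tri k := by
        rw [hE', hE]
        ring
    _ ≤ (G ^ 2 * ((S + S') / 2) ^ 2) ^ tri k := by
        gcongr
        nlinarith [sq_nonneg (S - S')]
    _ = _ := by rw [← mul_pow, ← pow_mul, mul_comm 2]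

/-- One step of the bilinear-to-linear reduction. -/
theorem decoupling_of_bilMoment {p : ℕ} [Fact p.Prime] {k l n : ℕ} (hk : 0 < k) (hl : l ≤ k)
    {D B : ℝ} (hD : 0 ≤ D) (hB : 0 ≤ B) (hdec : Decoupling p k n D)
    (hbil : ∀ (c : ℤ → ℂ) (s s' : Finset ℤ) (x₀ y₀ : ℤ), (∀ x ∈ s, (p : ℤ) ∣ x - x₀) →
      (∀ y ∈ s', (p : ℤ) ∣ y - y₀) → ¬ (p : ℤ) ∣ y₀ - x₀ →
      bilMoment (p ^ ((n + 1) * k)) k l c s s' ≤ B ^ tri k * decSum p k (n + 1) c s ^ tri l *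
        decSum p k (n + 1) c s' ^ (tri k - tri l)) :
    Decoupling p k (n + 1) (D + p * B) := by
  intro c s
  have hQ := (tri_pos hk).ne'
  have h1 : ∀ ω : Fin (k + 1) → ZMod (p ^ ((n + 1) * k)),
      0 ≤ (1 : (Fin (k + 1) → ZMod (p ^ ((n + 1) * k))) → ℝ) ω := fun _ => zero_le_one
  have hS0 : ∀ u, 0 ≤ decSum p k (n + 1) c u := fun u => decSum_nonneg _ _ _ _
  have hmem : ∀ r : ZMod p, ∀ x ∈ resClass s p r, (p : ℤ) ∣ x - (r.val : ℤ) := by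
    intro r x hx
    refine (ZMod.intCast_eq_intCast_iff_dvd_sub _ _ _).1 ?_
    rw [(Finset.mem_filter.1 hx).2]
    simp
  set f : ZMod p → (Fin (k + 1) → ZMod (p ^ ((n + 1) * k))) → ℝ :=
    fun r ω => ‖expSum c (resClass s p r) ω‖ with hf
  set S : ZMod p → ℝ := fun r => decSum p k (n + 1) c (resClass s p r) with hS
  have hf0 : ∀ r ω, 0 ≤ f r ω := fun r ω => norm_nonneg _
  have hdiag : ∀ r, wnorm 1 (tri k) (fun ω => f r ω * f r ω) ≤ D * S r := by
    intro r
    have := wnorm_expSum_le_of_class hk (by omega : 1 ≤ n + 1) le_rfl hD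
      (by rwa [Nat.add_sub_cancel]) (resClass s p r) r.val (by simpa using hmem r) c
    simpa only [hf, hS, decSum, ← sq] using this
  have hoff : ∀ r r', r ≠ r' → wnorm 1 (tri k) (fun ω => f r ω * f r' ω) ≤
      B * ((S r + S r') / 2) := by
    have hne : ∀ r r' : ZMod p, r ≠ r' → ¬ (p : ℤ) ∣ (r'.val : ℤ) - r.val := by
      intro r r' hrr hd
      refine hrr ?_
      have := (ZMod.intCast_eq_intCast_iff_dvd_sub _ _ _).2 hd
      simpa using this
    intro r r' hrr
    exact wnorm_mul_le_of_bilMoment hk hl c _ _ hB (hS0 _) (hS0 _)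
      (hbil c _ _ _ _ (hmem r) (hmem r') (hne r r' hrr))
      (hbil c _ _ _ _ (hmem r') (hmem r) (hne r' r hrr.symm))
  have hpair : ∀ r r', wnorm 1 (tri k) (fun ω => f r ω * f r' ω) ≤
      (if r = r' then D * S r else 0) + B * ((S r + S r') / 2) := by
    intro r r'
    have h0 : 0 ≤ B * ((S r + S r') / 2) :=
      mul_nonneg hB (div_nonneg (add_nonneg (hS0 _) (hS0 _)) (by norm_num))
    split_ifs with h
    · subst h
      linarith [hdiag r]
    · rw [zero_add]
      exact hoff r r' h
  have hSsum : ∑ r, S r = decSum p k (n + 1) c s := by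
    exact sum_resClass_resClass (dvd_pow_self p n.succ_ne_zero) s
      (g := fun u => wnorm 1 (tri k)
        fun ω : Fin (k + 1) → ZMod (p ^ ((n + 1) * k)) => ‖expSum c u ω‖ ^ 2) (by
        simp only [expSum_empty, norm_zero, ne_eq, OfNat.ofNat_ne_zero, not_false_eq_true, zero_pow]
        exact wnorm_zero hQ)
  calc wnorm 1 (tri k) (fun ω => ‖expSum c s ω‖ ^ 2)
      ≤ wnorm 1 (tri k) (fun ω => ∑ r, ∑ r', f r ω * f r' ω) := by
        refine wnorm_mono h1 (fun _ => by positivity) fun ω => ?_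
        rw [← Finset.sum_mul_sum, ← sq]
        refine pow_le_pow_left₀ (norm_nonneg _) ?_ 2
        rw [expSum_eq_sum_resClass c s ω p]
        exact norm_sum_le _ _
    _ ≤ ∑ r, ∑ r', wnorm 1 (tri k) (fun ω => f r ω * f r' ω) := by
        refine (wnorm_sum_le hQ h1 _ fun r ω => Finset.sum_nonneg fun r' _ =>
          mul_nonneg (hf0 _ _) (hf0 _ _)).trans ?_
        refine Finset.sum_le_sum fun r _ => ?_
        exact wnorm_sum_le hQ h1 _ fun r' ω => mul_nonneg (hf0 _ _) (hf0 _ _)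
    _ ≤ ∑ r, ∑ r', ((if r = r' then D * S r else 0) + B * ((S r + S r') / 2)) :=
        Finset.sum_le_sum fun r _ => Finset.sum_le_sum fun r' _ => hpair r r'
    _ = (D + p * B) * ∑ r, S r := by
        simp only [Finset.sum_add_distrib, Finset.sum_ite_eq, Finset.mem_univ, if_true,
          ← Finset.mul_sum, ← Finset.sum_div, Finset.sum_const, Finset.card_univ, ZMod.card,
          nsmul_eq_mul]
        ring
    _ = _ := by rw [hSsum, decSum]

theorem Decoupling.mono {p : ℕ} [Fact p.Prime] {k n : ℕ} {D D' : ℝ} (h : Decoupling p k n D)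
    (hD : D ≤ D') : Decoupling p k n D' := fun c s =>
  (h c s).trans (mul_le_mul_of_nonneg_right hD (decSum_nonneg k n c s))

theorem decoupling_trivial (p : ℕ) [Fact p.Prime] {k : ℕ} (hk : 0 < k) (n : ℕ) :
    Decoupling p k n ((p : ℝ) ^ n) := fun c s => by
  have := wnorm_expSum_le_trivial (k := k) (N := p ^ (n * k)) (N' := p ^ n) (tri_pos hk).ne'
    (w := 1) (fun _ => zero_le_one) c s
  rwa [Nat.cast_pow] at this

theorem decoupling_improve {p : ℕ} [Fact p.Prime] {k : ℕ} (hk : 2 ≤ k) (hpk : k < p)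
    (hlow : ∀ l, 0 < l → l < k → ∀ P : ℝ, 1 < P → ∃ C : ℝ, 0 < C ∧ ∀ n, Decoupling p l n (C * P ^ n))
    {H₀ : ℝ} (hH₀ : 1 < H₀) :
    ∃ μ : ℝ, 0 < μ ∧ μ < 1 ∧ ∀ H : ℝ, H₀ ≤ H →
      (∃ C : ℝ, 0 < C ∧ ∀ n, Decoupling p k n (C * H ^ n)) →
        ∃ C : ℝ, 0 < C ∧ ∀ n, Decoupling p k n (C * max (H * μ) H₀ ^ n) := by
  have hp1 : (1 : ℝ) < p := by exact_mod_cast (Fact.out : p.Prime).one_lt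
  have hp0 : (0 : ℝ) < p := by linarith
  obtain ⟨A, hA⟩ := pow_unbounded_of_one_lt ((p : ℝ) ^ 3) hH₀
  obtain ⟨t, l, hl0, hlk, hgain⟩ := exists_gain_ge hk A
  set m := (k.factorial * k) ^ t with hm
  have hm0 : 0 < m := by positivity
  set ρ : ℝ := (p : ℝ) ^ (((2 * m : ℕ) : ℝ)⁻¹) with hρ
  have hρ1 : 1 < ρ := Real.one_lt_rpow hp1 (by positivity)
  have hρ0 : 0 < ρ := by linarith
  have hρp : ρ ^ (2 * m) = p := Real.rpow_inv_natCast_pow hp0.le (by positivity)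
  refine ⟨ρ⁻¹, by positivity, inv_lt_one_of_one_lt₀ hρ1, ?_⟩
  rintro H hH ⟨C₀, hC₀, hdec⟩
  have hH1 : 1 ≤ H := by linarith
  have hH0 : 0 < H := by linarith
  obtain ⟨C, hC1, hC⟩ := bilMoment_le_gain hpk hlow hH1 hC₀ hdec t l hlk ρ hρ1
  set C₁ : ℝ := (C + C₀) * p with hC₁
  have hC₁0 : 0 < C₁ := by positivity
  have hbil : ∀ n (c : ℤ → ℂ) (s s' : Finset ℤ) (x₀ y₀ : ℤ), (∀ x ∈ s, (p : ℤ) ∣ x - x₀) →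
      (∀ y ∈ s', (p : ℤ) ∣ y - y₀) → ¬ (p : ℤ) ∣ y₀ - x₀ →
      bilMoment (p ^ (n * k)) k l c s s' ≤ (C₁ * (H * ρ⁻¹) ^ n) ^ tri k *
        decSum p k n c s ^ tri l * decSum p k n c s' ^ (tri k - tri l) := by
    intro n c s s' x₀ y₀ hs hs' hxy
    have hS := decSum_nonneg (p := p) k n c s
    have hS' := decSum_nonneg (p := p) k n c s'
    obtain ⟨a, ha⟩ : ∃ a, n / m = a := ⟨_, rfl⟩
    have ham : a * m ≤ n := by rw [← ha]; exact Nat.div_mul_le_self n m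
    have han : n ≤ m * (a + 1) := by
      rw [← ha]
      exact (Nat.lt_mul_div_succ n hm0).le
    have hkey : ρ ^ n ≤ (p : ℝ) ^ (a + 1) * (ρ⁻¹) ^ n := by
      rw [inv_pow, ← div_eq_mul_inv, le_div_iff₀ (by positivity), ← pow_add, ← hρp, ← pow_mul]
      exact pow_le_pow_right₀ hρ1.le (by nlinarith)
    rcases Nat.eq_zero_or_pos a with rfl | ha0
    · have h1 := bilMoment_le_of_decoupling (by omega) hlk.le (by positivity) (hdec n) c s s'
      refine h1.trans ?_
      suffices key : C₀ * H ^ n ≤ C₁ * (H * ρ⁻¹) ^ n by gcongr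
      rw [zero_add, pow_one] at hkey
      have h2 : 1 ≤ (p : ℝ) * ρ⁻¹ ^ n := (one_le_pow₀ hρ1.le).trans hkey
      calc C₀ * H ^ n ≤ (C + C₀) * H ^ n * 1 := by
            rw [mul_one]
            gcongr
            linarith
        _ ≤ (C + C₀) * H ^ n * (p * ρ⁻¹ ^ n) := by gcongr
        _ = _ := by rw [hC₁, mul_pow]; ring
    · set b := k.factorial ^ t * a with hb
      have hfac : 0 < k.factorial ^ t := by positivity
      have hb0 : 0 < b := by positivity
      have hab : a ≤ b := Nat.le_mul_of_pos_left a hfac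
      have hbk : b * k ^ t ≤ n := by
        calc b * k ^ t = a * m := by rw [hb, hm, mul_pow]; ring
          _ ≤ n := ham
      have hbn : b ≤ n := (Nat.le_mul_of_pos_right b (by positivity)).trans hbk
      set G : ℝ := C * ρ ^ n * H ^ ((n : ℝ) - gain k t l * b) with hG
      have hfine := bilMoment_le_of_fine (by omega) hlk hbn c s s' (G := G) (by positivity) (by
        rintro r ⟨y₁, hy₁⟩
        have hy₁s := (Finset.mem_filter.1 hy₁).1
        refine hC n b hb0 (Dvd.intro _ rfl) hbk c s _ x₀ y₁ hs
          (fun y hy => dvd_sub_of_mem_resClass hy₁ hy) fun hd => hxy ?_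
        have := dvd_sub hd (hs' y₁ hy₁s)
        have e1 : y₁ - x₀ - (y₁ - y₀) = y₀ - x₀ := by ring
        rwa [e1] at this)
      refine hfine.trans ?_
      suffices key : (p : ℝ) ^ (2 * b) * G ≤ C₁ * (H * ρ⁻¹) ^ n by gcongr
      have h1 : H ^ ((n : ℝ) - gain k t l * b) * (p : ℝ) ^ (3 * b) ≤ H ^ n := by
        have h2 : (p : ℝ) ^ (3 * b) ≤ H ^ ((A : ℝ) * b) := by
          rw [Real.rpow_mul hH0.le, Real.rpow_natCast, Real.rpow_natCast, pow_mul]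
          gcongr
          exact hA.le.trans (pow_le_pow_left₀ (by linarith) hH _)
        calc _ ≤ H ^ ((n : ℝ) - gain k t l * b) * H ^ ((A : ℝ) * b) := by gcongr
          _ = H ^ ((n : ℝ) - gain k t l * b + A * b) := (Real.rpow_add hH0 _ _).symm
          _ ≤ H ^ (n : ℝ) := by
            refine Real.rpow_le_rpow_of_exponent_le hH1 ?_
            have : (A : ℝ) * b ≤ gain k t l * b := by gcongr
            linarith
          _ = H ^ n := Real.rpow_natCast _ _
      have hpb : 0 < (p : ℝ) ^ b := by positivity
      have h3 : (p : ℝ) ^ (2 * b) * H ^ ((n : ℝ) - gain k t l * b) * (p : ℝ) ^ (a + 1) ≤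
          p * H ^ n := by
        calc (p : ℝ) ^ (2 * b) * H ^ ((n : ℝ) - gain k t l * b) * (p : ℝ) ^ (a + 1)
            ≤ (p : ℝ) ^ (2 * b) * H ^ ((n : ℝ) - gain k t l * b) * (p : ℝ) ^ (b + 1) := by
              gcongr
              exact hp1.le
          _ = p * (H ^ ((n : ℝ) - gain k t l * b) * (p : ℝ) ^ (3 * b)) := by ring
          _ ≤ _ := by gcongr
      calc (p : ℝ) ^ (2 * b) * G
          ≤ (p : ℝ) ^ (2 * b) * (C * ((p : ℝ) ^ (a + 1) * (ρ⁻¹) ^ n) *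
              H ^ ((n : ℝ) - gain k t l * b)) := by rw [hG]; gcongr
        _ = C * ρ⁻¹ ^ n *
              ((p : ℝ) ^ (2 * b) * H ^ ((n : ℝ) - gain k t l * b) * (p : ℝ) ^ (a + 1)) := by ring
        _ ≤ (C + C₀) * ρ⁻¹ ^ n * (p * H ^ n) := by
          gcongr
          linarith
        _ = _ := by rw [hC₁, mul_pow]; ring
  set H' := max (H * ρ⁻¹) H₀ with hH'
  have hH'1 : 1 < H' := hH₀.trans_le (le_max_right _ _)
  have hH'0 : 0 < H' - 1 := by linarith
  have hH'pos : 0 < H' := by linarith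
  set C₂ := 1 + p * C₁ * H' / (H' - 1) with hC₂
  have hC₂0 : 0 < C₂ := by positivity
  refine ⟨C₂, hC₂0, fun n => ?_⟩
  induction n with
  | zero =>
    refine (decoupling_trivial p (by omega) 0).mono ?_
    rw [pow_zero, pow_zero, mul_one, hC₂]
    have : 0 ≤ p * C₁ * H' / (H' - 1) := by positivity
    linarith
  | succ n ih =>
    refine (decoupling_of_bilMoment (by omega) hlk.le (by positivity)
      (B := C₁ * (H * ρ⁻¹) ^ (n + 1)) (by positivity) ih (hbil (n + 1))).mono ?_
    have h1 : (H * ρ⁻¹) ^ (n + 1) ≤ H' ^ (n + 1) :=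
      pow_le_pow_left₀ (by positivity) (le_max_left _ _) _
    have h2 : p * C₁ * H' ≤ C₂ * (H' - 1) := by
      rw [hC₂, add_mul, div_mul_cancel₀ _ hH'0.ne']
      linarith
    calc C₂ * H' ^ n + p * (C₁ * (H * ρ⁻¹) ^ (n + 1))
        ≤ C₂ * H' ^ n + p * (C₁ * H' ^ (n + 1)) := by gcongr
      _ = (C₂ + p * C₁ * H') * H' ^ n := by ring
      _ ≤ (C₂ + C₂ * (H' - 1)) * H' ^ n := by gcongr
      _ = _ := by ring

theorem exists_decoupling (p : ℕ) [Fact p.Prime] (k : ℕ) (hk : 0 < k) (hpk : k < p) :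
    ∀ P : ℝ, 1 < P → ∃ C : ℝ, 0 < C ∧ ∀ n, Decoupling p k n (C * P ^ n) := by
  induction k using Nat.strong_induction_on with
  | _ k ih =>
    intro P hP
    rcases Nat.lt_or_ge k 2 with hk2 | hk2
    · obtain rfl : k = 1 := by omega
      exact ⟨1, one_pos, fun n => (decoupling_one p n).mono (by
        rw [one_mul]
        exact one_le_pow₀ hP.le)⟩
    obtain ⟨μ, hμ0, hμ1, himp⟩ := decoupling_improve hk2 hpk
      (fun l hl hlk => ih l hlk hl (hlk.trans hpk)) hP
    have hp1 : (1 : ℝ) ≤ p := by exact_mod_cast (Fact.out : p.Prime).one_lt.le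
    have hiter : ∀ j : ℕ, ∃ C : ℝ, 0 < C ∧ ∀ n, Decoupling p k n (C * max (p * μ ^ j) P ^ n) := by
      intro j
      induction j with
      | zero =>
        refine ⟨1, one_pos, fun n => (decoupling_trivial p hk n).mono ?_⟩
        rw [one_mul, pow_zero, mul_one]
        gcongr
        exact le_max_left _ _
      | succ j ihj =>
        obtain ⟨C, hC, h⟩ := himp _ (le_max_right _ _) ihj
        refine ⟨C, hC, fun n => (h n).mono ?_⟩
        refine mul_le_mul_of_nonneg_left (pow_le_pow_left₀ (le_max_of_le_right (by linarith))
          (max_le ?_ (le_max_right _ _)) n) hC.le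
        rcases le_total (p * μ ^ j) P with h1 | h1
        · rw [max_eq_right h1]
          refine le_max_of_le_right ?_
          nlinarith
        · rw [max_eq_left h1, pow_succ, mul_assoc]
          exact le_max_left _ _
    obtain ⟨j, hj⟩ := exists_pow_lt_of_lt_one (div_pos (by linarith : 0 < P) (by linarith : (0 : ℝ) < p)) hμ1
    obtain ⟨C, hC, h⟩ := hiter j
    refine ⟨C, hC, fun n => ?_⟩
    have h1 : p * μ ^ j ≤ P := by
      rw [lt_div_iff₀ (by linarith)] at hj
      linarith
    rw [← max_eq_right h1]
    exact h n

/-- The exponential sum over `0 ≤ x < u` with polynomial phase `ω`. -/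
noncomputable def weylSum {k N : ℕ} [NeZero N] (u : ℕ) (ω : Fin (k + 1) → ZMod N) : ℂ :=
  ∑ x ∈ Finset.range u, ZMod.stdAddChar (polyEval ω x)

theorem weylSum_eq_expSum {k N : ℕ} [NeZero N] (u : ℕ) (ω : Fin (k + 1) → ZMod N) :
    weylSum u ω = expSum (fun _ => 1) ((Finset.range u).map Nat.castEmbedding) ω := by
  simp [weylSum, expSum]

/-- Vinogradov's mean value theorem at the critical exponent. -/
theorem sum_norm_weylSum_pow_le (p : ℕ) [Fact p.Prime] {k : ℕ} (hk : 0 < k) (hpk : k < p) {ε : ℝ}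
    (hε : 0 < ε) : ∃ C : ℝ, 0 < C ∧ ∀ n u : ℕ, u ≤ p ^ n →
      ∑ ω : Fin (k + 1) → ZMod (p ^ (n * k)), ‖weylSum u ω‖ ^ (2 * tri k) ≤
        C * ((p : ℝ) ^ n) ^ ε * u ^ tri k * ((p : ℝ) ^ (n * k)) ^ (k + 1) := by
  have hp1 : (1 : ℝ) < p := by exact_mod_cast (Fact.out : p.Prime).one_lt
  have hp0 : (0 : ℝ) < p := by linarith
  have hQ := tri_pos hk
  obtain ⟨C, hC, hdec⟩ := exists_decoupling p k hk hpk ((p : ℝ) ^ (ε / tri k))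
    (Real.one_lt_rpow hp1 (by positivity))
  refine ⟨C ^ tri k, by positivity, fun n u hu => ?_⟩
  set s : Finset ℤ := (Finset.range u).map Nat.castEmbedding with hs
  have hcard : (Fintype.card (Fin (k + 1) → ZMod (p ^ (n * k))) : ℝ) =
      ((p : ℝ) ^ (n * k)) ^ (k + 1) := by
    rw [Fintype.card_fun, ZMod.card, Fintype.card_fin]
    push_cast
    rfl
  set V : ℝ := (((p : ℝ) ^ (n * k)) ^ (k + 1)) ^ ((tri k : ℝ)⁻¹) with hV
  have hV0 : 0 ≤ V := by positivity
  have hVQ : V ^ tri k = ((p : ℝ) ^ (n * k)) ^ (k + 1) :=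
    Real.rpow_inv_natCast_pow (by positivity) hQ.ne'
  have hclass : ∀ r : ZMod (p ^ n), wnorm 1 (tri k) (fun ω : Fin (k + 1) → ZMod (p ^ (n * k)) =>
      ‖expSum (fun _ => 1) (resClass s (p ^ n) r) ω‖ ^ 2) ≤ (resClass s (p ^ n) r).card * V := by
    intro r
    have hc1 : (resClass s (p ^ n) r).card ≤ 1 := by
      refine Finset.card_le_one.2 fun x hx y hy => ?_
      obtain ⟨hxs, hxr⟩ := Finset.mem_filter.1 hx
      obtain ⟨hys, hyr⟩ := Finset.mem_filter.1 hy
      obtain ⟨a, ha, rfl⟩ := Finset.mem_map.1 hxs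
      obtain ⟨b, hb, rfl⟩ := Finset.mem_map.1 hys
      have ha' := Finset.mem_range.1 ha
      have hb' := Finset.mem_range.1 hb
      simp only [Nat.castEmbedding_apply, Int.cast_natCast] at hxr hyr ⊢
      have := (ZMod.natCast_eq_natCast_iff' a b (p ^ n)).1 (hxr.trans hyr.symm)
      rw [Nat.mod_eq_of_lt (by omega), Nat.mod_eq_of_lt (by omega)] at this
      rw [this]
    have hnorm : ∀ ω : Fin (k + 1) → ZMod (p ^ (n * k)),
        ‖expSum (fun _ => 1) (resClass s (p ^ n) r) ω‖ ≤ (resClass s (p ^ n) r).card := by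
      intro ω
      refine (norm_sum_le _ _).trans ?_
      simp
    generalize (resClass s (p ^ n) r).card = d at hc1 hnorm
    have h1 : ∀ ω : Fin (k + 1) → ZMod (p ^ (n * k)),
      0 ≤ (1 : (Fin (k + 1) → ZMod (p ^ (n * k))) → ℝ) ω := fun _ => zero_le_one
    refine le_of_pow_le_pow_left₀ hQ.ne' (by positivity) ?_
    rw [wnorm_pow hQ.ne' h1 (fun _ => by positivity), mul_pow, hVQ, ← hcard]
    have : ∀ ω : Fin (k + 1) → ZMod (p ^ (n * k)),
        (1 : (Fin (k + 1) → ZMod (p ^ (n * k))) → ℝ) ω *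
          (‖expSum (fun _ => 1) (resClass s (p ^ n) r) ω‖ ^ 2) ^ tri k ≤ (d : ℝ) ^ tri k := by
      intro ω
      rw [Pi.one_apply, one_mul]
      refine pow_le_pow_left₀ (by positivity) ((pow_le_pow_left₀ (norm_nonneg _) (hnorm ω) 2).trans ?_) _
      have : (d : ℝ) ≤ 1 := by exact_mod_cast hc1
      have h0 : (0 : ℝ) ≤ d := by positivity
      nlinarith
    refine (Finset.sum_le_sum fun ω _ => this ω).trans_eq ?_
    rw [Finset.sum_const, nsmul_eq_mul, Finset.card_univ, mul_comm]
  have hsum : ∑ r : ZMod (p ^ n), ((resClass s (p ^ n) r).card : ℝ) = u := by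
    have := sum_resClass s (p ^ n) (fun _ => (1 : ℝ))
    simpa [hs] using this
  have hmain := (hdec n (fun _ => 1) s).trans (mul_le_mul_of_nonneg_left
    (Finset.sum_le_sum fun r _ => hclass r) (by positivity))
  rw [← Finset.sum_mul, hsum] at hmain
  have h2 := pow_le_pow_left₀ (wnorm_nonneg (w := 1) (fun _ => zero_le_one)
    fun _ => by positivity) hmain (tri k)
  rw [wnorm_pow (w := 1) hQ.ne' (fun _ => zero_le_one) (fun _ => by positivity), mul_pow, mul_pow,
    mul_pow, hVQ] at h2
  have hexp : (((p : ℝ) ^ (ε / tri k)) ^ n) ^ tri k = ((p : ℝ) ^ n) ^ ε := by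
    rw [← Real.rpow_natCast, ← Real.rpow_natCast, ← Real.rpow_mul hp0.le, ← Real.rpow_mul hp0.le,
      ← Real.rpow_natCast, ← Real.rpow_mul hp0.le]
    congr 1
    field_simp
  rw [hexp] at h2
  calc _ = ∑ ω : Fin (k + 1) → ZMod (p ^ (n * k)),
        (1 : (Fin (k + 1) → ZMod (p ^ (n * k))) → ℝ) ω *
          (‖expSum (fun _ => 1) s ω‖ ^ 2) ^ tri k := by
        refine Finset.sum_congr rfl fun ω _ => ?_
        rw [weylSum_eq_expSum, Pi.one_apply, one_mul, pow_mul]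
    _ ≤ _ := h2
    _ = _ := by ring

theorem e_add (x y : ℝ) : e (x + y) = e x * e y := by
  rw [e, e, e, ← Complex.exp_add]
  congr 1
  push_cast
  ring

theorem norm_e (x : ℝ) : ‖e x‖ = 1 := by
  rw [e, show 2 * (Real.pi : ℂ) * Complex.I * x = ((2 * Real.pi * x : ℝ) : ℂ) * Complex.I by
    push_cast; ring]
  exact Complex.norm_exp_ofReal_mul_I _

theorem norm_e_sub_e_le (x y : ℝ) : ‖e x - e y‖ ≤ 2 * Real.pi * |x - y| := by
  have h1 : e x - e y = e y * (e (x - y) - 1) := by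
    rw [mul_sub, mul_one, ← e_add, add_sub_cancel]
  have h2 : e (x - y) = Complex.exp (Complex.I * ((2 * Real.pi * (x - y) : ℝ) : ℂ)) := by
    rw [e]
    congr 1
    push_cast
    ring
  rw [h1, norm_mul, norm_e, one_mul, h2]
  refine (Real.norm_exp_I_mul_ofReal_sub_one_le).trans_eq ?_
  rw [Real.norm_eq_abs, abs_mul, abs_of_pos (by positivity : 0 < 2 * Real.pi)]

theorem stdAddChar_polyEval {k N : ℕ} [NeZero N] (W : Fin (k + 1) → ℤ) (x : ℕ) :
    ZMod.stdAddChar (polyEval (fun j => (W j : ZMod N)) x) = e (∑ j, W j / N * (x : ℝ) ^ (j : ℕ)) := by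
  have h1 : polyEval (fun j => (W j : ZMod N)) (x : ℤ) =
      ((∑ j, W j * (x : ℤ) ^ (j : ℕ) : ℤ) : ZMod N) := by
    simp [polyEval]
  rw [h1, ZMod.stdAddChar_coe, e]
  congr 1
  push_cast
  rw [Finset.mul_sum, Finset.mul_sum, Finset.sum_div]
  refine Finset.sum_congr rfl fun j _ => ?_
  ring

theorem norm_sum_mul_le_partial {H : ℕ} (hH : 0 < H) (a φ : ℕ → ℂ) {A : ℝ}
    (hφ : ∀ x, ‖φ x‖ = 1) (hA : ∀ x, x + 1 < H → ‖φ (x + 1) - φ x‖ ≤ A / H) :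
    ‖∑ x ∈ Finset.range H, φ x * a x‖ ≤ ‖∑ x ∈ Finset.range H, a x‖ +
      A / H * ∑ u ∈ Finset.range (H - 1), ‖∑ x ∈ Finset.range (u + 1), a x‖ := by
  have := Finset.sum_range_by_parts φ a H
  simp only [smul_eq_mul] at this
  rw [this]
  refine (norm_sub_le _ _).trans (add_le_add ?_ ?_)
  · rw [norm_mul, hφ, one_mul]
  rw [Finset.mul_sum]
  refine (norm_sum_le _ _).trans (Finset.sum_le_sum fun u hu => ?_)
  rw [norm_mul]
  have := Finset.mem_range.1 hu
  exact mul_le_mul_of_nonneg_right (hA u (by omega)) (norm_nonneg _)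

theorem sum_mul_pow_le {Ω : Type*} [Fintype Ω] {Q : ℕ} (hQ : 0 < Q) {r F : Ω → ℝ}
    (hr : ∀ ω, 0 ≤ r ω) (hF : ∀ ω, 0 ≤ F ω) :
    (∑ ω, r ω * F ω) ^ (2 * Q) ≤
      (∑ ω, r ω) ^ (2 * (Q - 1)) * (∑ ω, r ω ^ 2) * ∑ ω, F ω ^ (2 * Q) := by
  obtain ⟨q, rfl⟩ : ∃ q, Q = q + 1 := ⟨Q - 1, by omega⟩
  have h1 := sum_pow_le_of_pow_le (Finset.univ : Finset Ω) (x := r) (y := fun ω => r ω * F ω ^ (q + 1))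
    (z := fun ω => r ω * F ω) (fun ω _ => hr ω)
    (fun ω _ => mul_nonneg (hr ω) (pow_nonneg (hF ω) _)) (fun ω _ => mul_nonneg (hr ω) (hF ω))
    (i := q) (j := 1) (by omega) (fun ω _ => le_of_eq (by ring))
  have h2 := sum_pow_le_of_pow_le (Finset.univ : Finset Ω) (x := fun ω => r ω ^ 2)
    (y := fun ω => F ω ^ (2 * (q + 1))) (z := fun ω => r ω * F ω ^ (q + 1))
    (fun ω _ => by positivity) (fun ω _ => pow_nonneg (hF ω) _)
    (fun ω _ => mul_nonneg (hr ω) (pow_nonneg (hF ω) _)) (i := 1) (j := 1) (by omega)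
    (fun ω _ => le_of_eq (by ring))
  have h0 : 0 ≤ ∑ ω, r ω := Finset.sum_nonneg fun ω _ => hr ω
  have h00 : 0 ≤ ∑ ω, r ω * F ω := Finset.sum_nonneg fun ω _ => mul_nonneg (hr ω) (hF ω)
  rw [Nat.add_sub_cancel]
  calc (∑ ω, r ω * F ω) ^ (2 * (q + 1)) = ((∑ ω, r ω * F ω) ^ (q + 1)) ^ 2 := by ring
    _ ≤ ((∑ ω, r ω) ^ q * (∑ ω, r ω * F ω ^ (q + 1)) ^ 1) ^ 2 :=
        pow_le_pow_left₀ (pow_nonneg h00 _) h1 2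
    _ = (∑ ω, r ω) ^ (2 * q) * (∑ ω, r ω * F ω ^ (q + 1)) ^ (1 + 1) := by ring
    _ ≤ (∑ ω, r ω) ^ (2 * q) * ((∑ ω, r ω ^ 2) ^ 1 * (∑ ω, F ω ^ (2 * (q + 1))) ^ 1) :=
        mul_le_mul_of_nonneg_left h2 (by positivity)
    _ = _ := by ring

/-- The box of residue vectors with `j`-th coordinate in `[s j, s j + L j)`. -/
noncomputable def residueBox {k : ℕ} (N : ℕ) (L : Fin (k + 1) → ℕ) (s : Fin (k + 1) → ℤ) :
    Finset (Fin (k + 1) → ZMod N) :=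
  Fintype.piFinset fun j => (Finset.range (L j)).image fun t : ℕ => ((s j + t : ℤ) : ZMod N)

theorem card_residueBox {k N : ℕ} {L : Fin (k + 1) → ℕ} (hL : ∀ j, L j ≤ N)
    (s : Fin (k + 1) → ℤ) : (residueBox N L s).card = ∏ j, L j := by
  rw [residueBox, Fintype.card_piFinset]
  refine Finset.prod_congr rfl fun j _ => ?_
  rw [Finset.card_image_of_injOn, Finset.card_range]
  intro t ht t' ht' h
  have ht := Finset.mem_range.1 ht
  have ht' := Finset.mem_range.1 ht'
  have h' : (((t : ℕ) : ZMod N)) = ((t' : ℕ) : ZMod N) := by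
    simpa using h
  have := (ZMod.natCast_eq_natCast_iff' _ _ _).1 h'
  rwa [Nat.mod_eq_of_lt (ht.trans_le (hL j)), Nat.mod_eq_of_lt (ht'.trans_le (hL j))] at this

theorem exists_of_mem_residueBox {k N : ℕ} {L : Fin (k + 1) → ℕ} {s : Fin (k + 1) → ℤ}
    {w : Fin (k + 1) → ZMod N} (hw : w ∈ residueBox N L s) :
    ∃ W : Fin (k + 1) → ℤ, w = (fun j => (W j : ZMod N)) ∧ ∀ j, s j ≤ W j ∧ W j + 1 ≤ s j + L j := by
  have h := fun j => Finset.mem_image.1 (Fintype.mem_piFinset.1 hw j)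
  choose t ht htw using h
  refine ⟨fun j => s j + t j, funext fun j => (htw j).symm, fun j => ⟨by simp, ?_⟩⟩
  have := Finset.mem_range.1 (ht j)
  simp only
  omega

theorem mul_succ_pow_sub_le {x H : ℕ} (hx : x + 1 ≤ H) (j : ℕ) :
    (H : ℝ) * (((x + 1 : ℕ) : ℝ) ^ j - (x : ℝ) ^ j) ≤ j * (H : ℝ) ^ j := by
  have hxH : ((x : ℝ) + 1) ≤ H := by exact_mod_cast hx
  have hx0 : (0 : ℝ) ≤ x := Nat.cast_nonneg x
  induction j with
  | zero => simp
  | succ j ih =>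
    push_cast at ih ⊢
    have h1 : ((x : ℝ)) ^ j ≤ (H : ℝ) ^ j := pow_le_pow_left₀ hx0 (by linarith) j
    have h2 : (x : ℝ) ^ j ≤ ((x : ℝ) + 1) ^ j := pow_le_pow_left₀ hx0 (by linarith) j
    have hH : (0 : ℝ) ≤ H := by linarith
    calc (H : ℝ) * (((x : ℝ) + 1) ^ (j + 1) - (x : ℝ) ^ (j + 1))
        = ((x : ℝ) + 1) * (H * (((x : ℝ) + 1) ^ j - (x : ℝ) ^ j)) + H * (x : ℝ) ^ j := by ring
      _ ≤ H * (H * (((x : ℝ) + 1) ^ j - (x : ℝ) ^ j)) + H * (H : ℝ) ^ j := by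
        have : 0 ≤ H * (((x : ℝ) + 1) ^ j - (x : ℝ) ^ j) := mul_nonneg hH (by linarith)
        gcongr
      _ ≤ H * (j * (H : ℝ) ^ j) + H * (H : ℝ) ^ j := by gcongr
      _ = _ := by ring

theorem norm_sum_e_le_weylSum {k N : ℕ} [NeZero N] {H : ℕ} (hH : 0 < H) {A : ℝ} (c : Fin (k + 1) → ℝ)
    (W : Fin (k + 1) → ℤ) (r : ℕ → ℝ) (hc : ∀ j, |c j - W j / N| ≤ 1 / (H : ℝ) ^ (j : ℕ))
    (hr : ∀ x, x + 1 < H → |r (x + 1) - r x| ≤ A / H) :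
    ‖∑ x ∈ Finset.range H, e (∑ j, c j * (x : ℝ) ^ (j : ℕ) + r x)‖ ≤
      ‖weylSum H (fun j => (W j : ZMod N))‖ +
      (2 * Real.pi * ((k + 1) * k + A)) / H *
        ∑ u ∈ Finset.range (H - 1), ‖weylSum (u + 1) (fun j => (W j : ZMod N))‖ := by
  have hH0 : (0 : ℝ) < H := by exact_mod_cast hH
  set g : ℕ → ℝ := fun x => ∑ j, (c j - W j / N) * (x : ℝ) ^ (j : ℕ) + r x with hg
  have hsplit : ∀ x : ℕ, e (∑ j, c j * (x : ℝ) ^ (j : ℕ) + r x) =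
      e (g x) * ZMod.stdAddChar (polyEval (fun j => (W j : ZMod N)) x) := by
    intro x
    rw [stdAddChar_polyEval, ← e_add]
    congr 1
    rw [hg]
    simp only [sub_mul, Finset.sum_sub_distrib]
    ring
  simp only [hsplit, weylSum]
  refine norm_sum_mul_le_partial hH _ (fun x => e (g x)) (fun x => norm_e _) fun x hx => ?_
  refine (norm_e_sub_e_le _ _).trans ?_
  rw [mul_div_assoc]
  refine mul_le_mul_of_nonneg_left ?_ (by positivity)
  have h1 : g (x + 1) - g x =
      ∑ j : Fin (k + 1), (c j - W j / N) * (((x + 1 : ℕ) : ℝ) ^ (j : ℕ) - (x : ℝ) ^ (j : ℕ)) +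
        (r (x + 1) - r x) := by
    simp only [hg, mul_sub, Finset.sum_sub_distrib]
    ring
  rw [h1, add_div]
  refine (abs_add_le _ _).trans (add_le_add ?_ (hr x hx))
  refine (Finset.abs_sum_le_sum_abs _ _).trans ?_
  have h2 : ∀ j : Fin (k + 1),
      |(c j - W j / N) * (((x + 1 : ℕ) : ℝ) ^ (j : ℕ) - (x : ℝ) ^ (j : ℕ))| ≤ k / H := by
    intro j
    have h3 : (0 : ℝ) ≤ ((x + 1 : ℕ) : ℝ) ^ (j : ℕ) - (x : ℝ) ^ (j : ℕ) := by
      have : (x : ℝ) ^ (j : ℕ) ≤ ((x + 1 : ℕ) : ℝ) ^ (j : ℕ) :=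
        pow_le_pow_left₀ (Nat.cast_nonneg x) (by push_cast; linarith) _
      linarith
    rw [abs_mul, abs_of_nonneg h3, le_div_iff₀ hH0]
    have h4 := mul_succ_pow_sub_le hx.le j
    have h5 : ((j : ℕ) : ℝ) ≤ k := by exact_mod_cast Nat.lt_succ_iff.1 j.2
    calc |c j - W j / N| * (((x + 1 : ℕ) : ℝ) ^ (j : ℕ) - (x : ℝ) ^ (j : ℕ)) * H
        = |c j - W j / N| * (H * (((x + 1 : ℕ) : ℝ) ^ (j : ℕ) - (x : ℝ) ^ (j : ℕ))) := by ring
      _ ≤ 1 / (H : ℝ) ^ (j : ℕ) * ((j : ℕ) * (H : ℝ) ^ (j : ℕ)) :=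
        mul_le_mul (hc j) h4 (mul_nonneg hH0.le h3) (by positivity)
      _ = (j : ℕ) := by field_simp
      _ ≤ k := h5
  refine (Finset.sum_le_sum fun j _ => h2 j).trans ?_
  rw [Finset.sum_const, Finset.card_univ, Fintype.card_fin, nsmul_eq_mul]
  push_cast
  rw [mul_div_assoc]

/-- The `(2 * Q)`-th power of the majorant from partial summation. -/
theorem add_sum_pow_le {H Q : ℕ} (hH : 0 < H) (hQ : 0 < Q) {A a : ℝ} (hA : 0 ≤ A) (ha : 0 ≤ a)
    {f : ℕ → ℝ} (hf : ∀ u, 0 ≤ f u) :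
    (a + A / H * ∑ u ∈ Finset.range (H - 1), f u) ^ Q ≤
      2 ^ Q * (a ^ Q + A ^ Q / H * ∑ u ∈ Finset.range (H - 1), f u ^ Q) := by
  obtain ⟨q, rfl⟩ : ∃ q, Q = q + 1 := ⟨Q - 1, by omega⟩
  have hH0 : (0 : ℝ) < H := by exact_mod_cast hH
  have hS : 0 ≤ ∑ u ∈ Finset.range (H - 1), f u := Finset.sum_nonneg fun u _ => hf u
  have hSq : 0 ≤ ∑ u ∈ Finset.range (H - 1), f u ^ (q + 1) :=
    Finset.sum_nonneg fun u _ => pow_nonneg (hf u) _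
  have h1 : (∑ u ∈ Finset.range (H - 1), f u) ^ (q + 1) ≤
      (H : ℝ) ^ q * ∑ u ∈ Finset.range (H - 1), f u ^ (q + 1) := by
    have h := pow_sum_le_card_mul_sum_pow (s := Finset.range (H - 1)) (f := f)
      (fun u _ => hf u) q
    rw [Finset.card_range] at h
    refine h.trans (mul_le_mul_of_nonneg_right ?_ hSq)
    exact pow_le_pow_left₀ (Nat.cast_nonneg _) (by exact_mod_cast Nat.sub_le H 1) q
  have h2 : (a + A / H * ∑ u ∈ Finset.range (H - 1), f u) ^ (q + 1) ≤
      2 ^ q * (a ^ (q + 1) + (A / H * ∑ u ∈ Finset.range (H - 1), f u) ^ (q + 1)) :=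
    add_pow_le ha (by positivity) (q + 1)
  have h3 : (A / H * ∑ u ∈ Finset.range (H - 1), f u) ^ (q + 1) ≤
      A ^ (q + 1) / H * ∑ u ∈ Finset.range (H - 1), f u ^ (q + 1) := by
    rw [mul_pow, div_pow]
    calc A ^ (q + 1) / (H : ℝ) ^ (q + 1) * (∑ u ∈ Finset.range (H - 1), f u) ^ (q + 1)
        ≤ A ^ (q + 1) / (H : ℝ) ^ (q + 1) *
          ((H : ℝ) ^ q * ∑ u ∈ Finset.range (H - 1), f u ^ (q + 1)) := by gcongr
      _ = _ := by field_simp; ring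
  refine h2.trans ?_
  have h4 : (2 : ℝ) ^ q ≤ 2 ^ (q + 1) := pow_le_pow_right₀ (by norm_num) (by omega)
  exact mul_le_mul h4 (by linarith) (by positivity) (by positivity)

/-- The number of pairs of indices below `N` whose coefficient vectors agree modulo one up to
`2 / H ^ j` in the `j`-th coordinate. -/
noncomputable def closePairs {k : ℕ} (c : ℕ → Fin (k + 1) → ℝ) (N H : ℕ) : Finset (ℕ × ℕ) :=
  (Finset.range N ×ˢ Finset.range N).filter fun z =>
    ∀ j : Fin (k + 1), ∃ ν : ℤ, |c z.1 j - c z.2 j - ν| ≤ 2 / (H : ℝ) ^ (j : ℕ)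

theorem prod_pow_fin (H : ℝ) (k : ℕ) : ∏ j : Fin (k + 1), H ^ (j : ℕ) = H ^ tri k := by
  rw [Finset.prod_pow_eq_pow_sum, Fin.sum_univ_eq_sum_range (fun j => j) (k + 1)]
  congr 1
  rw [Finset.sum_range_id, tri, Nat.add_sub_cancel, Nat.mul_comm]

/-- Averaging the exponential sums over boxes of rational coefficients. -/
theorem sum_norm_pow_le_closePairs (q : ℕ) [NeZero q] {k : ℕ} (hk : 0 < k) {H N : ℕ} (hH : 0 < H)
    (hHq : H ^ k ≤ q) {A D : ℝ} (hA : 0 ≤ A)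
    (hD : ∀ u, u ≤ H → ∑ ω : Fin (k + 1) → ZMod q, ‖weylSum u ω‖ ^ (2 * tri k) ≤ D)
    (c : ℕ → Fin (k + 1) → ℝ) (r : ℕ → ℕ → ℝ)
    (hr : ∀ i, i < N → ∀ x, x + 1 < H → |r i (x + 1) - r i x| ≤ A / H) :
    (∑ i ∈ Finset.range N, ‖∑ x ∈ Finset.range H, e (∑ j, c i j * (x : ℝ) ^ (j : ℕ) + r i x)‖) ^
        (2 * tri k) ≤
      2 ^ (k + 1) * (2 ^ (2 * tri k) * (1 + (2 * Real.pi * ((k + 1) * k + A)) ^ (2 * tri k))) *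
        ((H : ℝ) ^ tri k * D / (q : ℝ) ^ (k + 1)) * (N : ℝ) ^ (2 * tri k - 2) *
          (closePairs c N H).card := by
  have hQ := tri_pos hk
  have hH0 : (0 : ℝ) < H := by exact_mod_cast hH
  have hq : 0 < q := Nat.pos_of_ne_zero (NeZero.ne q)
  have hq0 : (0 : ℝ) < q := by exact_mod_cast hq
  set A' : ℝ := 2 * Real.pi * ((k + 1) * k + A) with hA'
  have hA'0 : 0 ≤ A' := by positivity
  set L : Fin (k + 1) → ℕ := fun j => q / H ^ (j : ℕ) with hL
  have hHj : ∀ j : Fin (k + 1), H ^ (j : ℕ) ≤ q := fun j =>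
    (Nat.pow_le_pow_right hH (Nat.lt_succ_iff.1 j.2)).trans hHq
  have hLq : ∀ j, L j ≤ q := fun j => Nat.div_le_self _ _
  have hLpos : ∀ j, 0 < L j := fun j => Nat.div_pos (hHj j) (by positivity)
  have hL1 : ∀ j, (L j : ℝ) / q ≤ 1 / (H : ℝ) ^ (j : ℕ) := by
    intro j
    rw [div_le_div_iff₀ hq0 (by positivity), one_mul]
    exact_mod_cast Nat.div_mul_le_self q (H ^ (j : ℕ))
  have hL2 : ∀ j, (q : ℝ) ≤ 2 * (L j * (H : ℝ) ^ (j : ℕ)) := by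
    intro j
    have h1 : q < q / H ^ (j : ℕ) * H ^ (j : ℕ) + H ^ (j : ℕ) := Nat.lt_div_mul_add (by positivity)
    have h2 : 1 * H ^ (j : ℕ) ≤ L j * H ^ (j : ℕ) := Nat.mul_le_mul_right _ (hLpos j)
    have h3 : q ≤ 2 * (L j * H ^ (j : ℕ)) := by
      simp only [hL] at h2 ⊢
      omega
    exact_mod_cast h3
  set B : ℕ := ∏ j, L j with hB
  have hBpos : 0 < B := Finset.prod_pos fun j _ => hLpos j
  have hB0 : (0 : ℝ) < B := by exact_mod_cast hBpos
  have hqB : (q : ℝ) ^ (k + 1) ≤ 2 ^ (k + 1) * (B * (H : ℝ) ^ tri k) := by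
    calc (q : ℝ) ^ (k + 1) = ∏ _j : Fin (k + 1), (q : ℝ) := by simp
      _ ≤ ∏ j : Fin (k + 1), (2 * (L j * (H : ℝ) ^ (j : ℕ))) :=
        Finset.prod_le_prod (fun _ _ => hq0.le) fun j _ => hL2 j
      _ = _ := by
        rw [Finset.prod_mul_distrib, Finset.prod_mul_distrib, prod_pow_fin, hB]
        simp
  set box : ℕ → Finset (Fin (k + 1) → ZMod q) :=
    fun i => residueBox q L (fun j => ⌈(q : ℝ) * c i j⌉) with hbox
  have hcard : ∀ i, (box i).card = B := fun i => card_residueBox hLq _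
  have hmem : ∀ i, ∀ w ∈ box i, ∃ W : Fin (k + 1) → ℤ, w = (fun j => (W j : ZMod q)) ∧
      ∀ j, |c i j - W j / q| ≤ 1 / (H : ℝ) ^ (j : ℕ) := by
    intro i w hw
    obtain ⟨W, hW, hWs⟩ := exists_of_mem_residueBox hw
    refine ⟨W, hW, fun j => le_trans ?_ (hL1 j)⟩
    obtain ⟨h1, h2⟩ := hWs j
    have h3 := Int.le_ceil ((q : ℝ) * c i j)
    have h4 := Int.ceil_lt_add_one ((q : ℝ) * c i j)
    have h1' : ((⌈(q : ℝ) * c i j⌉ : ℤ) : ℝ) ≤ W j := by exact_mod_cast h1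
    have h2' : (W j : ℝ) + 1 ≤ (⌈(q : ℝ) * c i j⌉ : ℤ) + (L j : ℝ) := by exact_mod_cast h2
    have h5 : c i j - W j / q = (q * c i j - W j) / q := by field_simp
    rw [h5, abs_div, abs_of_pos hq0]
    refine div_le_div_of_nonneg_right ?_ hq0.le
    rw [abs_le]
    constructor <;> linarith
  set F : (Fin (k + 1) → ZMod q) → ℝ := fun w => ‖weylSum H w‖ +
      A' / H * ∑ u ∈ Finset.range (H - 1), ‖weylSum (u + 1) w‖ with hF
  have hF0 : ∀ w, 0 ≤ F w := fun w => by positivity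
  set G : ℕ → ℝ := fun i =>
    ‖∑ x ∈ Finset.range H, e (∑ j, c i j * (x : ℝ) ^ (j : ℕ) + r i x)‖ with hG
  have hGF : ∀ i < N, ∀ w ∈ box i, G i ≤ F w := by
    intro i hi w hw
    obtain ⟨W, rfl, hW⟩ := hmem i w hw
    exact norm_sum_e_le_weylSum hH (c i) W (r i) hW (hr i hi)
  have hFsum : ∑ w, F w ^ (2 * tri k) ≤ 2 ^ (2 * tri k) * (1 + A' ^ (2 * tri k)) * D := by
    have hD0 : 0 ≤ D := le_trans (Finset.sum_nonneg fun _ _ => by positivity) (hD 0 (Nat.zero_le _))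
    calc ∑ w, F w ^ (2 * tri k)
        ≤ ∑ w : Fin (k + 1) → ZMod q, 2 ^ (2 * tri k) * (‖weylSum H w‖ ^ (2 * tri k) +
          A' ^ (2 * tri k) / H * ∑ u ∈ Finset.range (H - 1), ‖weylSum (u + 1) w‖ ^ (2 * tri k)) :=
        Finset.sum_le_sum fun w _ =>
          add_sum_pow_le hH (by omega) hA'0 (norm_nonneg _) (f := fun u => ‖weylSum (u + 1) w‖)
            fun u => norm_nonneg _
      _ = 2 ^ (2 * tri k) * (∑ w : Fin (k + 1) → ZMod q, ‖weylSum H w‖ ^ (2 * tri k) +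
          A' ^ (2 * tri k) / H * ∑ u ∈ Finset.range (H - 1),
            ∑ w : Fin (k + 1) → ZMod q, ‖weylSum (u + 1) w‖ ^ (2 * tri k)) := by
        rw [← Finset.mul_sum, Finset.sum_add_distrib, ← Finset.mul_sum, Finset.sum_comm]
      _ ≤ 2 ^ (2 * tri k) * (D + A' ^ (2 * tri k) / H * ∑ u ∈ Finset.range (H - 1), D) := by
        refine mul_le_mul_of_nonneg_left (add_le_add (hD H le_rfl)
          (mul_le_mul_of_nonneg_left (Finset.sum_le_sum fun u hu => hD _ ?_) (by positivity)))
          (by positivity)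
        have := Finset.mem_range.1 hu
        omega
      _ ≤ 2 ^ (2 * tri k) * (D + A' ^ (2 * tri k) / H * (H * D)) := by
        rw [Finset.sum_const, Finset.card_range, nsmul_eq_mul]
        have : ((H - 1 : ℕ) : ℝ) ≤ H := by exact_mod_cast Nat.sub_le H 1
        gcongr
      _ = _ := by field_simp
  set R : (Fin (k + 1) → ZMod q) → ℝ :=
    fun w => ∑ i ∈ Finset.range N, if w ∈ box i then (1 : ℝ) else 0 with hR
  have hR0 : ∀ w, 0 ≤ R w := fun w => Finset.sum_nonneg fun i _ => by split_ifs <;> norm_num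
  have hRsum : ∑ w, R w = N * B := by
    rw [hR, Finset.sum_comm]
    simp [hcard]
  have hR2 : ∑ w, R w ^ 2 ≤ (closePairs c N H).card * B := by
    have h1 : ∀ w, R w ^ 2 = ∑ z ∈ Finset.range N ×ˢ Finset.range N,
        if w ∈ box z.1 ∧ w ∈ box z.2 then (1 : ℝ) else 0 := by
      intro w
      rw [hR, sq, Finset.sum_mul_sum, Finset.sum_product]
      refine Finset.sum_congr rfl fun i _ => Finset.sum_congr rfl fun i' _ => ?_
      by_cases h1 : w ∈ box i <;> by_cases h2 : w ∈ box i' <;> simp [h1, h2]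
    simp only [h1]
    rw [Finset.sum_comm]
    have h2 : ∀ z ∈ Finset.range N ×ˢ Finset.range N,
        (∑ w, if w ∈ box z.1 ∧ w ∈ box z.2 then (1 : ℝ) else 0) ≤
          if z ∈ closePairs c N H then (B : ℝ) else 0 := by
      intro z hz
      by_cases hne : ∃ w, w ∈ box z.1 ∧ w ∈ box z.2
      · obtain ⟨w, hw1, hw2⟩ := hne
        obtain ⟨W, hW, hWc⟩ := hmem _ w hw1
        obtain ⟨W', hW', hWc'⟩ := hmem _ w hw2
        have hzc : z ∈ closePairs c N H := by
          refine Finset.mem_filter.2 ⟨hz, fun j => ?_⟩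
          have h3 : ((W j : ℤ) : ZMod q) = ((W' j : ℤ) : ZMod q) := by
            have := congrFun (hW.symm.trans hW') j
            exact this
          have h4 := (ZMod.intCast_eq_intCast_iff_dvd_sub _ _ _).1 h3
          obtain ⟨ν, hν⟩ := h4
          refine ⟨-ν, ?_⟩
          have h5 : (W' j : ℝ) - W j = q * ν := by exact_mod_cast hν
          have h6 : c z.1 j - c z.2 j - ((-ν : ℤ) : ℝ) =
              (c z.1 j - W j / q) - (c z.2 j - W' j / q) := by
            have : (ν : ℝ) = (W' j - W j) / q := by rw [h5]; field_simp
            push_cast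
            rw [this]
            ring
          rw [h6]
          refine (abs_sub _ _).trans ((add_le_add (hWc j) (hWc' j)).trans_eq ?_)
          ring
        rw [if_pos hzc]
        calc (∑ w, if w ∈ box z.1 ∧ w ∈ box z.2 then (1 : ℝ) else 0)
            ≤ ∑ w, if w ∈ box z.1 then (1 : ℝ) else 0 := by
              refine Finset.sum_le_sum fun w _ => ?_
              by_cases h1 : w ∈ box z.1 <;> by_cases h2 : w ∈ box z.2 <;> simp [h1, h2]
          _ = B := by simp [hcard]
      · rw [Finset.sum_eq_zero fun w _ => if_neg fun h => hne ⟨w, h⟩]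
        split_ifs
        · exact hB0.le
        · exact le_rfl
    refine (Finset.sum_le_sum h2).trans ?_
    rw [← Finset.sum_filter, Finset.sum_const, nsmul_eq_mul]
    refine mul_le_mul_of_nonneg_right ?_ hB0.le
    exact_mod_cast Finset.card_le_card fun z hz => (Finset.mem_filter.1 hz).2
  have hmain : B * ∑ i ∈ Finset.range N, G i ≤ ∑ w, R w * F w := by
    rw [Finset.mul_sum]
    calc ∑ i ∈ Finset.range N, (B : ℝ) * G i
        ≤ ∑ i ∈ Finset.range N, ∑ w, (if w ∈ box i then (1 : ℝ) else 0) * F w := by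
          refine Finset.sum_le_sum fun i hi => ?_
          simp only [ite_mul, one_mul, zero_mul]
          rw [← Finset.sum_filter, ← hcard i, ← nsmul_eq_mul]
          refine (Finset.card_nsmul_le_sum _ _ _ (hGF i (Finset.mem_range.1 hi))).trans_eq ?_
          congr 1
          ext w
          simp
      _ = ∑ w, R w * F w := by
          rw [Finset.sum_comm]
          simp only [hR, Finset.sum_mul]
  have hG0 : 0 ≤ ∑ i ∈ Finset.range N, G i := Finset.sum_nonneg fun i _ => norm_nonneg _
  have hD0 : 0 ≤ D := le_trans (Finset.sum_nonneg fun _ _ => by positivity) (hD 0 (Nat.zero_le _))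
  have h1 := (pow_le_pow_left₀ (mul_nonneg hB0.le hG0) hmain (2 * tri k)).trans
    (sum_mul_pow_le hQ hR0 hF0)
  rw [hRsum] at h1
  set P : ℝ := 2 ^ (2 * tri k) * (1 + A' ^ (2 * tri k)) with hP
  have hP0 : 0 ≤ P := by positivity
  have h2 : (B : ℝ) ^ (2 * tri k) * (∑ i ∈ Finset.range N, G i) ^ (2 * tri k) ≤
      (N * B : ℝ) ^ (2 * (tri k - 1)) * ((closePairs c N H).card * B) * (P * D) := by
    rw [← mul_pow]
    exact h1.trans (mul_le_mul (mul_le_mul_of_nonneg_left hR2 (by positivity)) hFsum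
      (Finset.sum_nonneg fun w _ => pow_nonneg (hF0 w) _) (by positivity))
  have h3 : (B : ℝ) ^ (2 * tri k) = (B : ℝ) ^ (2 * (tri k - 1)) * B * B := by
    rw [mul_assoc, ← sq, ← pow_add]
    congr 1
    omega
  have h4 : (B : ℝ) * (∑ i ∈ Finset.range N, G i) ^ (2 * tri k) ≤
      (N : ℝ) ^ (2 * (tri k - 1)) * (closePairs c N H).card * (P * D) := by
    have hpos : 0 < (B : ℝ) ^ (2 * (tri k - 1)) * B := by positivity
    refine le_of_mul_le_mul_left ?_ hpos
    rw [h3, mul_pow] at h2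
    linarith
  have h5 : (q : ℝ) ^ (k + 1) * (∑ i ∈ Finset.range N, G i) ^ (2 * tri k) ≤
      2 ^ (k + 1) * (H : ℝ) ^ tri k *
        ((N : ℝ) ^ (2 * (tri k - 1)) * (closePairs c N H).card * (P * D)) := by
    calc (q : ℝ) ^ (k + 1) * (∑ i ∈ Finset.range N, G i) ^ (2 * tri k)
        ≤ 2 ^ (k + 1) * (B * (H : ℝ) ^ tri k) * (∑ i ∈ Finset.range N, G i) ^ (2 * tri k) := by
          gcongr
      _ = 2 ^ (k + 1) * (H : ℝ) ^ tri k * (B * (∑ i ∈ Finset.range N, G i) ^ (2 * tri k)) := by ring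
      _ ≤ _ := by gcongr
  rw [show 2 * tri k - 2 = 2 * (tri k - 1) by omega]
  refine le_of_mul_le_mul_left (h5.trans_eq ?_) (pow_pos hq0 (k + 1))
  field_simp

/-- Mean value estimate for families of exponential sums with nearly polynomial phases. -/
theorem exists_sum_norm_pow_le_closePairs {k : ℕ} (hk : 0 < k) {ε A : ℝ} (hε : 0 < ε) (hA : 0 ≤ A) :
    ∃ C : ℝ, 0 < C ∧ ∀ H N : ℕ, 0 < H → ∀ (c : ℕ → Fin (k + 1) → ℝ) (r : ℕ → ℕ → ℝ),
      (∀ i, i < N → ∀ x, x + 1 < H → |r i (x + 1) - r i x| ≤ A / H) →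
      (∑ i ∈ Finset.range N,
          ‖∑ x ∈ Finset.range H, e (∑ j, c i j * (x : ℝ) ^ (j : ℕ) + r i x)‖) ^ (2 * tri k) ≤
        C * (H : ℝ) ^ ε * (H : ℝ) ^ (2 * tri k) * (N : ℝ) ^ (2 * tri k - 2) *
          (closePairs c N H).card := by
  obtain ⟨p, hkp, hp⟩ := Nat.exists_infinite_primes (k + 1)
  have : Fact p.Prime := ⟨hp⟩
  have hp0 : (0 : ℝ) < p := by exact_mod_cast hp.pos
  obtain ⟨C, hC, hvin⟩ := sum_norm_weylSum_pow_le p hk (by omega : k < p) hε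
  set E : ℝ := 2 ^ (k + 1) *
    (2 ^ (2 * tri k) * (1 + (2 * Real.pi * ((k + 1) * k + A)) ^ (2 * tri k))) with hE
  have hE0 : 0 < E := by positivity
  refine ⟨E * (C * (p : ℝ) ^ ε), by positivity, fun H N hH c r hr => ?_⟩
  have hH0 : (0 : ℝ) < H := by exact_mod_cast hH
  set n := Nat.clog p H with hn
  have hHn : H ≤ p ^ n := Nat.le_pow_clog hp.one_lt H
  have hnH : ((p : ℝ) ^ n) ≤ p * H := by
    have : p ^ n ≤ p * H := by
      rcases Nat.eq_zero_or_pos n with h | h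
      · rw [h, pow_zero]
        exact Nat.mul_pos hp.pos hH
      · have hH1 : 1 < H := by
          by_contra hle
          rw [hn, Nat.clog_of_right_le_one (by omega)] at h
          omega
        have := Nat.pow_pred_clog_lt_self hp.one_lt hH1
        rw [← hn, Nat.pred_eq_sub_one] at this
        calc p ^ n = p * p ^ (n - 1) := by rw [← pow_succ']; congr 1; omega
          _ ≤ p * H := Nat.mul_le_mul_left _ this.le
    exact_mod_cast this
  have : NeZero (p ^ (n * k)) := ⟨(pow_pos hp.pos _).ne'⟩
  have h1 := sum_norm_pow_le_closePairs (p ^ (n * k)) hk hH (N := N)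
    (by rw [pow_mul]; exact Nat.pow_le_pow_left hHn k) hA
    (D := C * ((p : ℝ) ^ n) ^ ε * (H : ℝ) ^ tri k * ((p : ℝ) ^ (n * k)) ^ (k + 1))
    (fun u hu => (hvin n u (hu.trans hHn)).trans (by gcongr)) c r hr
  refine h1.trans ?_
  rw [← hE]
  have h2 : (H : ℝ) ^ tri k * (C * ((p : ℝ) ^ n) ^ ε * (H : ℝ) ^ tri k *
      ((p : ℝ) ^ (n * k)) ^ (k + 1)) / ((p ^ (n * k) : ℕ) : ℝ) ^ (k + 1) ≤
      C * (p : ℝ) ^ ε * (H : ℝ) ^ ε * (H : ℝ) ^ (2 * tri k) := by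
    push_cast
    calc _ = C * ((p : ℝ) ^ n) ^ ε * (H : ℝ) ^ (2 * tri k) := by
          rw [two_mul, pow_add]
          field_simp
          ring
      _ ≤ C * (p * H : ℝ) ^ ε * (H : ℝ) ^ (2 * tri k) := by gcongr
      _ = _ := by rw [Real.mul_rpow hp0.le hH0.le]; ring
  calc _ ≤ E * (C * (p : ℝ) ^ ε * (H : ℝ) ^ ε * (H : ℝ) ^ (2 * tri k)) *
        (N : ℝ) ^ (2 * tri k - 2) * (closePairs c N H).card := by gcongr
    _ = _ := by ring

theorem rpow_le_mul_rpow {R z : ℝ} (hR : 0 < R) (h1 : R ≤ z) (h2 : z ≤ 4 * R) (β : ℝ) :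
    z ^ β ≤ 4 ^ |β| * R ^ β := by
  have hz : 0 < z := hR.trans_le h1
  rcases le_total 0 β with h | h
  · rw [abs_of_nonneg h, ← Real.mul_rpow (by norm_num) hR.le]
    exact Real.rpow_le_rpow hz.le h2 h
  · calc z ^ β ≤ R ^ β := Real.rpow_le_rpow_of_nonpos hR h1 h
      _ = 1 * R ^ β := (one_mul _).symm
      _ ≤ 4 ^ |β| * R ^ β := by
        gcongr
        exact Real.one_le_rpow (by norm_num) (abs_nonneg β)

theorem mul_rpow_le_rpow {R z : ℝ} (hR : 0 < R) (h1 : R ≤ z) (h2 : z ≤ 4 * R) (β : ℝ) :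
    4 ^ (-|β|) * R ^ β ≤ z ^ β := by
  have hz : 0 < z := hR.trans_le h1
  have h := rpow_le_mul_rpow hR h1 h2 (-β)
  rw [abs_neg, Real.rpow_neg hz.le, Real.rpow_neg hR.le] at h
  rw [Real.rpow_neg (by norm_num)]
  have hzβ : 0 < z ^ β := Real.rpow_pos_of_pos hz β
  have hRβ : 0 < R ^ β := Real.rpow_pos_of_pos hR β
  have h4 : (0 : ℝ) < 4 ^ |β| := by positivity
  rw [inv_mul_le_iff₀ h4]
  rw [← div_eq_mul_inv, inv_le_comm₀ hzβ (by positivity), inv_div, div_le_iff₀ h4] at h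
  linarith

/-- The generalized binomial coefficient. -/
noncomputable def bcoef : ℝ → ℕ → ℝ
  | _, 0 => 1
  | β, j + 1 => β / (j + 1) * bcoef (β - 1) j

theorem bcoef_ne_zero (j : ℕ) : ∀ β : ℝ, (∀ n : ℤ, β ≠ n) → bcoef β j ≠ 0 := by
  induction j with
  | zero => intro β _; simp [bcoef]
  | succ j ih =>
    intro β hβ
    have h0 : β ≠ 0 := by simpa using hβ 0
    have h1 : bcoef (β - 1) j ≠ 0 := ih _ fun n h => hβ (n + 1) (by push_cast; linarith)
    have : ((j : ℝ) + 1) ≠ 0 := by positivity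
    simp only [bcoef]
    exact mul_ne_zero (div_ne_zero h0 this) h1

/-- The remainder in the Taylor expansion of `(x + y) ^ β` in powers of `y`. -/
noncomputable def rpowRem (β : ℝ) (m : ℕ) (x y : ℝ) : ℝ :=
  (x + y) ^ β - ∑ j ∈ Finset.range m, bcoef β j * x ^ (β - j) * y ^ j

theorem hasDerivAt_rpowRem (β : ℝ) (m : ℕ) {x y : ℝ} (h : 0 < x + y) :
    HasDerivAt (rpowRem β (m + 1) x) (β * rpowRem (β - 1) m x y) y := by
  have h1 : HasDerivAt (fun y => (x + y) ^ β) (1 * β * (x + y) ^ (β - 1)) y :=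
    ((hasDerivAt_id y).const_add x).rpow_const (Or.inl h.ne')
  have h2 : HasDerivAt (fun y => ∑ j ∈ Finset.range (m + 1), bcoef β j * x ^ (β - j) * y ^ j)
      (∑ j ∈ Finset.range (m + 1), bcoef β j * x ^ (β - j) * (j * y ^ (j - 1))) y :=
    HasDerivAt.fun_sum fun j _ => (hasDerivAt_pow j y).const_mul _
  refine (h1.sub h2).congr_deriv ?_
  rw [rpowRem, mul_sub, one_mul, Finset.sum_range_succ', Finset.mul_sum]
  simp only [Nat.cast_zero, zero_mul, mul_zero, add_zero, Nat.add_sub_cancel]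
  congr 1
  refine Finset.sum_congr rfl fun j _ => ?_
  have hj : ((j : ℝ) + 1) ≠ 0 := by positivity
  rw [bcoef, show β - ((j + 1 : ℕ) : ℝ) = β - 1 - j by push_cast; ring]
  push_cast
  field_simp

theorem rpowRem_zero_right (β : ℝ) (m : ℕ) (x : ℝ) : rpowRem β (m + 1) x 0 = 0 := by
  rw [rpowRem, Finset.sum_range_succ']
  simp [bcoef]

theorem exists_abs_rpowRem_le (m : ℕ) : ∀ β : ℝ, ∃ C : ℝ, 0 ≤ C ∧ ∀ R x y : ℝ, 0 < R → R ≤ x →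
    0 ≤ y → x + y ≤ 4 * R → |rpowRem β m x y| ≤ C * R ^ (β - m) * y ^ m := by
  induction m with
  | zero =>
    intro β
    refine ⟨4 ^ |β|, by positivity, fun R x y hR hx hy hxy => ?_⟩
    have : 0 < x + y := by linarith
    simp only [rpowRem, Finset.range_zero, Finset.sum_empty, sub_zero, Nat.cast_zero, pow_zero,
      mul_one]
    rw [abs_of_pos (Real.rpow_pos_of_pos this β)]
    exact rpow_le_mul_rpow hR (by linarith) hxy β
  | succ m ih =>
    intro β
    obtain ⟨C, hC, h⟩ := ih (β - 1)
    refine ⟨|β| * C, by positivity, fun R x y hR hx hy hxy => ?_⟩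
    have h1 := (convex_Icc (0 : ℝ) y).norm_image_sub_le_of_norm_hasDerivWithin_le
      (f := rpowRem β (m + 1) x) (f' := fun z => β * rpowRem (β - 1) m x z)
      (C := |β| * (C * R ^ (β - 1 - m) * y ^ m)) (x := 0) (y := y)
      (fun z hz => (hasDerivAt_rpowRem β m (by linarith [hz.1])).hasDerivWithinAt)
      (fun z hz => by
        rw [norm_mul, Real.norm_eq_abs, Real.norm_eq_abs]
        refine mul_le_mul_of_nonneg_left ((h R x z hR hx hz.1 (by linarith [hz.2])).trans ?_)
          (abs_nonneg β)
        have := hz.1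
        have := hz.2
        gcongr)
      ⟨le_rfl, hy⟩ ⟨hy, le_rfl⟩
    rw [rpowRem_zero_right, sub_zero, sub_zero, Real.norm_eq_abs, Real.norm_eq_abs,
      abs_of_nonneg hy] at h1
    refine h1.trans_eq ?_
    rw [show β - ((m + 1 : ℕ) : ℝ) = β - 1 - m by push_cast; ring]
    ring

theorem exists_abs_rpowRem_sub_le (β : ℝ) (m : ℕ) : ∃ C : ℝ, 0 ≤ C ∧ ∀ R x y : ℝ, 0 < R → R ≤ x →
    0 ≤ y → x + (y + 1) ≤ 4 * R →
      |rpowRem β (m + 1) x (y + 1) - rpowRem β (m + 1) x y| ≤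
        C * R ^ (β - (m + 1 : ℕ)) * (y + 1) ^ m := by
  obtain ⟨C, hC, h⟩ := exists_abs_rpowRem_le m (β - 1)
  refine ⟨|β| * C, by positivity, fun R x y hR hx hy hxy => ?_⟩
  have h1 := (convex_Icc (0 : ℝ) (y + 1)).norm_image_sub_le_of_norm_hasDerivWithin_le
    (f := rpowRem β (m + 1) x) (f' := fun z => β * rpowRem (β - 1) m x z)
    (C := |β| * (C * R ^ (β - 1 - m) * (y + 1) ^ m)) (x := y) (y := y + 1)
    (fun z hz => (hasDerivAt_rpowRem β m (by linarith [hz.1])).hasDerivWithinAt)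
    (fun z hz => by
      rw [norm_mul, Real.norm_eq_abs, Real.norm_eq_abs]
      refine mul_le_mul_of_nonneg_left ((h R x z hR hx hz.1 (by linarith [hz.2])).trans ?_)
        (abs_nonneg β)
      have := hz.1
      have := hz.2
      gcongr)
    ⟨hy, by linarith⟩ ⟨by linarith, le_rfl⟩
  rw [add_sub_cancel_left, norm_one, mul_one, Real.norm_eq_abs] at h1
  refine h1.trans_eq ?_
  rw [show β - ((m + 1 : ℕ) : ℝ) = β - 1 - m by push_cast; ring]
  ring

theorem exists_rpow_sub_eq {β u v : ℝ} (hu : 0 < u) (huv : u < v) :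
    ∃ ξ, u ≤ ξ ∧ ξ ≤ v ∧ v ^ β - u ^ β = β * ξ ^ (β - 1) * (v - u) := by
  obtain ⟨ξ, hξ, h⟩ := exists_hasDerivAt_eq_slope (fun y => y ^ β) (fun y => β * y ^ (β - 1)) huv
    (fun y hy => (Real.continuousAt_rpow_const y β
      (Or.inl (hu.trans_le hy.1).ne')).continuousWithinAt)
    (fun y hy => by
      simpa using Real.hasDerivAt_rpow_const (p := β) (Or.inl (hu.trans hy.1).ne'))
  refine ⟨ξ, hξ.1.le, hξ.2.le, ?_⟩
  have : v - u ≠ 0 := by linarith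
  rw [h]
  field_simp

theorem abs_rpow_sub_bounds {β R u v : ℝ} (hR : 0 < R) (hu : R ≤ u) (huv : u ≤ v)
    (hv : v ≤ 4 * R) :
    |β| * 4 ^ (-|β - 1|) * R ^ (β - 1) * (v - u) ≤ |v ^ β - u ^ β| ∧
      |v ^ β - u ^ β| ≤ |β| * 4 ^ |β - 1| * R ^ (β - 1) * (v - u) := by
  rcases huv.eq_or_lt with rfl | huv
  · simp
  obtain ⟨ξ, h1, h2, h3⟩ := exists_rpow_sub_eq (β := β) (hR.trans_le hu) huv
  have hξ : 0 < ξ := by linarith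
  have hvu : 0 ≤ v - u := by linarith
  rw [h3, abs_mul, abs_mul, abs_of_nonneg hvu, abs_of_pos (Real.rpow_pos_of_pos hξ _)]
  constructor
  · refine mul_le_mul_of_nonneg_right ?_ hvu
    rw [mul_assoc]
    exact mul_le_mul_of_nonneg_left (mul_rpow_le_rpow hR (by linarith) (by linarith) _)
      (abs_nonneg _)
  · refine mul_le_mul_of_nonneg_right ?_ hvu
    rw [mul_assoc]
    exact mul_le_mul_of_nonneg_left (rpow_le_mul_rpow hR (by linarith) (by linarith) _)
      (abs_nonneg _)

theorem abs_rpow_sub_sub_bounds {β R u v d : ℝ} (hR : 0 < R) (hu : R ≤ u) (huv : u ≤ v)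
    (hd : 0 ≤ d) (hv : v + d ≤ 4 * R) :
    |β| * (|β - 1| * 4 ^ (-|β - 1 - 1|) * R ^ (β - 1 - 1) * d) * (v - u) ≤
        |((v + d) ^ β - v ^ β) - ((u + d) ^ β - u ^ β)| ∧
      |((v + d) ^ β - v ^ β) - ((u + d) ^ β - u ^ β)| ≤
        |β| * (|β - 1| * 4 ^ |β - 1 - 1| * R ^ (β - 1 - 1) * d) * (v - u) := by
  rcases huv.eq_or_lt with rfl | huv
  · simp
  have hder : ∀ y, u ≤ y → HasDerivAt (fun y => (y + d) ^ β - y ^ β)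
      (β * ((y + d) ^ (β - 1) - y ^ (β - 1))) y := by
    intro y hy
    have h1 : HasDerivAt (fun y => (y + d) ^ β) (1 * β * (y + d) ^ (β - 1)) y :=
      ((hasDerivAt_id y).add_const d).rpow_const (Or.inl (by simp only [id]; linarith))
    have h2 : HasDerivAt (fun y : ℝ => y ^ β) (β * y ^ (β - 1)) y :=
      Real.hasDerivAt_rpow_const (Or.inl (by linarith))
    exact (h1.sub h2).congr_deriv (by ring)
  obtain ⟨ξ, hξ, h⟩ := exists_hasDerivAt_eq_slope (fun y => (y + d) ^ β - y ^ β) _ huv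
    (fun y hy => (hder y hy.1).continuousAt.continuousWithinAt) (fun y hy => hder y hy.1.le)
  have hvu : 0 ≤ v - u := by linarith
  have h3 : ((v + d) ^ β - v ^ β) - ((u + d) ^ β - u ^ β) =
      β * ((ξ + d) ^ (β - 1) - ξ ^ (β - 1)) * (v - u) := by
    have : v - u ≠ 0 := by linarith
    rw [h]
    field_simp
  obtain ⟨hb1, hb2⟩ := abs_rpow_sub_bounds (β := β - 1) hR (hu.trans hξ.1.le)
    (by linarith : ξ ≤ ξ + d) (by linarith [hξ.2])
  rw [add_sub_cancel_left] at hb1 hb2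
  rw [h3, abs_mul, abs_mul, abs_of_nonneg hvu]
  exact ⟨by gcongr, by gcongr⟩

theorem card_le_of_abs_sub_le {s : Finset ℤ} {D : ℝ} (hD : 0 ≤ D)
    (h : ∀ x ∈ s, ∀ y ∈ s, |(x : ℝ) - y| ≤ D) : (s.card : ℝ) ≤ D + 1 := by
  rcases s.eq_empty_or_nonempty with rfl | hs
  · simp
    linarith
  have hsub : s ⊆ Finset.Icc (s.min' hs) (s.min' hs + ⌊D⌋) := by
    intro x hx
    refine Finset.mem_Icc.2 ⟨s.min'_le x hx, ?_⟩
    have h1 : ((x - s.min' hs : ℤ) : ℝ) ≤ D := by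
      push_cast
      exact (le_abs_self _).trans (h x hx _ (s.min'_mem hs))
    have := Int.le_floor.2 h1
    omega
  have h2 := Finset.card_le_card hsub
  rw [Int.card_Icc] at h2
  have h3 : (0 : ℤ) ≤ ⌊D⌋ := Int.floor_nonneg.2 hD
  have h4 : (s.card : ℤ) ≤ ⌊D⌋ + 1 := by omega
  have h5 : (s.card : ℝ) ≤ (⌊D⌋ : ℝ) + 1 := by exact_mod_cast h4
  linarith [Int.floor_le D]

theorem card_natCast_le_of_abs_sub_le {s : Finset ℕ} {D : ℝ} (hD : 0 ≤ D)
    (h : ∀ x ∈ s, ∀ y ∈ s, |(x : ℝ) - y| ≤ D) : (s.card : ℝ) ≤ D + 1 := by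
  have := card_le_of_abs_sub_le (s := s.map Nat.castEmbedding) hD (by
    intro x hx y hy
    obtain ⟨x, hx', rfl⟩ := Finset.mem_map.1 hx
    obtain ⟨y, hy', rfl⟩ := Finset.mem_map.1 hy
    simpa using h x hx' y hy')
  simpa using this

/-- Points of a well-spaced sequence lying near integers. -/
theorem card_near_integer_le {g : ℕ → ℝ} {n : ℕ} {η W ρ : ℝ} (hη : 0 < η) (hW : 0 ≤ W) (hρ : 0 ≤ ρ)
    (h1 : ∀ i < n, ∀ i' < n, η * |(i : ℝ) - i'| ≤ |g i - g i'|)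
    (h2 : ∀ i < n, ∀ i' < n, |g i - g i'| ≤ W) :
    (((Finset.range n).filter fun i => ∃ ν : ℤ, |g i - ν| ≤ ρ).card : ℝ) ≤
      (W + 2 * ρ + 1) * (2 * ρ / η + 1) := by
  set S := (Finset.range n).filter fun i => ∃ ν : ℤ, |g i - ν| ≤ ρ with hS
  have hex : ∀ i, ∃ ν : ℤ, i ∈ S → |g i - ν| ≤ ρ := by
    intro i
    by_cases hi : i ∈ S
    · obtain ⟨ν, hν⟩ := (Finset.mem_filter.1 hi).2
      exact ⟨ν, fun _ => hν⟩
    · exact ⟨0, fun h => absurd h hi⟩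
  choose ν hν using hex
  have hlt : ∀ i ∈ S, i < n := fun i hi => Finset.mem_range.1 (Finset.mem_filter.1 hi).1
  have himg : ((S.image ν).card : ℝ) ≤ (W + 2 * ρ) + 1 := by
    refine card_le_of_abs_sub_le (by positivity) ?_
    intro x hx y hy
    obtain ⟨i, hi, rfl⟩ := Finset.mem_image.1 hx
    obtain ⟨j, hj, rfl⟩ := Finset.mem_image.1 hy
    have a1 := abs_le.1 (hν i hi)
    have a2 := abs_le.1 (hν j hj)
    have a3 := abs_le.1 (h2 i (hlt i hi) j (hlt j hj))
    rw [abs_le]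
    constructor <;> linarith
  have hfib : ∀ y ∈ S.image ν, (((S.filter fun i => ν i = y).card : ℕ) : ℝ) ≤ 2 * ρ / η + 1 := by
    intro y _
    refine card_natCast_le_of_abs_sub_le (by positivity) ?_
    intro i hi j hj
    obtain ⟨hi, hiy⟩ := Finset.mem_filter.1 hi
    obtain ⟨hj, hjy⟩ := Finset.mem_filter.1 hj
    have a1 := abs_le.1 (hν i hi)
    have a2 := abs_le.1 (hν j hj)
    rw [hiy] at a1
    rw [hjy] at a2
    rw [le_div_iff₀ hη, mul_comm]
    refine (h1 i (hlt i hi) j (hlt j hj)).trans ?_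
    rw [abs_le]
    constructor <;> linarith
  have hsum : (S.card : ℝ) = ∑ y ∈ S.image ν, ((S.filter fun i => ν i = y).card : ℝ) := by
    rw [Finset.card_eq_sum_card_image ν S]
    push_cast
    rfl
  rw [hsum]
  refine (Finset.sum_le_sum hfib).trans ?_
  rw [Finset.sum_const, nsmul_eq_mul]
  exact mul_le_mul_of_nonneg_right himg (by positivity)

theorem sum_inv_succ_le_rpow {ε : ℝ} (hε : 0 < ε) : ∃ C : ℝ, 0 < C ∧ ∀ n H : ℕ, ∀ B : ℝ, 1 ≤ B →
    0 < H → (n : ℝ) ≤ B * H →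
    ∑ d ∈ Finset.range n, (1 : ℝ) / ((d : ℝ) + 1) ≤ C * B * (H : ℝ) ^ ε := by
  refine ⟨1 + 1 + 1 / ε, by positivity, fun n H B hB hH hn => ?_⟩
  have hH1 : (1 : ℝ) ≤ H := by exact_mod_cast hH
  have h1 : ∑ d ∈ Finset.range n, (1 : ℝ) / ((d : ℝ) + 1) = ((harmonic n : ℚ) : ℝ) := by
    rw [harmonic]
    push_cast
    simp
  have hHε : 1 ≤ (H : ℝ) ^ ε := Real.one_le_rpow hH1 hε.le
  rw [h1]
  rcases Nat.eq_zero_or_pos n with rfl | hn0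
  · simp
    positivity
  have h2 : Real.log n ≤ Real.log B + Real.log H := by
    rw [← Real.log_mul (by linarith) (by linarith)]
    exact Real.log_le_log (by exact_mod_cast hn0) hn
  have h3 : Real.log B ≤ B := (Real.log_le_sub_one_of_pos (by linarith)).trans (by linarith)
  have h4 : Real.log H ≤ (H : ℝ) ^ ε / ε := Real.log_le_rpow_div (by linarith) hε
  calc ((harmonic n : ℚ) : ℝ) ≤ 1 + Real.log n := harmonic_le_one_add_log n
    _ ≤ 1 + (B + (H : ℝ) ^ ε / ε) := by linarith
    _ ≤ 1 * (B * (H : ℝ) ^ ε) + (B * (H : ℝ) ^ ε + B * ((H : ℝ) ^ ε / ε)) := by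
      have a1 : 1 ≤ B * (H : ℝ) ^ ε := one_le_mul_of_one_le_of_one_le hB hHε
      have a2 : B ≤ B * (H : ℝ) ^ ε := le_mul_of_one_le_right (by linarith) hHε
      have a3 : (H : ℝ) ^ ε / ε ≤ B * ((H : ℝ) ^ ε / ε) := le_mul_of_one_le_left (by positivity) hB
      linarith
    _ = _ := by ring

/-- The Taylor coefficients of `Θ x ^ α` at the points `x₀ + i`. -/
noncomputable def rpowCoeff (k : ℕ) (α Θ x₀ : ℝ) (i : ℕ) (j : Fin (k + 1)) : ℝ :=
  Θ * (bcoef α j * (x₀ + i) ^ (α - (j : ℕ)))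

theorem card_closePairs_le_sum {k : ℕ} (c : ℕ → Fin (k + 1) → ℝ) (N H n : ℕ) (j : Fin (k + 1))
    (hn : ∀ z ∈ closePairs c N H, z.1 ≤ z.2 + n ∧ z.2 ≤ z.1 + n) :
    (closePairs c N H).card ≤ N + 2 * ∑ d ∈ Finset.range n, ((Finset.range (N - (d + 1))).filter
      fun i => ∃ ν : ℤ, |c (i + (d + 1)) j - c i j - ν| ≤ 2 / (H : ℝ) ^ (j : ℕ)).card := by
  set S : ℕ → Finset ℕ := fun d => (Finset.range (N - (d + 1))).filter
    fun i => ∃ ν : ℤ, |c (i + (d + 1)) j - c i j - ν| ≤ 2 / (H : ℝ) ^ (j : ℕ) with hS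
  have hsub : closePairs c N H ⊆ ((Finset.range N).image fun i => (i, i)) ∪
      (((Finset.range n).biUnion fun d => (S d).image fun i => (i + (d + 1), i)) ∪
        ((Finset.range n).biUnion fun d => (S d).image fun i => (i, i + (d + 1)))) := by
    rintro ⟨i, i'⟩ hz
    obtain ⟨hn1, hn2⟩ := hn _ hz
    obtain ⟨hz1, hz2⟩ := Finset.mem_filter.1 hz
    obtain ⟨hi, hi'⟩ := Finset.mem_product.1 hz1
    have hz1' := hi
    have hi := Finset.mem_range.1 hi
    have hi' := Finset.mem_range.1 hi'
    obtain ⟨ν, hν⟩ := hz2 j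
    simp only at hn1 hn2 hi hi' hν
    rcases lt_trichotomy i i' with h | rfl | h
    · refine Finset.mem_union_right _ (Finset.mem_union_right _ (Finset.mem_biUnion.2
        ⟨i' - i - 1, Finset.mem_range.2 (by omega), Finset.mem_image.2 ⟨i, ?_, ?_⟩⟩))
      · refine Finset.mem_filter.2 ⟨Finset.mem_range.2 (by omega), -ν, ?_⟩
        rw [show i + (i' - i - 1 + 1) = i' by omega, ← abs_neg]
        convert hν using 2
        push_cast
        ring
      · rw [show i + (i' - i - 1 + 1) = i' by omega]
    · exact Finset.mem_union_left _ (Finset.mem_image.2 ⟨i, hz1', rfl⟩)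
    · refine Finset.mem_union_right _ (Finset.mem_union_left _ (Finset.mem_biUnion.2
        ⟨i - i' - 1, Finset.mem_range.2 (by omega), Finset.mem_image.2 ⟨i', ?_, ?_⟩⟩))
      · refine Finset.mem_filter.2 ⟨Finset.mem_range.2 (by omega), ν, ?_⟩
        rw [show i' + (i - i' - 1 + 1) = i by omega]
        exact hν
      · rw [show i' + (i - i' - 1 + 1) = i by omega]
  refine (Finset.card_le_card hsub).trans ((Finset.card_union_le _ _).trans ?_)
  have h1 : ((Finset.range N).image fun i => (i, i)).card ≤ N :=
    Finset.card_image_le.trans_eq (Finset.card_range N)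
  have h2 : ∀ f : ℕ → ℕ → ℕ × ℕ, ((Finset.range n).biUnion fun d => (S d).image (f d)).card ≤
      ∑ d ∈ Finset.range n, (S d).card := fun f =>
    Finset.card_biUnion_le.trans (Finset.sum_le_sum fun d _ => Finset.card_image_le)
  have h3 := Finset.card_union_le ((Finset.range n).biUnion fun d => (S d).image
    fun i => (i + (d + 1), i)) ((Finset.range n).biUnion fun d => (S d).image
    fun i => (i, i + (d + 1)))
  have h4 := h2 fun d i => (i + (d + 1), i)
  have h5 := h2 fun d i => (i, i + (d + 1))
  change _ ≤ N + 2 * ∑ d ∈ Finset.range n, (S d).card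
  omega

set_option maxHeartbeats 1600000 in
theorem exists_card_closePairs_le {α : ℝ} (hα : ∀ n : ℤ, α ≠ n) {k : ℕ} (hk : 2 ≤ k) {ε : ℝ}
    (hε : 0 < ε) : ∃ C c₀ : ℝ, 0 < C ∧ 0 < c₀ ∧ c₀ ≤ 1 ∧ ∀ (Θ R x₀ : ℝ) (N H : ℕ), 0 < R →
      R ≤ x₀ → x₀ + N ≤ 4 * R → 0 < H → |Θ| * R ^ (α - (k + 1 : ℕ)) * N ≤ c₀ →
      1 ≤ 2 ^ (k + 1) * (|Θ| * R ^ (α - (k + 1 : ℕ)) * (H : ℝ) ^ (k + 1)) →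
      ((closePairs (rpowCoeff k α Θ x₀) N H).card : ℝ) ≤ C * (H : ℝ) ^ ε * (N + (H : ℝ) ^ 2) := by
  obtain ⟨l, rfl⟩ : ∃ l, k = l + 1 := ⟨k - 1, by omega⟩
  have hne : ∀ j : ℕ, α - j ≠ 0 := fun j h => hα j (by push_cast; linarith)
  have hb : ∀ j, 0 < |bcoef α j| := fun j => abs_pos.2 (bcoef_ne_zero j α hα)
  set β₁ : ℝ := α - (l + 1 : ℕ) with hβ₁
  set β₂ : ℝ := α - l with hβ₂
  have hβ₁₂ : β₂ - 1 = β₁ := by rw [hβ₁, hβ₂]; push_cast; ring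
  have hβ₁0 : 0 < |β₁| := abs_pos.2 (hne _)
  have hβ₂0 : 0 < |β₂| := abs_pos.2 (hne _)
  set b₁ := |bcoef α (l + 1)| with hb₁
  set b₂ := |bcoef α l| with hb₂
  have hb₁0 : 0 < b₁ := hb _
  have hb₂0 : 0 < b₂ := hb _
  set m₁ : ℝ := b₁ * (|β₁| * 4 ^ (-|β₁ - 1|)) with hm₁
  set M₁ : ℝ := b₁ * (|β₁| * 4 ^ |β₁ - 1|) with hM₁
  set m₂ : ℝ := b₂ * (|β₂| * (|β₁| * 4 ^ (-|β₁ - 1|))) with hm₂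
  set M₂ : ℝ := b₂ * (|β₂| * (|β₁| * 4 ^ |β₁ - 1|)) with hM₂
  have hm₁0 : 0 < m₁ := by positivity
  have hM₁0 : 0 < M₁ := by positivity
  have hm₂0 : 0 < m₂ := by positivity
  have hM₂0 : 0 < M₂ := by positivity
  obtain ⟨C₁, hC₁, hharm⟩ := sum_inv_succ_le_rpow hε
  set P : ℝ := 2 ^ (l + 1 + 1) with hP
  have hP1 : 1 ≤ P := one_le_pow₀ (by norm_num)
  set D : ℝ := P * (2 / m₁ + 8) with hD
  have hD1 : 1 ≤ D := by
    have : 0 < 2 / m₁ := by positivity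
    nlinarith
  refine ⟨1 + 2 * (4 * (M₂ / m₂) * D + (M₂ * D ^ 2 + 5 * (4 * P / m₂) * (C₁ * D) + 5 * D)),
    min 1 (1 / (4 * M₁)), by positivity, by positivity, min_le_left _ _,
    fun Θ R x₀ N H hR hx hxN hH hlam hlamH => ?_⟩
  set lam : ℝ := |Θ| * R ^ (α - (l + 1 + 1 : ℕ)) with hlamdef
  have hβ' : β₁ - 1 = α - (l + 1 + 1 : ℕ) := by rw [hβ₁]; push_cast; ring
  have hH1 : (1 : ℝ) ≤ H := by exact_mod_cast hH
  have hH0 : (0 : ℝ) < H := by linarith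
  have hlam0 : 0 < lam := by
    have h0 : 0 ≤ lam := by positivity
    refine h0.lt_of_ne fun h => ?_
    rw [← h] at hlamH
    norm_num at hlamH
  have hlam1 : lam * N ≤ 1 := hlam.trans (min_le_left _ _)
  have hlam2 : M₁ * (lam * N) ≤ 1 / 4 := by
    calc M₁ * (lam * N) ≤ M₁ * (1 / (4 * M₁)) :=
          mul_le_mul_of_nonneg_left (hlam.trans (min_le_right _ _)) hM₁0.le
      _ = 1 / 4 := by field_simp
  have hinv : 1 / lam ≤ P * (H : ℝ) ^ (l + 1 + 1) := by
    rw [div_le_iff₀ hlam0]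
    linarith
  set c := rpowCoeff (l + 1) α Θ x₀ with hc
  have hkey : ∀ i i' : ℕ, i ≤ i' → i' < N →
      m₁ * lam * ((i' : ℝ) - i) ≤ |c i' (Fin.last _) - c i (Fin.last _)| ∧
        |c i' (Fin.last _) - c i (Fin.last _)| ≤ M₁ * lam * ((i' : ℝ) - i) := by
    intro i i' hii hi'
    have h1 : (i : ℝ) ≤ i' := by exact_mod_cast hii
    have h2 : (i' : ℝ) ≤ N := by exact_mod_cast hi'.le
    have h3 : (0 : ℝ) ≤ i := Nat.cast_nonneg i
    obtain ⟨ha, hb⟩ := abs_rpow_sub_bounds (β := β₁) hR (by linarith : R ≤ x₀ + i)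
      (by linarith : x₀ + i ≤ x₀ + i') (by linarith)
    have h4 : c i' (Fin.last _) - c i (Fin.last _) =
        Θ * (bcoef α (l + 1) * ((x₀ + i') ^ β₁ - (x₀ + i) ^ β₁)) := by
      simp only [hc, rpowCoeff, Fin.val_last, hβ₁]
      ring
    rw [h4, abs_mul, abs_mul, ← hb₁]
    rw [hβ', add_sub_add_left_eq_sub] at ha hb
    constructor
    · calc _ = |Θ| * (b₁ * (|β₁| * 4 ^ (-|α - (l + 1 + 1 : ℕ)|) * R ^ (α - (l + 1 + 1 : ℕ)) *
            ((i' : ℝ) - i))) := by rw [hm₁, hlamdef, hβ']; ring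
        _ ≤ _ := by gcongr
    · calc _ ≤ |Θ| * (b₁ * (|β₁| * 4 ^ (|α - (l + 1 + 1 : ℕ)|) * R ^ (α - (l + 1 + 1 : ℕ)) *
            ((i' : ℝ) - i))) := by gcongr
        _ = _ := by rw [hM₁, hlamdef, hβ']; ring
  have hdist : ∀ i i' : ℕ, i ≤ i' → i' < N →
      (∃ ν : ℤ, |c i' (Fin.last _) - c i (Fin.last _) - ν| ≤ 2 / (H : ℝ) ^ (l + 1)) →
      ((i' : ℝ) - i) ≤ D * H := by
    rintro i i' hii hi' ⟨ν, hν⟩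
    obtain ⟨ha, hb⟩ := hkey i i' hii hi'
    have hDH : P * (2 / m₁ + 8) * H = P * (2 / m₁) * H + P * 8 * H := by ring
    have hp1 : 0 < P * (2 / m₁) * H := by positivity
    have hp2 : 0 < P * 8 * H := by positivity
    have h2 : (i' : ℝ) ≤ N := by exact_mod_cast hi'.le
    have h3 : (0 : ℝ) ≤ i := Nat.cast_nonneg i
    rw [hD, hDH]
    rcases lt_or_ge ((H : ℝ) ^ (l + 1)) 8 with h8 | h8
    · have : (N : ℝ) ≤ 1 / lam := by
        rw [le_div_iff₀ hlam0, mul_comm]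
        exact hlam1
      have h9 : P * (H : ℝ) ^ (l + 1 + 1) ≤ P * 8 * H := by
        rw [pow_succ]
        have : (H : ℝ) ^ (l + 1) * H ≤ 8 * H := by gcongr
        nlinarith
      linarith
    · have h10 : 2 / (H : ℝ) ^ (l + 1) ≤ 1 / 4 := by
        rw [div_le_iff₀ (by positivity)]
        linarith only [h8]
      have h11 : M₁ * lam * ((i' : ℝ) - i) ≤ 1 / 4 := by
        refine le_trans ?_ hlam2
        rw [mul_assoc]
        have : (i' : ℝ) - i ≤ N := by linarith only [h2, h3]
        gcongr
      have h12 : ν = 0 := by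
        have a1 := abs_le.1 hν
        have a2 := abs_le.1 (hb.trans h11)
        have b1 : (ν : ℝ) < 1 := by linarith only [a1, a2, h10]
        have b2 : (-1 : ℝ) < ν := by linarith only [a1, a2, h10]
        have b3 : ν < 1 := by exact_mod_cast b1
        have b4 : -1 < ν := by exact_mod_cast b2
        omega
      rw [h12, Int.cast_zero, sub_zero] at hν
      have h13 := ha.trans hν
      have h14 : ((i' : ℝ) - i) ≤ 2 / m₁ * (1 / lam) / (H : ℝ) ^ (l + 1) := by
        rw [le_div_iff₀ (by positivity)] at h13 ⊢
        calc ((i' : ℝ) - i) * (H : ℝ) ^ (l + 1) =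
            (m₁ * lam * ((i' : ℝ) - i) * (H : ℝ) ^ (l + 1)) / (m₁ * lam) := by field_simp
          _ ≤ 2 / (m₁ * lam) := by gcongr
          _ = _ := by field_simp
      have h15 : 2 / m₁ * (1 / lam) / (H : ℝ) ^ (l + 1) ≤ P * (2 / m₁) * H := by
        rw [div_le_iff₀ (by positivity)]
        calc 2 / m₁ * (1 / lam) ≤ 2 / m₁ * (P * (H : ℝ) ^ (l + 1 + 1)) := by gcongr
          _ = _ := by ring
      exact h14.trans (h15.trans (le_add_of_nonneg_right hp2.le))
  set n := ⌊D * H⌋₊ with hn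
  have hnDH : (n : ℝ) ≤ D * H := Nat.floor_le (by positivity)
  have hpairs : ∀ z ∈ closePairs c N H, z.1 ≤ z.2 + n ∧ z.2 ≤ z.1 + n := by
    rintro ⟨i, i'⟩ hz
    obtain ⟨hz1, hz2⟩ := Finset.mem_filter.1 hz
    obtain ⟨hi, hi'⟩ := Finset.mem_product.1 hz1
    have hi := Finset.mem_range.1 hi
    have hi' := Finset.mem_range.1 hi'
    obtain ⟨ν, hν⟩ := hz2 (Fin.last _)
    simp only [Fin.val_last] at hi hi' hν ⊢
    rcases le_total i i' with h | h
    · have h1 := hdist i i' h hi' ⟨-ν, by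
        rw [← abs_neg]
        convert hν using 2
        push_cast
        ring⟩
      rw [← Nat.cast_sub h] at h1
      have := Nat.le_floor h1
      omega
    · have h1 := hdist i' i h hi ⟨ν, hν⟩
      rw [← Nat.cast_sub h] at h1
      have := Nat.le_floor h1
      omega
  have hcard := card_closePairs_le_sum c N H n (⟨l, by omega⟩ : Fin (l + 1 + 1)) hpairs
  have hSd : ∀ d ∈ Finset.range n, (((Finset.range (N - (d + 1))).filter fun i => ∃ ν : ℤ,
      |c (i + (d + 1)) ⟨l, by omega⟩ - c i ⟨l, by omega⟩ - ν| ≤ 2 / (H : ℝ) ^ l).card : ℝ) ≤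
      4 * (M₂ / m₂) * N / H + (M₂ * D * H + 5 * (4 * P / m₂) * (H : ℝ) ^ 2 * (1 / ((d : ℝ) + 1)) +
        5) := by
    intro d hd
    have hdn : ((d : ℝ) + 1) ≤ D * H := by
      have h1 : d + 1 ≤ n := Finset.mem_range.1 hd
      have h2 : ((d : ℝ) + 1) ≤ n := by exact_mod_cast h1
      linarith
    have hd0 : (0 : ℝ) < (d : ℝ) + 1 := by positivity
    have hg : ∀ i i' : ℕ, i ≤ i' → i' < N - (d + 1) →
        m₂ * lam * ((d : ℝ) + 1) * ((i' : ℝ) - i) ≤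
          |(c (i' + (d + 1)) ⟨l, by omega⟩ - c i' ⟨l, by omega⟩) -
            (c (i + (d + 1)) ⟨l, by omega⟩ - c i ⟨l, by omega⟩)| ∧
        |(c (i' + (d + 1)) ⟨l, by omega⟩ - c i' ⟨l, by omega⟩) -
            (c (i + (d + 1)) ⟨l, by omega⟩ - c i ⟨l, by omega⟩)| ≤
          M₂ * lam * ((d : ℝ) + 1) * ((i' : ℝ) - i) := by
      intro i i' hii hi'
      have h1 : (i : ℝ) ≤ i' := by exact_mod_cast hii
      have h2 : (i' : ℝ) + ((d : ℝ) + 1) ≤ N := by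
        have : i' + (d + 1) ≤ N := by omega
        exact_mod_cast this
      have h3 : (0 : ℝ) ≤ i := Nat.cast_nonneg i
      obtain ⟨ha, hb⟩ := abs_rpow_sub_sub_bounds (β := β₂) (d := (d : ℝ) + 1) hR
        (by linarith : R ≤ x₀ + i) (by linarith : x₀ + i ≤ x₀ + i') hd0.le (by linarith)
      have h4 : (c (i' + (d + 1)) ⟨l, by omega⟩ - c i' ⟨l, by omega⟩) -
            (c (i + (d + 1)) ⟨l, by omega⟩ - c i ⟨l, by omega⟩) =
          Θ * (bcoef α l * (((x₀ + i' + ((d : ℝ) + 1)) ^ β₂ - (x₀ + i') ^ β₂) -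
            ((x₀ + i + ((d : ℝ) + 1)) ^ β₂ - (x₀ + i) ^ β₂))) := by
        simp only [hc, rpowCoeff, hβ₂]
        push_cast
        rw [← add_assoc x₀ (i' : ℝ), ← add_assoc x₀ (i : ℝ)]
        ring
      rw [h4, abs_mul, abs_mul, ← hb₂]
      rw [hβ₁₂, hβ', add_sub_add_left_eq_sub] at ha hb
      constructor
      · calc _ = |Θ| * (b₂ * (|β₂| * (|β₁| * 4 ^ (-|α - (l + 1 + 1 : ℕ)|) *
              R ^ (α - (l + 1 + 1 : ℕ)) * ((d : ℝ) + 1)) * ((i' : ℝ) - i))) := by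
              rw [hm₂, hlamdef, hβ']; ring
          _ ≤ _ := by gcongr
      · calc _ ≤ |Θ| * (b₂ * (|β₂| * (|β₁| * 4 ^ (|α - (l + 1 + 1 : ℕ)|) *
              R ^ (α - (l + 1 + 1 : ℕ)) * ((d : ℝ) + 1)) * ((i' : ℝ) - i))) := by gcongr
          _ = _ := by rw [hM₂, hlamdef, hβ']; ring
    have hη : 0 < m₂ * lam * ((d : ℝ) + 1) := by positivity
    have hcnt := card_near_integer_le
      (g := fun i => c (i + (d + 1)) ⟨l, by omega⟩ - c i ⟨l, by omega⟩) (n := N - (d + 1))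
      (η := m₂ * lam * ((d : ℝ) + 1)) (W := M₂ * lam * ((d : ℝ) + 1) * N) (ρ := 2 / (H : ℝ) ^ l)
      hη (by positivity) (by positivity)
      (fun i hi i' hi' => by
        rcases le_total i i' with h | h
        · rw [abs_sub_comm, abs_of_nonneg (by rw [sub_nonneg]; exact_mod_cast h),
            abs_sub_comm (c (i + (d + 1)) _ - _)]
          exact (hg i i' h hi').1
        · rw [abs_of_nonneg (by rw [sub_nonneg]; exact_mod_cast h)]
          exact (hg i' i h hi).1)
      (fun i hi i' hi' => by
        have hb : ∀ u v : ℕ, v < N - (d + 1) → (v : ℝ) - u ≤ N := by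
          intro u v hv
          have h1 : (v : ℝ) ≤ N := by exact_mod_cast (by omega : v ≤ N)
          have h2 : (0 : ℝ) ≤ u := Nat.cast_nonneg u
          linarith
        rcases le_total i i' with h | h
        · rw [abs_sub_comm]
          exact (hg i i' h hi').2.trans (mul_le_mul_of_nonneg_left (hb i i' hi') (by positivity))
        · exact (hg i' i h hi).2.trans (mul_le_mul_of_nonneg_left (hb i' i hi) (by positivity)))
    refine hcnt.trans ?_
    have hHl : 1 ≤ (H : ℝ) ^ l := one_le_pow₀ hH1
    have hHl' : (H : ℝ) ≤ (H : ℝ) ^ l := le_self_pow₀ hH1 (by omega)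
    have hρ2 : 2 / (H : ℝ) ^ l ≤ 2 := div_le_self (by norm_num) hHl
    have e1 : M₂ * lam * ((d : ℝ) + 1) * N * (2 * (2 / (H : ℝ) ^ l) / (m₂ * lam * ((d : ℝ) + 1))) ≤
        4 * (M₂ / m₂) * N / H := by
      calc _ = 4 * (M₂ / m₂) * N / (H : ℝ) ^ l := by field_simp; ring
        _ ≤ _ := by gcongr
    have e2 : M₂ * lam * ((d : ℝ) + 1) * N ≤ M₂ * D * H := by
      calc M₂ * lam * ((d : ℝ) + 1) * N = M₂ * (((d : ℝ) + 1) * (lam * N)) := by ring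
        _ ≤ M₂ * ((D * H) * 1) := by gcongr
        _ = _ := by ring
    have e3 : 2 * (2 / (H : ℝ) ^ l) / (m₂ * lam * ((d : ℝ) + 1)) ≤
        4 * P / m₂ * (H : ℝ) ^ 2 * (1 / ((d : ℝ) + 1)) := by
      calc 2 * (2 / (H : ℝ) ^ l) / (m₂ * lam * ((d : ℝ) + 1)) =
          4 / m₂ * (1 / lam) / (H : ℝ) ^ l * (1 / ((d : ℝ) + 1)) := by field_simp; norm_num
        _ ≤ 4 / m₂ * (P * (H : ℝ) ^ (l + 1 + 1)) / (H : ℝ) ^ l * (1 / ((d : ℝ) + 1)) := by gcongr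
        _ = _ := by field_simp; ring
    have e4 : 0 ≤ 2 * (2 / (H : ℝ) ^ l) / (m₂ * lam * ((d : ℝ) + 1)) := by positivity
    calc _ ≤ (M₂ * lam * ((d : ℝ) + 1) * N + 5) *
          (2 * (2 / (H : ℝ) ^ l) / (m₂ * lam * ((d : ℝ) + 1)) + 1) := by
          refine mul_le_mul_of_nonneg_right ?_ (by linarith)
          linarith
      _ = M₂ * lam * ((d : ℝ) + 1) * N * (2 * (2 / (H : ℝ) ^ l) / (m₂ * lam * ((d : ℝ) + 1))) +
          (M₂ * lam * ((d : ℝ) + 1) * N +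
            5 * (2 * (2 / (H : ℝ) ^ l) / (m₂ * lam * ((d : ℝ) + 1))) + 5) := by ring
      _ ≤ _ := by linarith only [e1, e2, e3]
  have hHε : 1 ≤ (H : ℝ) ^ ε := Real.one_le_rpow hH1 hε.le
  have hHH : (H : ℝ) ≤ (H : ℝ) ^ 2 := le_self_pow₀ hH1 (by norm_num)
  have hsum := Finset.sum_le_sum hSd
  rw [Finset.sum_add_distrib, Finset.sum_add_distrib, Finset.sum_add_distrib, Finset.sum_const,
    Finset.sum_const, Finset.sum_const, Finset.card_range, ← Finset.mul_sum, nsmul_eq_mul,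
    nsmul_eq_mul, nsmul_eq_mul] at hsum
  have hcard' : ((closePairs c N H).card : ℝ) ≤ N + 2 * ∑ d ∈ Finset.range n,
      (((Finset.range (N - (d + 1))).filter fun i => ∃ ν : ℤ,
      |c (i + (d + 1)) ⟨l, by omega⟩ - c i ⟨l, by omega⟩ - ν| ≤ 2 / (H : ℝ) ^ l).card : ℝ) := by
    exact_mod_cast hcard
  have f1 : (n : ℝ) * (4 * (M₂ / m₂) * N / H) ≤ 4 * (M₂ / m₂) * D * N := by
    calc (n : ℝ) * (4 * (M₂ / m₂) * N / H) ≤ (D * H) * (4 * (M₂ / m₂) * N / H) := by gcongr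
      _ = _ := by field_simp
  have f2 : (n : ℝ) * (M₂ * D * H) ≤ M₂ * D ^ 2 * (H : ℝ) ^ 2 := by
    calc (n : ℝ) * (M₂ * D * H) ≤ (D * H) * (M₂ * D * H) := by gcongr
      _ = _ := by ring
  have f3 : 5 * (4 * P / m₂) * (H : ℝ) ^ 2 * ∑ d ∈ Finset.range n, 1 / ((d : ℝ) + 1) ≤
      5 * (4 * P / m₂) * (C₁ * D) * ((H : ℝ) ^ ε * (H : ℝ) ^ 2) := by
    calc _ ≤ 5 * (4 * P / m₂) * (H : ℝ) ^ 2 * (C₁ * D * (H : ℝ) ^ ε) := by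
          gcongr
          exact hharm n H D hD1 hH hnDH
      _ = _ := by ring
  have f4 : (n : ℝ) * 5 ≤ 5 * D * (H : ℝ) ^ 2 := by
    calc (n : ℝ) * 5 ≤ (D * H) * 5 := by gcongr
      _ ≤ (D * (H : ℝ) ^ 2) * 5 := by gcongr
      _ = _ := by ring
  have g1 : (N : ℝ) ≤ (H : ℝ) ^ ε * N := le_mul_of_one_le_left (Nat.cast_nonneg N) hHε
  have g2 : (H : ℝ) ^ 2 ≤ (H : ℝ) ^ ε * (H : ℝ) ^ 2 := le_mul_of_one_le_left (by positivity) hHε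
  set U : ℝ := (H : ℝ) ^ ε * N with hU
  set Y : ℝ := (H : ℝ) ^ ε * (H : ℝ) ^ 2 with hY
  have hU0 : 0 ≤ U := by positivity
  have hY0 : 0 ≤ Y := by positivity
  have k1 : 4 * (M₂ / m₂) * D * N ≤ 4 * (M₂ / m₂) * D * U := by gcongr
  have k2 : M₂ * D ^ 2 * (H : ℝ) ^ 2 ≤ M₂ * D ^ 2 * Y := by gcongr
  have k4 : 5 * D * (H : ℝ) ^ 2 ≤ 5 * D * Y := by gcongr
  set a₁ := 4 * (M₂ / m₂) * D with ha₁
  set a₂ := M₂ * D ^ 2 with ha₂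
  set a₃ := 5 * (4 * P / m₂) * (C₁ * D) with ha₃
  set a₄ := 5 * D with ha₄
  have p1 : 0 ≤ a₁ := by positivity
  have p2 : 0 ≤ a₂ + a₃ + a₄ := by positivity
  calc ((closePairs c N H).card : ℝ) ≤ U + 2 * (a₁ * U + (a₂ * Y + a₃ * Y + a₄ * Y)) := by
        linarith only [hcard', hsum, f1, f2, f3, f4, g1, k1, k2, k4]
    _ = (1 + 2 * a₁) * U + (2 * (a₂ + a₃ + a₄)) * Y := by ring
    _ ≤ (1 + 2 * (a₁ + (a₂ + a₃ + a₄))) * U + (1 + 2 * (a₁ + (a₂ + a₃ + a₄))) * Y := by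
      refine add_le_add (mul_le_mul_of_nonneg_right ?_ hU0) (mul_le_mul_of_nonneg_right ?_ hY0)
      · linarith only [p1, p2]
      · linarith only [p1, p2]
    _ = _ := by rw [hU, hY]; ring

theorem rpow_add_eq_sum_rpowCoeff (k : ℕ) (α Θ x₀ : ℝ) (i x : ℕ) :
    Θ * (x₀ + i + x) ^ α =
      ∑ j, rpowCoeff k α Θ x₀ i j * (x : ℝ) ^ (j : ℕ) + Θ * rpowRem α (k + 1) (x₀ + i) x := by
  rw [rpowRem, Finset.sum_range, mul_sub, Finset.mul_sum]
  simp only [rpowCoeff]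
  have : ∀ j : Fin (k + 1), Θ * (bcoef α j * (x₀ + i) ^ (α - (j : ℕ))) * (x : ℝ) ^ (j : ℕ) =
      Θ * (bcoef α j * (x₀ + i) ^ (α - (j : ℕ)) * (x : ℝ) ^ (j : ℕ)) := fun j => by ring
  simp only [this]
  ring

theorem exists_sum_norm_rpow_pow_le {α : ℝ} (hα : ∀ n : ℤ, α ≠ n) {k : ℕ} (hk : 2 ≤ k) {ε : ℝ}
    (hε : 0 < ε) : ∃ C c₀ : ℝ, 0 < C ∧ 0 < c₀ ∧ c₀ ≤ 1 ∧ ∀ (Θ R x₀ : ℝ) (N H : ℕ), 0 < R →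
      R ≤ x₀ → x₀ + N + H ≤ 4 * R → 0 < H → |Θ| * R ^ (α - (k + 1 : ℕ)) * N ≤ c₀ →
      1 ≤ 2 ^ (k + 1) * (|Θ| * R ^ (α - (k + 1 : ℕ)) * (H : ℝ) ^ (k + 1)) →
      |Θ| * R ^ (α - (k + 1 : ℕ)) * (H : ℝ) ^ (k + 1) ≤ 1 →
      (∑ i ∈ Finset.range N, ‖∑ x ∈ Finset.range H, e (Θ * (x₀ + i + x) ^ α)‖) ^ (2 * tri k) ≤
        C * (H : ℝ) ^ ε * (H : ℝ) ^ (2 * tri k) * (N : ℝ) ^ (2 * tri k - 2) *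
          (N + (H : ℝ) ^ 2) := by
  obtain ⟨A, hA, hrem⟩ := exists_abs_rpowRem_sub_le α k
  obtain ⟨C₁, hC₁, h1⟩ := exists_sum_norm_pow_le_closePairs (k := k) (by omega) (half_pos hε) hA
  obtain ⟨C₂, c₀, hC₂, hc₀, hc₀1, h2⟩ := exists_card_closePairs_le hα hk (half_pos hε)
  refine ⟨C₁ * C₂, c₀, by positivity, hc₀, hc₀1, fun Θ R x₀ N H hR hx hN hH hl1 hl2 hl3 => ?_⟩
  have hH0 : (0 : ℝ) < H := by exact_mod_cast hH
  simp only [rpow_add_eq_sum_rpowCoeff k]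
  refine (h1 H N hH (rpowCoeff k α Θ x₀) (fun i x => Θ * rpowRem α (k + 1) (x₀ + i) x) ?_).trans ?_
  · intro i hi x hxH
    have hi' : (i : ℝ) ≤ N := by exact_mod_cast hi.le
    have hxH' : (x : ℝ) + 1 ≤ H := by exact_mod_cast hxH.le
    have h3 := hrem R (x₀ + i) x hR (by linarith [Nat.cast_nonneg (α := ℝ) i]) (Nat.cast_nonneg x)
      (by linarith)
    push_cast
    rw [← mul_sub, abs_mul, le_div_iff₀ hH0]
    have h4 : ((x : ℝ) + 1) ^ k ≤ (H : ℝ) ^ k := by gcongr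
    push_cast at h3 hl3
    calc |Θ| * |rpowRem α (k + 1) (x₀ + i) (x + 1) - rpowRem α (k + 1) (x₀ + i) x| * H
        ≤ |Θ| * (A * R ^ (α - (k + 1)) * (H : ℝ) ^ k) * H := by
          gcongr
          exact h3.trans (by gcongr)
      _ = A * (|Θ| * R ^ (α - (k + 1)) * (H : ℝ) ^ (k + 1)) := by ring
      _ ≤ A * 1 := by gcongr
      _ = A := mul_one A
  · have h3 := h2 Θ R x₀ N H hR hx (by linarith) hH hl1 hl2
    have h4 : (H : ℝ) ^ ε = (H : ℝ) ^ (ε / 2) * (H : ℝ) ^ (ε / 2) := by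
      rw [← Real.rpow_add hH0, add_halves]
    calc _ ≤ C₁ * (H : ℝ) ^ (ε / 2) * (H : ℝ) ^ (2 * tri k) * (N : ℝ) ^ (2 * tri k - 2) *
          (C₂ * (H : ℝ) ^ (ε / 2) * (N + (H : ℝ) ^ 2)) := by gcongr
      _ = _ := by rw [h4]; ring

theorem exists_sum_norm_rpow_le {α : ℝ} (hα : ∀ n : ℤ, α ≠ n) {k : ℕ} (hk : 2 ≤ k) {ε : ℝ}
    (hε : 0 < ε) : ∃ C c₀ : ℝ, 0 < C ∧ 0 < c₀ ∧ c₀ ≤ 1 ∧ ∀ (Θ R x₀ : ℝ) (N H : ℕ), 0 < R →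
      R ≤ x₀ → x₀ + N + H ≤ 4 * R → 0 < H → |Θ| * R ^ (α - (k + 1 : ℕ)) * N ≤ c₀ →
      1 ≤ 2 ^ (k + 1) * (|Θ| * R ^ (α - (k + 1 : ℕ)) * (H : ℝ) ^ (k + 1)) →
      |Θ| * R ^ (α - (k + 1 : ℕ)) * (H : ℝ) ^ (k + 1) ≤ 1 →
      ∑ i ∈ Finset.range N, ‖∑ x ∈ Finset.range H, e (Θ * (x₀ + i + x) ^ α)‖ ≤
        C * (H : ℝ) ^ ε * H * ((N : ℝ) ^ (1 - ((2 * tri k : ℕ) : ℝ)⁻¹) +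
          (N : ℝ) ^ (1 - 2 * ((2 * tri k : ℕ) : ℝ)⁻¹) *
            (H : ℝ) ^ (2 * ((2 * tri k : ℕ) : ℝ)⁻¹)) := by
  have hQ := tri_pos (show 0 < k by omega)
  set Q := 2 * tri k with hQdef
  have hQ2 : 2 ≤ Q := by omega
  have hQ0 : (0 : ℝ) < Q := by exact_mod_cast (by omega : 0 < Q)
  set σ : ℝ := (Q : ℝ)⁻¹ with hσ
  have hσ0 : 0 < σ := by positivity
  have hσQ : σ * Q = 1 := inv_mul_cancel₀ hQ0.ne'
  have hσ1 : σ ≤ 1 := inv_le_one_of_one_le₀ (by exact_mod_cast (by omega : 1 ≤ Q))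
  obtain ⟨C, c₀, hC, hc₀, hc₀1, h⟩ := exists_sum_norm_rpow_pow_le hα hk
    (show 0 < ε * Q by positivity)
  refine ⟨C ^ σ, c₀, by positivity, hc₀, hc₀1, fun Θ R x₀ N H hR hx hN hH hl1 hl2 hl3 => ?_⟩
  have h1 := h Θ R x₀ N H hR hx hN hH hl1 hl2 hl3
  have hH0 : (0 : ℝ) < H := by exact_mod_cast hH
  rcases Nat.eq_zero_or_pos N with rfl | hNpos
  · simp only [Finset.range_zero, Finset.sum_empty]
    positivity
  have hN0 : (0 : ℝ) < N := by exact_mod_cast hNpos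
  have hpow : ∀ {x : ℝ}, 0 ≤ x → ∀ y : ℝ, (x ^ y) ^ Q = x ^ (y * Q) := fun hx y => by
    rw [Real.rpow_mul hx, Real.rpow_natCast]
  have h2 : ∑ i ∈ Finset.range N, ‖∑ x ∈ Finset.range H, e (Θ * (x₀ + i + x) ^ α)‖ ≤
      C ^ σ * (H : ℝ) ^ ε * H * ((N : ℝ) ^ (1 - 2 * σ) * (N + (H : ℝ) ^ 2) ^ σ) := by
    refine le_of_pow_le_pow_left₀ (by omega : Q ≠ 0) (by positivity) (h1.trans_eq ?_)
    rw [mul_pow, mul_pow, mul_pow, mul_pow, hpow hC.le, hpow hH0.le, hpow hN0.le,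
      hpow (by positivity), hσQ, sub_mul, mul_assoc 2 σ, hσQ, Real.rpow_one, Real.rpow_one,
      show (1 : ℝ) * Q - 2 * 1 = ((Q - 2 : ℕ) : ℝ) by rw [Nat.cast_sub hQ2]; push_cast; ring,
      Real.rpow_natCast]
    ring
  refine h2.trans (mul_le_mul_of_nonneg_left ?_ (by positivity))
  have h3 : ((N : ℝ) + (H : ℝ) ^ 2) ^ σ ≤ (N : ℝ) ^ σ + (H : ℝ) ^ (2 * σ) := by
    refine (Real.rpow_add_le_add_rpow hN0.le (by positivity) hσ0.le hσ1).trans_eq ?_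
    rw [Real.rpow_mul hH0.le, Real.rpow_two]
  calc (N : ℝ) ^ (1 - 2 * σ) * (N + (H : ℝ) ^ 2) ^ σ
      ≤ (N : ℝ) ^ (1 - 2 * σ) * ((N : ℝ) ^ σ + (H : ℝ) ^ (2 * σ)) := by gcongr
    _ = _ := by
      rw [mul_add, ← Real.rpow_add hN0, show (1 : ℝ) - 2 * σ + σ = 1 - σ by ring]

theorem norm_sum_le_shift {a : ℕ → ℂ} (ha : ∀ i, ‖a i‖ ≤ 1) (N : ℕ) {H : ℕ} (hH : 0 < H) :
    ‖∑ i ∈ Finset.range N, a i‖ ≤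
      2 * H + (∑ i ∈ Finset.range N, ‖∑ x ∈ Finset.range H, a (i + x)‖) / H := by
  have hH0 : (0 : ℝ) < H := by exact_mod_cast hH
  have hshort : ∀ (b : ℕ → ℂ), (∀ i, ‖b i‖ ≤ 1) → ∀ x, ‖∑ i ∈ Finset.range x, b i‖ ≤ x := by
    intro b hb x
    refine (norm_sum_le _ _).trans ((Finset.sum_le_sum fun i _ => hb i).trans_eq ?_)
    simp
  have hdiff : ∀ x ∈ Finset.range H, ‖∑ i ∈ Finset.range N, a i‖ ≤
      ‖∑ i ∈ Finset.range N, a i - ∑ i ∈ Finset.range N, a (i + x)‖ +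
        ‖∑ i ∈ Finset.range N, a (i + x)‖ := fun x _ => by
    simpa using norm_add_le (∑ i ∈ Finset.range N, a i - ∑ i ∈ Finset.range N, a (i + x))
      (∑ i ∈ Finset.range N, a (i + x))
  have hd : ∀ x, x < H →
      ‖∑ i ∈ Finset.range N, a i - ∑ i ∈ Finset.range N, a (i + x)‖ ≤ 2 * H := by
    intro x hx
    have h1 := Finset.sum_range_add a N x
    have h2 := Finset.sum_range_add a x N
    rw [Nat.add_comm x N, h1] at h2
    have h3 : ∑ i ∈ Finset.range N, a i - ∑ i ∈ Finset.range N, a (i + x) =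
        ∑ i ∈ Finset.range x, a i - ∑ i ∈ Finset.range x, a (N + i) := by
      simp only [Nat.add_comm _ x]
      linear_combination h2
    rw [h3]
    have hxH : (x : ℝ) ≤ H := by exact_mod_cast hx.le
    have h4 := hshort a ha x
    have h5 := hshort (fun i => a (N + i)) (fun i => ha _) x
    refine (norm_sub_le _ _).trans ?_
    linarith
  have htot : (H : ℝ) * ‖∑ i ∈ Finset.range N, a i‖ ≤
      H * (2 * H) + ‖∑ x ∈ Finset.range H, ∑ i ∈ Finset.range N, a (i + x)‖ := by
    have h1 : (H : ℂ) * ∑ i ∈ Finset.range N, a i =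
        ∑ x ∈ Finset.range H, (∑ i ∈ Finset.range N, a i - ∑ i ∈ Finset.range N, a (i + x)) +
          ∑ x ∈ Finset.range H, ∑ i ∈ Finset.range N, a (i + x) := by
      rw [Finset.sum_sub_distrib, sub_add_cancel, Finset.sum_const, Finset.card_range, nsmul_eq_mul]
    have h2 : (H : ℝ) * ‖∑ i ∈ Finset.range N, a i‖ = ‖(H : ℂ) * ∑ i ∈ Finset.range N, a i‖ := by
      rw [norm_mul, Complex.norm_natCast]
    rw [h2, h1]
    refine (norm_add_le _ _).trans (add_le_add_left ?_ _)
    refine (norm_sum_le _ _).trans ((Finset.sum_le_sum fun x hx =>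
      hd x (Finset.mem_range.1 hx)).trans_eq ?_)
    rw [Finset.sum_const, Finset.card_range, nsmul_eq_mul]
  have hcomm : ‖∑ x ∈ Finset.range H, ∑ i ∈ Finset.range N, a (i + x)‖ ≤
      ∑ i ∈ Finset.range N, ‖∑ x ∈ Finset.range H, a (i + x)‖ := by
    rw [Finset.sum_comm]
    exact norm_sum_le _ _
  rw [← sub_le_iff_le_add', le_div_iff₀ hH0]
  linarith

theorem norm_sum_le_blocks {a : ℕ → ℂ} {N₁ : ℕ} (hN₁ : 0 < N₁) {B : ℝ} (N : ℕ)
    (h : ∀ s n, n ≤ N₁ → s + n ≤ N → ‖∑ i ∈ Finset.range n, a (s + i)‖ ≤ B) :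
    ‖∑ i ∈ Finset.range N, a i‖ ≤ ((N : ℝ) / N₁ + 1) * B := by
  have hN₁0 : (0 : ℝ) < N₁ := by exact_mod_cast hN₁
  have hB : 0 ≤ B := by simpa using h 0 0 (Nat.zero_le _) (Nat.zero_le _)
  have key : ∀ M, M ≤ N → ‖∑ i ∈ Finset.range M, a i‖ ≤ ((M : ℝ) / N₁ + 1) * B := by
    intro M
    induction M using Nat.strong_induction_on with
    | _ M ih =>
      intro hM
      rcases le_or_gt M N₁ with hle | hlt
      · have h1 := h 0 M hle (by omega)
        simp only [zero_add] at h1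
        refine h1.trans (le_mul_of_one_le_left hB ?_)
        have : 0 ≤ (M : ℝ) / N₁ := by positivity
        linarith
      · have h1 := ih (M - N₁) (by omega) (by omega)
        have h2 := h (M - N₁) N₁ le_rfl (by omega)
        have h3 := Finset.sum_range_add a (M - N₁) N₁
        rw [Nat.sub_add_cancel hlt.le] at h3
        rw [h3]
        refine (norm_add_le _ _).trans ((add_le_add h1 h2).trans_eq ?_)
        rw [Nat.cast_sub hlt.le]
        field_simp
        ring
  exact key N le_rfl

theorem min_rpow_neg_le {a b τ : ℝ} (ha : 0 < a) (hb : 0 < b) :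
    (min a b) ^ (-τ) ≤ a ^ (-τ) + b ^ (-τ) := by
  have h1 := Real.rpow_pos_of_pos ha (-τ)
  have h2 := Real.rpow_pos_of_pos hb (-τ)
  rcases min_choice a b with h | h <;> rw [h] <;> linarith

theorem block_bound_le {c σ l w R n : ℝ} (hc : 0 < c) (hσ : 0 < σ) (hσ1 : 2 * σ ≤ 1)
    (hl : 0 < l) (hw : 1 ≤ w) (hwR : w ≤ R) (hlw : (l * w) ^ 2 ≤ l) (hl1 : l * w ≤ 1)
    (hn : n = min (c / l) (2 * R)) :
    (4 * R * l / c + 1) * w ≤ (4 / c + 1) * (R * (l ^ σ + R ^ (-σ) + (w / R) ^ (2 * σ))) ∧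
    (4 * R * l / c + 1) * (n ^ (1 - σ) + n ^ (1 - 2 * σ) * w ^ (2 * σ)) ≤
      6 * (c ^ (-σ) + c ^ (-(2 * σ)) + 2) * (R * (l ^ σ + R ^ (-σ) + (w / R) ^ (2 * σ))) := by
  have hw0 : 0 < w := by linarith
  have hR : 0 < R := by linarith
  have hn0 : 0 < n := by rw [hn]; positivity
  have hlw1 : (l * w) ^ (2 * σ) ≤ l ^ σ := by
    rw [Real.rpow_mul (by positivity), Real.rpow_two]
    gcongr
  have hlw2 : l * w ≤ l ^ σ := by
    refine le_trans ?_ hlw1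
    conv_lhs => rw [← Real.rpow_one (l * w)]
    exact Real.rpow_le_rpow_of_exponent_ge (by positivity) hl1 hσ1
  have hwR2 : w ≤ R * (w / R) ^ (2 * σ) := by
    calc w = R * (w / R) ^ (1 : ℝ) := by rw [Real.rpow_one]; field_simp
      _ ≤ _ := by
        gcongr R * ?_
        exact Real.rpow_le_rpow_of_exponent_ge (by positivity) ((div_le_one hR).2 hwR) hσ1
  have hp1 := Real.rpow_pos_of_pos hl σ
  have hp2 := Real.rpow_pos_of_pos hR (-σ)
  have hp3 := Real.rpow_pos_of_pos (div_pos hw0 hR) (2 * σ)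
  have hc1 := Real.rpow_pos_of_pos hc (-σ)
  have hc2 := Real.rpow_pos_of_pos hc (-(2 * σ))
  set B := l ^ σ + R ^ (-σ) + (w / R) ^ (2 * σ) with hB
  have hB0 : 0 < B := by positivity
  constructor
  · calc (4 * R * l / c + 1) * w = 4 / c * (R * (l * w)) + w := by ring
      _ ≤ 4 / c * (R * B) + R * B := by
        gcongr
        · linarith
        · exact hwR2.trans (by gcongr; linarith)
      _ = _ := by ring
  have hJn : (4 * R * l / c + 1) * n ≤ 6 * R := by
    calc (4 * R * l / c + 1) * n = 4 * R * l / c * n + n := by ring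
      _ ≤ 4 * R * l / c * (c / l) + 2 * R := by
        gcongr
        · rw [hn]; exact min_le_left _ _
        · rw [hn]; exact min_le_right _ _
      _ = 6 * R := by field_simp; ring
  have hneg : ∀ τ : ℝ, 0 ≤ τ → n ^ (-τ) ≤ c ^ (-τ) * l ^ τ + R ^ (-τ) := by
    intro τ hτ
    rw [hn]
    refine (min_rpow_neg_le (by positivity) (by positivity)).trans (add_le_add (le_of_eq ?_) ?_)
    · rw [Real.div_rpow hc.le hl.le, Real.rpow_neg hl.le, div_inv_eq_mul]
    · exact Real.rpow_le_rpow_of_nonpos hR (by linarith) (by linarith)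
  have h1 : n ^ (1 - σ) = n * n ^ (-σ) := by
    rw [sub_eq_add_neg, Real.rpow_add hn0, Real.rpow_one]
  have h2 : n ^ (1 - 2 * σ) = n * n ^ (-(2 * σ)) := by
    rw [sub_eq_add_neg, Real.rpow_add hn0, Real.rpow_one]
  have h3 : n ^ (-σ) ≤ (c ^ (-σ) + 1) * B := by
    refine (hneg σ hσ.le).trans ?_
    have : c ^ (-σ) * l ^ σ ≤ c ^ (-σ) * B := by gcongr; linarith
    linarith
  have h4 : n ^ (-(2 * σ)) * w ^ (2 * σ) ≤ (c ^ (-(2 * σ)) + 1) * B := by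
    calc n ^ (-(2 * σ)) * w ^ (2 * σ)
        ≤ (c ^ (-(2 * σ)) * l ^ (2 * σ) + R ^ (-(2 * σ))) * w ^ (2 * σ) := by
          gcongr
          exact hneg _ (by linarith)
      _ = c ^ (-(2 * σ)) * (l * w) ^ (2 * σ) + (w / R) ^ (2 * σ) := by
          rw [Real.mul_rpow hl.le hw0.le, Real.div_rpow hw0.le hR.le, Real.rpow_neg hR.le]
          ring
      _ ≤ c ^ (-(2 * σ)) * B + B := by
          gcongr
          · linarith
          · linarith
      _ = _ := by ring
  calc (4 * R * l / c + 1) * (n ^ (1 - σ) + n ^ (1 - 2 * σ) * w ^ (2 * σ))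
      = ((4 * R * l / c + 1) * n) * (n ^ (-σ) + n ^ (-(2 * σ)) * w ^ (2 * σ)) := by
        rw [h1, h2]; ring
    _ ≤ (6 * R) * ((c ^ (-σ) + 1) * B + (c ^ (-(2 * σ)) + 1) * B) := by gcongr
    _ = _ := by ring

set_option maxHeartbeats 2000000 in
theorem exists_norm_sum_rpow_le {α : ℝ} (hα : ∀ n : ℤ, α ≠ n) {k : ℕ} (hk : 2 ≤ k) {ε : ℝ}
    (hε : 0 < ε) : ∃ C : ℝ, 0 < C ∧ ∀ (Θ R x₀ : ℝ) (N : ℕ), 1 ≤ R → R ≤ x₀ → x₀ + N ≤ 3 * R →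
      Θ ≠ 0 → ‖∑ i ∈ Finset.range N, e (Θ * (x₀ + i) ^ α)‖ ≤
        C * R ^ ε * (R * ((|Θ| * R ^ α / R ^ (k + 1)) ^ (((2 * tri k : ℕ) : ℝ)⁻¹) +
          R ^ (-((2 * tri k : ℕ) : ℝ)⁻¹) +
          ((|Θ| * R ^ α) ^ (-((k + 1 : ℕ) : ℝ)⁻¹)) ^ (2 * ((2 * tri k : ℕ) : ℝ)⁻¹))) := by
  obtain ⟨C, c, hC, hc, hc1, h⟩ := exists_sum_norm_rpow_le hα hk hε
  have htri : 3 ≤ tri k := by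
    rw [tri, Nat.le_div_iff_mul_le (by norm_num)]; nlinarith
  have htri' : (3 : ℝ) ≤ tri k := by exact_mod_cast htri
  set σ := ((2 * tri k : ℕ) : ℝ)⁻¹ with hσ
  have hσ0 : 0 < σ := by rw [hσ]; push_cast; positivity
  have hσ1 : 2 * σ ≤ 1 := by
    rw [hσ, ← div_eq_mul_inv, div_le_one (by push_cast; positivity)]
    push_cast; linarith
  have hc' := Real.rpow_pos_of_pos hc (-σ)
  have hc'' := Real.rpow_pos_of_pos hc (-(2 * σ))
  set D := 2 * (4 / c + 1) + C * (6 * (c ^ (-σ) + c ^ (-(2 * σ)) + 2)) with hD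
  have hD0 : 0 < D := by positivity
  refine ⟨D + (2 * c ^ (-σ) + 2), by positivity, fun Θ R x₀ N hR hx hN hΘ => ?_⟩
  have hR0 : 0 < R := by linarith
  have hN2 : (N : ℝ) ≤ 2 * R := by linarith
  have hRε : 1 ≤ R ^ ε := Real.one_le_rpow hR hε.le
  have hT : 0 < |Θ| * R ^ α := by positivity
  set T := |Θ| * R ^ α with hTdef
  set l := T / R ^ (k + 1) with hldef
  have hl : 0 < l := by positivity
  set v := T ^ (-((k + 1 : ℕ) : ℝ)⁻¹) with hv
  have hv0 : 0 < v := by positivity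
  have hp1 := Real.rpow_pos_of_pos hl σ
  have hp2 := Real.rpow_pos_of_pos hR0 (-σ)
  have hp3 := Real.rpow_pos_of_pos hv0 (2 * σ)
  set B := l ^ σ + R ^ (-σ) + v ^ (2 * σ) with hB
  have hB0 : 0 < B := by positivity
  have htriv : ‖∑ i ∈ Finset.range N, e (Θ * (x₀ + i) ^ α)‖ ≤ 2 * R := by
    refine (norm_sum_le _ _).trans (le_trans (Finset.sum_le_sum fun i _ => (norm_e _).le) ?_)
    simpa using hN2
  have hfin : ∀ {A}, 0 ≤ A → A ≤ D + (2 * c ^ (-σ) + 2) →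
      A * (R * B) ≤ (D + (2 * c ^ (-σ) + 2)) * R ^ ε * (R * B) := by
    intro A hA0 hA
    gcongr
    nlinarith
  rcases lt_or_ge c l with hcl | hcl
  · refine le_trans ?_ (hfin (A := 2 * c ^ (-σ)) (by positivity) (by linarith))
    have : 1 ≤ c ^ (-σ) * l ^ σ := by
      calc (1 : ℝ) = c ^ (-σ) * c ^ σ := by rw [← Real.rpow_add hc]; simp
        _ ≤ _ := by gcongr
    have : 1 ≤ c ^ (-σ) * B := this.trans (by gcongr; linarith)
    nlinarith
  rcases lt_or_ge T 1 with hT1 | hT1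
  · refine le_trans ?_ (hfin (A := 2) (by positivity) (by linarith))
    have : 1 ≤ v ^ (2 * σ) := by
      refine Real.one_le_rpow (Real.one_le_rpow_of_pos_of_le_one_of_nonpos hT hT1.le ?_)
        (by positivity)
      rw [neg_nonpos]; positivity
    nlinarith
  have hvk : T * v ^ (k + 1) = 1 := by
    rw [hv, ← Real.rpow_natCast, ← Real.rpow_mul hT.le, neg_mul,
      inv_mul_cancel₀ (by positivity), Real.rpow_neg_one, mul_inv_cancel₀ hT.ne']
  have hv1 : v ≤ 1 := Real.rpow_le_one_of_one_le_of_nonpos hT1 (by rw [neg_nonpos]; positivity)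
  set w := R * v with hw
  have hw0 : 0 < w := by positivity
  have hwk : l * w ^ (k + 1) = 1 := by
    rw [hldef, hw, mul_pow, ← hvk]; field_simp
  have hw1 : 1 ≤ w := by
    by_contra! hlt
    have : w ^ (k + 1) < 1 := pow_lt_one₀ hw0.le hlt (by omega)
    nlinarith
  have hwR : w ≤ R := by rw [hw]; nlinarith
  have hwv : w / R = v := by rw [hw]; field_simp
  have hl1 : l * w ≤ 1 := by
    rw [← hwk]; gcongr
    exact le_self_pow₀ hw1 (by omega)
  have hlw : (l * w) ^ 2 ≤ l := by
    calc (l * w) ^ 2 = l * (l * w ^ 2) := by ring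
      _ ≤ l * (l * w ^ (k + 1)) := by gcongr <;> first | exact hw1 | omega
      _ = l := by rw [hwk, mul_one]
  obtain ⟨hb1, hb2⟩ := block_bound_le hc hσ0 hσ1 hl hw1 hwR hlw hl1 rfl
  rw [hwv] at hb1 hb2
  set n' := min (c / l) (2 * R) with hn'
  have hn'0 : 0 < n' := by positivity
  set H := ⌊w⌋₊ with hH
  have hHw : (H : ℝ) ≤ w := Nat.floor_le hw0.le
  have hH1 : 1 ≤ H := Nat.le_floor (by simpa using hw1)
  have hH0 : (0 : ℝ) < H := by exact_mod_cast hH1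
  have hHw2 : w ≤ 2 * H := by
    have : w < H + 1 := Nat.lt_floor_add_one w
    have : (1 : ℝ) ≤ H := by exact_mod_cast hH1
    linarith
  have hcl1 : 1 ≤ c / l := (one_le_div hl).2 hcl
  set N₁ := ⌊c / l⌋₊ with hN₁
  have hN₁l : (N₁ : ℝ) ≤ c / l := Nat.floor_le (by positivity)
  have hN₁1 : 1 ≤ N₁ := Nat.le_floor (by simpa using hcl1)
  have hN₁2 : c / l ≤ 2 * N₁ := by
    have : c / l < N₁ + 1 := Nat.lt_floor_add_one _
    have : (1 : ℝ) ≤ N₁ := by exact_mod_cast hN₁1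
    linarith
  have hN₁0 : (0 : ℝ) < N₁ := by exact_mod_cast hN₁1
  have hlΘ : |Θ| * R ^ (α - (k + 1 : ℕ)) = l := by
    rw [hldef, hTdef, Real.rpow_sub hR0, Real.rpow_natCast, mul_div_assoc]
  have hblock : ∀ s n, n ≤ N₁ → s + n ≤ N →
      ‖∑ i ∈ Finset.range n, e (Θ * (x₀ + (s + i : ℕ)) ^ α)‖ ≤
        2 * w + C * R ^ ε * (n' ^ (1 - σ) + n' ^ (1 - 2 * σ) * w ^ (2 * σ)) := by
    intro s n hn hsn
    have hn0 : (n : ℝ) ≤ N₁ := by exact_mod_cast hn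
    have hsn' : (s : ℝ) + n ≤ N := by exact_mod_cast hsn
    have hs0 : (0 : ℝ) ≤ s := Nat.cast_nonneg s
    have hnn : (n : ℝ) ≤ n' := le_min (hn0.trans hN₁l) (by linarith)
    have hsh := norm_sum_le_shift (a := fun i => e (Θ * (x₀ + (s + i : ℕ)) ^ α))
      (fun i => (norm_e _).le) n (H := H) (by omega)
    refine hsh.trans ?_
    have h1 := h Θ R (x₀ + s) n H hR0 (by linarith) (by linarith) (by omega)
      (by
        rw [hlΘ]
        calc l * n ≤ l * (c / l) := by gcongr; linarith
          _ = c := by field_simp)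
      (by
        rw [hlΘ]
        calc (1 : ℝ) = l * w ^ (k + 1) := hwk.symm
          _ ≤ l * (2 * H) ^ (k + 1) := by gcongr
          _ = _ := by ring)
      (by
        rw [hlΘ, ← hwk]
        gcongr)
    have h2 : ∑ i ∈ Finset.range n, ‖∑ x ∈ Finset.range H, e (Θ * (x₀ + (s + (i + x) : ℕ)) ^ α)‖ =
        ∑ i ∈ Finset.range n, ‖∑ x ∈ Finset.range H, e (Θ * (x₀ + s + i + x) ^ α)‖ := by
      push_cast
      simp only [add_assoc]
    rw [h2]
    gcongr
    rw [div_le_iff₀ hH0]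
    refine h1.trans ?_
    have : (H : ℝ) ^ ε ≤ R ^ ε := by gcongr; linarith
    have h3 : (n : ℝ) ^ (1 - σ) ≤ n' ^ (1 - σ) := by gcongr; linarith
    have h4 : (n : ℝ) ^ (1 - 2 * σ) ≤ n' ^ (1 - 2 * σ) := by gcongr
    calc C * (H : ℝ) ^ ε * H * ((n : ℝ) ^ (1 - σ) + (n : ℝ) ^ (1 - 2 * σ) * (H : ℝ) ^ (2 * σ))
        ≤ C * R ^ ε * H * (n' ^ (1 - σ) + n' ^ (1 - 2 * σ) * w ^ (2 * σ)) := by gcongr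
      _ = _ := by ring
  have hall := norm_sum_le_blocks (a := fun i => e (Θ * (x₀ + (i : ℕ)) ^ α)) hN₁1 N
    hblock
  have hJ : (N : ℝ) / N₁ + 1 ≤ 4 * R * l / c + 1 := by
    refine add_le_add ?_ le_rfl
    rw [div_le_iff₀ hN₁0]
    calc (N : ℝ) ≤ 2 * R := hN2
      _ = 2 * R * l / c * (c / l) := by field_simp
      _ ≤ 2 * R * l / c * (2 * N₁) := by gcongr
      _ = _ := by ring
  set G := n' ^ (1 - σ) + n' ^ (1 - 2 * σ) * w ^ (2 * σ) with hG
  have hG0 : 0 < G := by positivity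
  calc ‖∑ i ∈ Finset.range N, e (Θ * (x₀ + (i : ℕ)) ^ α)‖
      ≤ ((N : ℝ) / N₁ + 1) * (2 * w + C * R ^ ε * G) := hall
    _ ≤ (4 * R * l / c + 1) * (2 * w + C * R ^ ε * G) := by gcongr
    _ = 2 * ((4 * R * l / c + 1) * w) + C * R ^ ε * ((4 * R * l / c + 1) * G) := by ring
    _ ≤ 2 * ((4 / c + 1) * (R * B)) +
        C * R ^ ε * (6 * (c ^ (-σ) + c ^ (-(2 * σ)) + 2) * (R * B)) := by gcongr
    _ ≤ R ^ ε * (2 * ((4 / c + 1) * (R * B))) +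
        C * R ^ ε * (6 * (c ^ (-σ) + c ^ (-(2 * σ)) + 2) * (R * B)) := by
      exact add_le_add (le_mul_of_one_le_left (by positivity) hRε) le_rfl
    _ = D * R ^ ε * (R * B) := by rw [hD]; ring
    _ ≤ _ := by
      gcongr
      linarith

theorem sum_Icc_rpow_neg_le {τ : ℝ} (hτ : 0 ≤ τ) (hτ1 : τ ≤ 1 / 2) (S : ℕ) :
    ∑ s ∈ Finset.Icc 1 S, (s : ℝ) ^ (-τ) ≤ 2 * (S : ℝ) ^ (1 - τ) := by
  induction S with
  | zero => simpa using by positivity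
  | succ S ih =>
    rw [Finset.sum_Icc_succ_top (by omega)]
    have hS : (0 : ℝ) < S + 1 := by positivity
    have h1 : (S : ℝ) ^ (1 - τ) ≤ ((S + 1 : ℝ)) ^ (1 - τ) - (1 - τ) * (S + 1 : ℝ) ^ (-τ) := by
      have hb := rpow_one_add_le_one_add_mul_self (s := -(1 / ((S : ℝ) + 1))) (p := 1 - τ)
        (by rw [neg_le_neg_iff, div_le_one hS]; linarith [Nat.cast_nonneg (α := ℝ) S])
        (by linarith) (by linarith)
      have h2 : (S : ℝ) = (S + 1) * (1 + -(1 / ((S : ℝ) + 1))) := by field_simp; ring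
      have h3 : 0 ≤ 1 + -(1 / ((S : ℝ) + 1)) := by
        rw [← sub_eq_add_neg, sub_nonneg, div_le_one hS]; linarith [Nat.cast_nonneg (α := ℝ) S]
      calc (S : ℝ) ^ (1 - τ) = (S + 1 : ℝ) ^ (1 - τ) * (1 + -(1 / ((S : ℝ) + 1))) ^ (1 - τ) := by
            rw [← Real.mul_rpow hS.le h3, ← h2]
        _ ≤ (S + 1 : ℝ) ^ (1 - τ) * (1 + (1 - τ) * -(1 / ((S : ℝ) + 1))) := by gcongr
        _ = _ := by
            rw [sub_eq_add_neg 1 τ, Real.rpow_add hS, Real.rpow_one]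
            field_simp
            ring
    have h4 : 0 ≤ (S + 1 : ℝ) ^ (-τ) := by positivity
    push_cast
    nlinarith

theorem card_le_of_modEq {q : ℕ} (hq : 0 < q) {s : Finset ℕ} {D : ℝ}
    (hD : 0 ≤ D) (hmod : ∀ x ∈ s, ∀ y ∈ s, x ≡ y [MOD q]) (h : ∀ x ∈ s, (x : ℝ) ≤ D) :
    (s.card : ℝ) ≤ D / q + 1 := by
  have hq0 : (0 : ℝ) < q := by exact_mod_cast hq
  have hinj : Set.InjOn (fun x : ℕ => x / q) s := fun x hx y hy hxy => by
    have h1 : x % q = y % q := hmod x hx y hy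
    have h2 : x / q = y / q := hxy
    rw [← Nat.div_add_mod x q, ← Nat.div_add_mod y q, h1, h2]
  rw [← Finset.card_image_of_injOn hinj]
  have hbd : ∀ x ∈ s.image (fun x : ℕ => x / q), (0 : ℝ) ≤ x ∧ (x : ℝ) ≤ D / q := by
    intro z hz
    obtain ⟨x, hx, rfl⟩ := Finset.mem_image.1 hz
    refine ⟨by positivity, Nat.cast_div_le.trans ?_⟩
    have := h x hx
    gcongr
  refine card_natCast_le_of_abs_sub_le (by positivity) fun x hx y hy => ?_
  have h1 := hbd x hx
  have h2 := hbd y hy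
  rw [abs_le]
  constructor <;> linarith [h1.1, h1.2, h2.1, h2.2]

theorem exists_sum_eq_sum_range {q : ℕ} (hq : 0 < q) {s : Finset ℕ} (hs : s.Nonempty)
    (hmod : ∀ x ∈ s, ∀ y ∈ s, x ≡ y [MOD q])
    (hconv : ∀ x ∈ s, ∀ y ∈ s, ∀ z, x ≤ z → z ≤ y → z ≡ x [MOD q] → z ∈ s) :
    ∃ m N : ℕ, m ∈ s ∧ m + q * N ∈ s ∧
      ∀ f : ℕ → ℂ, ∑ x ∈ s, f x = ∑ i ∈ Finset.range (N + 1), f (m + q * i) := by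
  set m := s.min' hs with hm
  set M := s.max' hs with hM
  have hms := s.min'_mem hs
  have hMs := s.max'_mem hs
  have hdiv : ∀ x ∈ s, ∃ i, x = m + q * i := fun x hx => by
    have hle := s.min'_le x hx
    obtain ⟨i, hi⟩ := (Nat.modEq_iff_dvd' hle).1 (hmod _ hms x hx)
    exact ⟨i, by omega⟩
  obtain ⟨N, hN⟩ := hdiv M hMs
  refine ⟨m, N, hms, hN ▸ hMs, fun f => ?_⟩
  have hset : s = (Finset.range (N + 1)).image (fun i => m + q * i) := by
    ext x
    simp only [Finset.mem_image, Finset.mem_range]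
    constructor
    · intro hx
      obtain ⟨i, hi⟩ := hdiv x hx
      have hle := s.le_max' x hx
      refine ⟨i, ?_, hi.symm⟩
      have : q * i ≤ q * N := by omega
      have := Nat.le_of_mul_le_mul_left this hq
      omega
    · rintro ⟨i, hi, rfl⟩
      refine hconv m hms M hMs _ (by omega) ?_ ?_
      · rw [hN]
        have : q * i ≤ q * N := Nat.mul_le_mul_left _ (by omega)
        omega
      · exact (Nat.modEq_iff_dvd' (by omega)).2 ⟨i, by omega⟩ |>.symm
  rw [hset, Finset.sum_image]
  intro i _ j _ hij
  have : q * i = q * j := by simpa using hij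
  exact Nat.eq_of_mul_eq_mul_left hq this

theorem phase_size_bounds {α X M h u v : ℝ} (hX : 0 < X) (hM : 0 < M) (hh : 0 < h)
    (hu : X / (2 * M) ≤ u) (huv : u ≤ v) (hv : v ≤ 2 * X / M) :
    |α| * 4 ^ (-|α - 1|) * 2 ^ (-α) * (2 * h * X ^ α * ((v - u) * M / X)) ≤
        h * |v ^ α - u ^ α| * M ^ α ∧
      h * |v ^ α - u ^ α| * M ^ α ≤
        |α| * 4 ^ |α - 1| * 2 ^ (-α) * (2 * h * X ^ α * ((v - u) * M / X)) := by
  have hR : 0 < X / (2 * M) := by positivity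
  obtain ⟨h1, h2⟩ := abs_rpow_sub_bounds (β := α) hR hu huv
    (hv.trans_eq (by field_simp; norm_num))
  have h3 : (X / (2 * M)) ^ (α - 1) * M ^ α = 2 ^ (-α) * 2 * X ^ α * (M / X) := by
    rw [Real.rpow_sub_one hR.ne', Real.div_rpow hX.le (by positivity),
      Real.mul_rpow (by norm_num) hM.le, Real.rpow_neg (by norm_num)]
    have := (Real.rpow_pos_of_pos hM α).ne'
    have := (Real.rpow_pos_of_pos (show (0 : ℝ) < 2 by norm_num) α).ne'
    field_simp
  have hMα := Real.rpow_pos_of_pos hM α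
  constructor
  · calc |α| * 4 ^ (-|α - 1|) * 2 ^ (-α) * (2 * h * X ^ α * ((v - u) * M / X))
        = h * (|α| * 4 ^ (-|α - 1|)) * (2 ^ (-α) * 2 * X ^ α * (M / X)) * (v - u) := by ring
      _ = h * (|α| * 4 ^ (-|α - 1|) * (X / (2 * M)) ^ (α - 1) * (v - u)) * M ^ α := by
        rw [← h3]; ring
      _ ≤ _ := by gcongr
  · calc h * |v ^ α - u ^ α| * M ^ α
        ≤ h * (|α| * 4 ^ |α - 1| * (X / (2 * M)) ^ (α - 1) * (v - u)) * M ^ α := by gcongr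
      _ = h * (|α| * 4 ^ |α - 1|) * ((X / (2 * M)) ^ (α - 1) * M ^ α) * (v - u) := by ring
      _ = _ := by rw [h3]; ring

set_option maxHeartbeats 1000000 in
theorem exists_norm_sum_progression_le {α : ℝ} (hα : ∀ n : ℤ, α ≠ n) {k : ℕ} (hk : 2 ≤ k) {ε : ℝ}
    (hε : 0 < ε) : ∃ C : ℝ, 0 < C ∧ ∀ (X M h : ℝ) (q n s : ℕ) (P : Finset ℕ), 0 < X → 0 < h →
      0 < q → q ≤ M → 1 ≤ s → X / (2 * M) ≤ n → ((n + q * s : ℕ) : ℝ) ≤ 2 * X / M →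
      (∀ m ∈ P, M < m ∧ m ≤ 2 * M) → (∀ x ∈ P, ∀ y ∈ P, x ≡ y [MOD q]) →
      (∀ x ∈ P, ∀ y ∈ P, ∀ z, x ≤ z → z ≤ y → z ≡ x [MOD q] → z ∈ P) →
      ‖∑ m ∈ P, e (h * (m : ℝ) ^ α * ((n : ℝ) ^ α - ((n + q * s : ℕ) : ℝ) ^ α))‖ ≤
        C * (M / q) ^ ε * (M / q) *
          ((2 * h * (q : ℝ) ^ (k + 1) * X ^ α / M ^ (k + 1)) ^ (((2 * tri k : ℕ) : ℝ)⁻¹) +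
            (q / M) ^ (((2 * tri k : ℕ) : ℝ)⁻¹) +
            (2 * h * X ^ α) ^ (-(2 * ((2 * tri k : ℕ) : ℝ)⁻¹ / (k + 1 : ℕ))) *
              (s / (X / (M * q))) ^ (-(2 * ((2 * tri k : ℕ) : ℝ)⁻¹ / (k + 1 : ℕ)))) := by
  obtain ⟨C, hC, hmain⟩ := exists_norm_sum_rpow_le hα hk hε
  have hα0 : 0 < |α| := abs_pos.2 (by exact_mod_cast hα 0)
  set σ := ((2 * tri k : ℕ) : ℝ)⁻¹ with hσ
  have hσ0 : 0 ≤ σ := by positivity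
  set τ := 2 * σ / (k + 1 : ℕ) with hτ
  set c₁ := |α| * 4 ^ (-|α - 1|) * 2 ^ (-α) with hc₁
  set c₂ := |α| * 4 ^ |α - 1| * 2 ^ (-α) * 2 with hc₂
  have hc₁0 : 0 < c₁ := by positivity
  have hc₂0 : 0 < c₂ := by positivity
  refine ⟨C * (c₂ ^ σ + 1 + c₁ ^ (-τ)), by positivity,
    fun X M h q n s P hX hh hq hqM hs hn hns hP hmod hconv => ?_⟩
  have hq0 : (0 : ℝ) < q := by exact_mod_cast hq
  have hs0 : (0 : ℝ) < s := by exact_mod_cast hs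
  have hM : 0 < M := by linarith
  rcases P.eq_empty_or_nonempty with rfl | hne
  · simp only [Finset.sum_empty, norm_zero]; positivity
  obtain ⟨m, N, hm, hmN, hsum⟩ := exists_sum_eq_sum_range hq hne hmod hconv
  rw [hsum]
  set v := ((n + q * s : ℕ) : ℝ) with hv
  have hvn : v - n = q * s := by rw [hv]; push_cast; ring
  have hn0 : 0 < (n : ℝ) := lt_of_lt_of_le (by positivity) hn
  have hqs : 0 < (q : ℝ) * s := by positivity
  obtain ⟨hT1, hT2⟩ := phase_size_bounds (α := α) hX hM hh hn (by linarith) hns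
  have hsL : (v - n) * M / X = s / (X / (M * q)) := by
    rw [hvn]; field_simp
  rw [hsL] at hT1 hT2
  have hsL2 : s / (X / (M * q)) ≤ 2 := by
    rw [← hsL, div_le_iff₀ hX]
    rw [le_div_iff₀ hM] at hns
    nlinarith
  have hsL0 : 0 < s / (X / (M * q)) := by positivity
  set y := s / (X / (M * q)) with hy
  have hR : 1 ≤ M / q := (one_le_div hq0).2 hqM
  set Θ := h * ((n : ℝ) ^ α - v ^ α) * (q : ℝ) ^ α with hΘ
  have hTeq : |Θ| * (M / q) ^ α = h * |v ^ α - (n : ℝ) ^ α| * M ^ α := by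
    rw [hΘ, abs_mul, abs_mul, abs_of_pos hh, abs_of_pos (Real.rpow_pos_of_pos hq0 α),
      Real.div_rpow hM.le hq0.le, abs_sub_comm]
    have := (Real.rpow_pos_of_pos hq0 α).ne'
    field_simp
  rw [← hTeq] at hT1 hT2
  have hT0 : 0 < |Θ| * (M / q) ^ α := lt_of_lt_of_le (by positivity) hT1
  have hΘ0 : Θ ≠ 0 := by
    rintro h0
    rw [h0] at hT0
    simp at hT0
  have hmM := (hP m hm).1
  have hmM' := (hP _ hmN).2
  push_cast at hmM'
  have key := hmain Θ (M / q) (m / q) (N + 1) hR (by gcongr) (by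
    push_cast
    have : (m : ℝ) / q + N ≤ 2 * (M / q) := by
      rw [← mul_div_assoc, div_add' _ _ _ hq0.ne']
      gcongr
      linarith
    linarith) hΘ0
  have hphase : ∀ i : ℕ, h * ((m + q * i : ℕ) : ℝ) ^ α * ((n : ℝ) ^ α - v ^ α) =
      Θ * ((m : ℝ) / q + i) ^ α := fun i => by
    have : ((m + q * i : ℕ) : ℝ) = q * (m / q + i) := by push_cast; field_simp
    rw [this, Real.mul_rpow hq0.le (by positivity), hΘ]
    ring
  simp only [hphase]
  refine key.trans ?_
  set T := |Θ| * (M / q) ^ α with hT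
  set U := 2 * h * X ^ α with hU
  have hU0 : 0 < U := by positivity
  have h1 : (T / (M / q) ^ (k + 1)) ^ σ ≤
      c₂ ^ σ * (2 * h * (q : ℝ) ^ (k + 1) * X ^ α / M ^ (k + 1)) ^ σ := by
    rw [← Real.mul_rpow hc₂0.le (by positivity)]
    gcongr
    calc T / (M / q) ^ (k + 1) ≤ (|α| * 4 ^ |α - 1| * 2 ^ (-α) * (U * 2)) / (M / q) ^ (k + 1) := by
          gcongr
          exact hT2.trans (by gcongr)
      _ = _ := by
          rw [hU, hc₂, div_pow]
          field_simp
  have h2 : (M / q) ^ (-σ) = (q / M) ^ σ := by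
    rw [Real.rpow_neg (by positivity), ← Real.inv_rpow (by positivity), inv_div]
  have h3 : (T ^ (-((k + 1 : ℕ) : ℝ)⁻¹)) ^ (2 * σ) ≤ c₁ ^ (-τ) * (U ^ (-τ) * y ^ (-τ)) := by
    rw [← Real.mul_rpow hU0.le hsL0.le, ← Real.mul_rpow hc₁0.le (by positivity),
      ← Real.rpow_mul hT0.le, show -((k + 1 : ℕ) : ℝ)⁻¹ * (2 * σ) = -τ by rw [hτ]; ring]
    exact Real.rpow_le_rpow_of_nonpos (by positivity) hT1 (by rw [neg_nonpos]; positivity)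
  rw [h2]
  set t₁ := (2 * h * (q : ℝ) ^ (k + 1) * X ^ α / M ^ (k + 1)) ^ σ with ht₁
  set t₂ := ((q : ℝ) / M) ^ σ with ht₂
  set t₃ := U ^ (-τ) * y ^ (-τ) with ht₃
  have p1 : 0 ≤ t₁ := by positivity
  have p2 : 0 ≤ t₂ := by positivity
  have p3 : 0 ≤ t₃ := by positivity
  have p4 : 0 ≤ c₂ ^ σ := by positivity
  have p5 : 0 ≤ c₁ ^ (-τ) := by positivity
  have hsum3 : (T / (M / q) ^ (k + 1)) ^ σ + t₂ + (T ^ (-((k + 1 : ℕ) : ℝ)⁻¹)) ^ (2 * σ) ≤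
      (c₂ ^ σ + 1 + c₁ ^ (-τ)) * (t₁ + t₂ + t₃) := by
    nlinarith [mul_nonneg p4 p2, mul_nonneg p4 p3, mul_nonneg p5 p1, mul_nonneg p5 p2]
  calc C * (M / q) ^ ε * (M / q * ((T / (M / q) ^ (k + 1)) ^ σ + t₂ +
        (T ^ (-((k + 1 : ℕ) : ℝ)⁻¹)) ^ (2 * σ)))
      ≤ C * (M / q) ^ ε * (M / q * ((c₂ ^ σ + 1 + c₁ ^ (-τ)) * (t₁ + t₂ + t₃))) := by gcongr
    _ = _ := by ring

theorem sum_sum_le_of_progression {g : ℕ → ℕ → ℝ} {G : ℕ → ℝ} (hG : ∀ s, 0 ≤ G s) (s t : Finset ℕ)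
    {q N S : ℕ} (h : ∀ m n, g m n ≤ 0 ∨
      ∃ j ∈ Finset.Icc 1 S, m < N ∧ n = m + q * j ∧ g m n ≤ G j) :
    ∑ m ∈ s, ∑ n ∈ t, g m n ≤ N * ∑ j ∈ Finset.Icc 1 S, G j := by
  have hsum : 0 ≤ ∑ j ∈ Finset.Icc 1 S, G j := Finset.sum_nonneg fun j _ => hG j
  have hinner : ∀ m, ∑ n ∈ t, g m n ≤
      if m < N then ∑ j ∈ Finset.Icc 1 S, G j else 0 := by
    intro m
    have h0 : ∀ n j, 0 ≤ if n = m + q * j then G j else 0 := fun n j => by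
      split_ifs <;> first | exact hG j | exact le_rfl
    split_ifs with hm
    · calc ∑ n ∈ t, g m n
          ≤ ∑ n ∈ t, ∑ j ∈ Finset.Icc 1 S, if n = m + q * j then G j else 0 := by
            refine Finset.sum_le_sum fun n _ => ?_
            rcases h m n with hz | ⟨j, hj, -, hn, hle⟩
            · exact hz.trans (Finset.sum_nonneg fun j _ => h0 n j)
            · refine hle.trans ?_
              have := Finset.single_le_sum (f := fun j => if n = m + q * j then G j else 0)
                (fun j _ => h0 n j) hj
              simpa only [if_pos hn] using this
        _ = ∑ j ∈ Finset.Icc 1 S, if m + q * j ∈ t then G j else 0 := by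
            rw [Finset.sum_comm]
            simp only [Finset.sum_ite_eq']
        _ ≤ _ := Finset.sum_le_sum fun j _ => by
            split_ifs <;> first | exact hG j | exact le_rfl
    · refine Finset.sum_nonpos fun n _ => ?_
      rcases h m n with hz | ⟨j, -, hm', -⟩
      · exact hz
      · exact absurd hm' hm
  calc ∑ m ∈ s, ∑ n ∈ t, g m n
      ≤ ∑ m ∈ s, if m < N then ∑ j ∈ Finset.Icc 1 S, G j else 0 :=
        Finset.sum_le_sum fun m _ => hinner m
    _ = ((s.filter (· < N)).card : ℝ) * ∑ j ∈ Finset.Icc 1 S, G j := by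
        rw [← Finset.sum_filter, Finset.sum_const, nsmul_eq_mul]
    _ ≤ _ := by
        gcongr
        calc (s.filter (· < N)).card ≤ (Finset.range N).card :=
              Finset.card_le_card fun x hx => by simpa using (Finset.mem_filter.1 hx).2
          _ = N := Finset.card_range N

theorem norm_sum_sum_sum_le {s : Finset ℕ} {A : ℕ → Prop} {B : ℕ → ℕ → Prop}
    {C : ℕ → ℕ → ℕ → Prop} [DecidablePred A] [∀ m, DecidablePred (B m)]
    [∀ m n₁, DecidablePred (C m n₁)] {b : ℕ → ℕ → ℂ} {f : ℕ → ℕ → ℕ → ℂ} {D : ℝ}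
    (hb : ∀ n₁ ∈ s, ∀ n₂ ∈ s, ‖b n₁ n₂‖ ≤ D) :
    ‖∑ m ∈ s.filter A, ∑ n₁ ∈ s.filter (B m), ∑ n₂ ∈ s.filter (C m n₁), b n₁ n₂ * f m n₁ n₂‖ ≤
      D * ∑ n₁ ∈ s, ∑ n₂ ∈ s,
        ‖∑ m ∈ s.filter (fun m => A m ∧ B m n₁ ∧ C m n₁ n₂), f m n₁ n₂‖ := by
  have hswap : ∑ m ∈ s.filter A, ∑ n₁ ∈ s.filter (B m), ∑ n₂ ∈ s.filter (C m n₁),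
      b n₁ n₂ * f m n₁ n₂ = ∑ n₁ ∈ s, ∑ n₂ ∈ s,
        b n₁ n₂ * ∑ m ∈ s.filter (fun m => A m ∧ B m n₁ ∧ C m n₁ n₂), f m n₁ n₂ := by
    have h1 : ∀ m, ∑ n₁ ∈ s.filter (B m), ∑ n₂ ∈ s.filter (C m n₁), b n₁ n₂ * f m n₁ n₂ =
        ∑ n₁ ∈ s, ∑ n₂ ∈ s, if B m n₁ ∧ C m n₁ n₂ then b n₁ n₂ * f m n₁ n₂ else 0 := by
      intro m
      rw [Finset.sum_filter]
      refine Finset.sum_congr rfl fun n₁ _ => ?_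
      rw [Finset.sum_filter]
      split_ifs with hB <;> simp [hB]
    simp only [h1]
    rw [Finset.sum_comm]
    refine Finset.sum_congr rfl fun n₁ _ => ?_
    rw [Finset.sum_comm]
    refine Finset.sum_congr rfl fun n₂ _ => ?_
    rw [← Finset.sum_filter, Finset.filter_filter, Finset.mul_sum]
  rw [hswap, Finset.mul_sum]
  refine (norm_sum_le _ _).trans (Finset.sum_le_sum fun n₁ h₁ => ?_)
  rw [Finset.mul_sum]
  refine (norm_sum_le _ _).trans (Finset.sum_le_sum fun n₂ h₂ => ?_)
  rw [norm_mul]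
  gcongr
  exact hb n₁ h₁ n₂ h₂

theorem sum_Icc_rpow_div_le {τ L t₁ t₂ t₃ : ℝ} (hτ : 0 ≤ τ) (hτ1 : τ ≤ 1 / 2) (hL : 0 < L)
    (h₁ : 0 ≤ t₁) (h₂ : 0 ≤ t₂) (h₃ : 0 ≤ t₃) :
    ∑ s ∈ Finset.Icc 1 ⌊2 * L⌋₊, (t₁ + t₂ + t₃ * ((s : ℝ) / L) ^ (-τ)) ≤
      4 * L * (t₁ + t₂ + t₃) := by
  set S := ⌊2 * L⌋₊ with hS
  have hSL : (S : ℝ) ≤ 2 * L := Nat.floor_le (by positivity)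
  have h4 : ∑ s ∈ Finset.Icc 1 S, ((s : ℝ) / L) ^ (-τ) ≤ 4 * L := by
    calc ∑ s ∈ Finset.Icc 1 S, ((s : ℝ) / L) ^ (-τ)
        = L ^ τ * ∑ s ∈ Finset.Icc 1 S, (s : ℝ) ^ (-τ) := by
          rw [Finset.mul_sum]
          refine Finset.sum_congr rfl fun s _ => ?_
          rw [Real.div_rpow (by positivity) hL.le, Real.rpow_neg hL.le, div_inv_eq_mul, mul_comm]
      _ ≤ L ^ τ * (2 * (2 * L) ^ (1 - τ)) := by
          gcongr
          refine (sum_Icc_rpow_neg_le hτ hτ1 S).trans ?_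
          gcongr
          linarith
      _ = 2 ^ (1 - τ) * (2 * (L ^ τ * L ^ (1 - τ))) := by
          rw [Real.mul_rpow (by norm_num) hL.le]; ring
      _ = 2 ^ (1 - τ) * (2 * L) := by
          rw [← Real.rpow_add hL, add_sub_cancel, Real.rpow_one]
      _ ≤ 2 ^ (1 : ℝ) * (2 * L) := by
          gcongr
          · norm_num
          · linarith
      _ = 4 * L := by rw [Real.rpow_one]; ring
  rw [Finset.sum_add_distrib, Finset.sum_const, Nat.card_Icc, nsmul_eq_mul, ← Finset.mul_sum]
  simp only [add_tsub_cancel_right]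
  have h5 := mul_le_mul_of_nonneg_left h4 h₃
  have h6 := mul_le_mul_of_nonneg_right hSL (add_nonneg h₁ h₂)
  nlinarith [mul_nonneg hL.le (add_nonneg h₁ h₂)]

theorem one_add_log_le {δ X q M : ℝ} (hδ : 0 < δ) (hX : 0 < X) (hq : 0 < q)
    (hqX : q ≤ X) (hXM : X ^ ((1 : ℝ) / 3) ≤ M) (hMq : M * q ≤ 2 * X) :
    1 + Real.log (2 * X) ≤ (1 + Real.log 16 + 6 / δ) * (X / q) ^ (δ / 2) := by
  have hy : 1 ≤ X / q := (one_le_div hq).2 hqX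
  set y := X / q with hydef
  have hy0 : 0 < y := by linarith
  have h1 : X ^ ((1 : ℝ) / 3) ≤ 2 * y := by
    refine hXM.trans ?_
    rw [hydef, ← mul_div_assoc, le_div_iff₀ hq]
    exact hMq
  have h2 : X ≤ (2 * y) ^ 3 := by
    calc X = (X ^ ((1 : ℝ) / 3)) ^ 3 := by
          rw [← Real.rpow_natCast, ← Real.rpow_mul hX.le]; norm_num
      _ ≤ _ := by gcongr
  have h3 : Real.log (2 * X) ≤ Real.log 16 + 3 * Real.log y := by
    calc Real.log (2 * X) ≤ Real.log (16 * y ^ 3) := by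
          refine Real.log_le_log (by positivity) ?_
          nlinarith
      _ = _ := by
          rw [Real.log_mul (by norm_num) (by positivity), Real.log_pow]; norm_num
  have h4 : Real.log y ≤ y ^ (δ / 2) / (δ / 2) := Real.log_le_rpow_div hy0.le (by positivity)
  have h5 : 1 ≤ y ^ (δ / 2) := Real.one_le_rpow hy (by positivity)
  have h6 : 0 ≤ Real.log 16 := Real.log_nonneg (by norm_num)
  have h7 : 3 * (y ^ (δ / 2) / (δ / 2)) = 6 / δ * y ^ (δ / 2) := by field_simp; norm_num
  nlinarith

theorem abs_le_one_add_log {β : ℕ → ℝ} (hβ : (∀ n, |β n| ≤ Λ n) ∨ ∀ n, |β n| ≤ 1) {X n : ℕ}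
    (hX : 0 < X) (hn : n ≤ 2 * X) : |β n| ≤ 1 + Real.log (2 * X) := by
  have hX1 : (1 : ℝ) ≤ X := by exact_mod_cast hX
  have hlog : 0 ≤ Real.log (2 * X) := Real.log_nonneg (by linarith)
  rcases hβ with h | h
  · refine (h n).trans (vonMangoldt_le_log.trans ?_)
    rcases Nat.eq_zero_or_pos n with rfl | hn0
    · simp; linarith
    · have : Real.log n ≤ Real.log (2 * X) :=
        Real.log_le_log (by exact_mod_cast hn0) (by exact_mod_cast hn)
      linarith
  · linarith [h n]

theorem modEq_of_mul_mod_eq {a q m n₁ n₂ : ℕ} (ha : a.Coprime q) (h₁ : (m * n₁) % q = a % q)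
    (h₂ : (m * n₂) % q = a % q) : n₁ ≡ n₂ [MOD q] := by
  have h : m * n₁ ≡ a [MOD q] := h₁
  have hc : (m * n₁).Coprime q := by
    rw [Nat.Coprime, h.gcd_eq]; exact ha
  have hm : Nat.gcd q m = 1 := (Nat.Coprime.coprime_mul_right hc).symm
  exact Nat.ModEq.cancel_left_of_coprime hm (h.trans (show m * n₂ ≡ a [MOD q] from h₂).symm)

theorem range_bounds {X M M₁ Y z : ℝ} {m n₁ n₂ : ℕ} (hX : 0 < X) (hM : 0 < M) (hM₁ : M₁ ≤ 2 * M)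
    (hY : Y ≤ 2 * X) (hz : X ≤ z) (hm : M < m) (hm₁ : m ≤ M₁) (h₁ : z / m ≤ n₁)
    (h₂ : n₂ < Y / m) : X / (2 * M) ≤ n₁ ∧ (n₂ : ℝ) < 2 * X / M := by
  have hm0 : (0 : ℝ) < m := hM.trans hm
  constructor
  · exact (div_le_div₀ (hX.le.trans hz) hz hm0 (by linarith)).trans h₁
  · refine h₂.trans_le ?_
    gcongr

theorem sum_sum_card_le {X M M₁ Y : ℝ} {q a : ℕ} {Z : ℕ → ℝ} (I : Finset ℕ) (hX : 0 < X)
    (hM : 1 ≤ M) (hM₁ : M₁ ≤ 2 * M) (hY : Y ≤ 2 * X) (hZ : ∀ m, X ≤ Z m) (hq : 0 < q)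
    (ha : a.Coprime q) (hMq : M * q ≤ 2 * X) :
    ((∑ m ∈ I.filter (fun m : ℕ => M < m ∧ m ≤ M₁),
      ∑ n₁ ∈ I.filter (fun n₁ : ℕ => Z m / m ≤ n₁ ∧ (m * n₁) % q = a % q),
        (I.filter (fun n₂ : ℕ => n₁ < n₂ ∧ n₂ < Y / m ∧ (m * n₂) % q = a % q)).card : ℕ) : ℝ) ≤
      32 * (X ^ 2 / (M * q ^ 2)) := by
  have hq0 : (0 : ℝ) < q := by exact_mod_cast hq
  have hM0 : 0 < M := by linarith
  have hD : 0 ≤ 2 * X / M := by positivity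
  have hcount : 2 * X / M / q + 1 ≤ 4 * X / (M * q) := by
    have : 1 ≤ 2 * X / M / q := by
      rw [div_div, one_le_div (by positivity)]; exact hMq
    calc 2 * X / M / q + 1 ≤ 2 * X / M / q + 2 * X / M / q := by linarith
      _ = _ := by field_simp; norm_num
  have hres : ∀ m : ℕ, ∀ t : Finset ℕ, (∀ n ∈ t, (n : ℝ) ≤ 2 * X / M ∧ (m * n) % q = a % q) →
      (t.card : ℝ) ≤ 4 * X / (M * q) := fun m t ht =>
    (card_le_of_modEq hq hD (fun x hx y hy => modEq_of_mul_mod_eq ha (ht x hx).2 (ht y hy).2)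
      fun x hx => (ht x hx).1).trans hcount
  have hm : ∀ m ∈ I.filter (fun m : ℕ => M < m ∧ m ≤ M₁),
      (∑ n₁ ∈ I.filter (fun n₁ : ℕ => Z m / m ≤ n₁ ∧ (m * n₁) % q = a % q),
        ((I.filter (fun n₂ : ℕ => n₁ < n₂ ∧ n₂ < Y / m ∧ (m * n₂) % q = a % q)).card : ℝ)) ≤
      4 * X / (M * q) * (4 * X / (M * q)) := by
    intro m hm
    obtain ⟨-, hm1, hm2⟩ := Finset.mem_filter.1 hm
    set t := (I.filter (fun n₁ : ℕ => Z m / m ≤ n₁ ∧ (m * n₁) % q = a % q)).filter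
      (fun n₁ : ℕ => (n₁ : ℝ) ≤ 2 * X / M) with ht
    calc _ = ∑ n₁ ∈ t,
          ((I.filter (fun n₂ : ℕ => n₁ < n₂ ∧ n₂ < Y / m ∧ (m * n₂) % q = a % q)).card : ℝ) := by
          refine (Finset.sum_subset (Finset.filter_subset _ _) fun n₁ h1 h2 => ?_).symm
          rw [Nat.cast_eq_zero, Finset.card_eq_zero, Finset.filter_eq_empty_iff]
          rintro n₂ - ⟨h3, h4, -⟩
          refine h2 (Finset.mem_filter.2 ⟨h1, ?_⟩)
          have h5 := (range_bounds hX hM0 hM₁ hY (hZ m) hm1 hm2 (Finset.mem_filter.1 h1).2.1 h4).2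
          have : (n₁ : ℝ) ≤ n₂ := by exact_mod_cast h3.le
          linarith
      _ ≤ ∑ n₁ ∈ t, 4 * X / (M * q) := by
          refine Finset.sum_le_sum fun n₁ h1 => hres m _ fun n₂ h2 => ?_
          obtain ⟨-, -, h4, h5⟩ := Finset.mem_filter.1 h2
          exact ⟨(range_bounds hX hM0 hM₁ hY (hZ m) hm1 hm2
            (Finset.mem_filter.1 (Finset.mem_filter.1 h1).1).2.1 h4).2.le, h5⟩
      _ = t.card * (4 * X / (M * q)) := by rw [Finset.sum_const, nsmul_eq_mul]
      _ ≤ _ := by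
          gcongr
          refine hres m t fun n hn => ?_
          obtain ⟨h1, h2⟩ := Finset.mem_filter.1 hn
          exact ⟨h2, (Finset.mem_filter.1 h1).2.2⟩
  have hcard : ((I.filter (fun m : ℕ => M < m ∧ m ≤ M₁)).card : ℝ) ≤ M + 1 := by
    refine card_natCast_le_of_abs_sub_le hM0.le fun x hx y hy => ?_
    obtain ⟨-, hx1, hx2⟩ := Finset.mem_filter.1 hx
    obtain ⟨-, hy1, hy2⟩ := Finset.mem_filter.1 hy
    rw [abs_le]
    constructor <;> linarith
  push_cast
  calc _ ≤ ∑ m ∈ I.filter (fun m : ℕ => M < m ∧ m ≤ M₁), 4 * X / (M * q) * (4 * X / (M * q)) :=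
        Finset.sum_le_sum hm
    _ = ((I.filter (fun m : ℕ => M < m ∧ m ≤ M₁)).card : ℝ) *
        (4 * X / (M * q) * (4 * X / (M * q))) := by rw [Finset.sum_const, nsmul_eq_mul]
    _ ≤ (2 * M) * (4 * X / (M * q) * (4 * X / (M * q))) := by
        gcongr
        linarith
    _ = _ := by field_simp; norm_num

set_option maxHeartbeats 1000000 in
theorem exists_sum_sum_norm_le {α : ℝ} (hα : ∀ n : ℤ, α ≠ n) {k : ℕ} (hk : 2 ≤ k) {ε : ℝ}
    (hε : 0 < ε) : ∃ C : ℝ, 0 < C ∧ ∀ (I : Finset ℕ) (X M M₁ Y h : ℝ) (q a : ℕ) (Z : ℕ → ℝ),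
      (∀ x ∈ I, ∀ y ≤ x, y ∈ I) → 0 < X → 0 < h → 0 < q → q ≤ M → M ≤ X → M₁ ≤ 2 * M →
      Y ≤ 2 * X → a.Coprime q → (∀ m, X ≤ Z m) →
      (∀ m m' : ℕ, ∀ c : ℝ, 0 < m → m ≤ m' → Z m / m ≤ c → Z m' / m' ≤ c) →
      ∑ n₁ ∈ I, ∑ n₂ ∈ I, ‖∑ m ∈ I.filter (fun m : ℕ => (M < m ∧ m ≤ M₁) ∧
          (Z m / m ≤ n₁ ∧ (m * n₁) % q = a % q) ∧ (n₁ < n₂ ∧ n₂ < Y / m ∧ (m * n₂) % q = a % q)),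
          e (h * (m : ℝ) ^ α * ((n₁ : ℝ) ^ α - (n₂ : ℝ) ^ α))‖ ≤
        C * (M / q) ^ ε * (X ^ 2 / (M * q ^ 2)) *
          ((2 * h * (q : ℝ) ^ (k + 1) * X ^ α / M ^ (k + 1)) ^ (((2 * tri k : ℕ) : ℝ)⁻¹) +
            (q / M) ^ (((2 * tri k : ℕ) : ℝ)⁻¹) +
            (2 * h * X ^ α) ^ (-(2 * ((2 * tri k : ℕ) : ℝ)⁻¹ / (k + 1 : ℕ)))) := by
  obtain ⟨C, hC, hmain⟩ := exists_norm_sum_progression_le hα hk hε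
  set σ := ((2 * tri k : ℕ) : ℝ)⁻¹ with hσ
  set τ := 2 * σ / (k + 1 : ℕ) with hτ
  have hτ0 : 0 ≤ τ := by positivity
  have hτ1 : τ ≤ 1 / 2 := by
    have h1 : (2 : ℝ) ≤ k := by exact_mod_cast hk
    rw [hτ, hσ, two_mul_tri]
    push_cast
    rw [div_le_div_iff₀ (by positivity) (by norm_num), ← div_eq_mul_inv, div_mul_eq_mul_div,
      div_le_iff₀ (by positivity)]
    nlinarith [mul_nonneg (sub_nonneg.2 h1) (sub_nonneg.2 h1),
      mul_nonneg (mul_nonneg (sub_nonneg.2 h1) (sub_nonneg.2 h1)) (sub_nonneg.2 h1)]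
  refine ⟨12 * C, by positivity,
    fun I X M M₁ Y h q a Z hI hX hh hq hqM hMX hM₁ hY ha hZ hZmono => ?_⟩
  have hq0 : (0 : ℝ) < q := by exact_mod_cast hq
  have hM : 0 < M := by linarith
  set t₁ := (2 * h * (q : ℝ) ^ (k + 1) * X ^ α / M ^ (k + 1)) ^ σ with ht₁
  set t₂ := ((q : ℝ) / M) ^ σ with ht₂
  set t₃ := (2 * h * X ^ α) ^ (-τ) with ht₃
  have p1 : 0 ≤ t₁ := by positivity
  have p2 : 0 ≤ t₂ := by positivity
  have p3 : 0 ≤ t₃ := by positivity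
  set L := X / (M * q) with hL
  have hL0 : 0 < L := by positivity
  set G : ℕ → ℝ := fun s => C * (M / q) ^ ε * (M / q) * (t₁ + t₂ + t₃ * ((s : ℝ) / L) ^ (-τ))
    with hG
  set P : ℕ → ℕ → Finset ℕ := fun n₁ n₂ => I.filter (fun m : ℕ => (M < m ∧ m ≤ M₁) ∧
    (Z m / m ≤ n₁ ∧ (m * n₁) % q = a % q) ∧ (n₁ < n₂ ∧ n₂ < Y / m ∧ (m * n₂) % q = a % q)) with hP
  have hPmem : ∀ n₁ n₂ m, m ∈ P n₁ n₂ ↔ m ∈ I ∧ (M < m ∧ m ≤ M₁) ∧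
    (Z m / m ≤ n₁ ∧ (m * n₁) % q = a % q) ∧
      (n₁ < n₂ ∧ n₂ < Y / m ∧ (m * n₂) % q = a % q) := fun n₁ n₂ m => Finset.mem_filter
  have hpair : ∀ n₁ n₂ : ℕ,
      ‖∑ m ∈ P n₁ n₂, e (h * (m : ℝ) ^ α * ((n₁ : ℝ) ^ α - (n₂ : ℝ) ^ α))‖ ≤ 0 ∨
      ∃ s ∈ Finset.Icc 1 ⌊2 * L⌋₊, n₁ < ⌊2 * X / M⌋₊ + 1 ∧ n₂ = n₁ + q * s ∧
        ‖∑ m ∈ P n₁ n₂, e (h * (m : ℝ) ^ α * ((n₁ : ℝ) ^ α - (n₂ : ℝ) ^ α))‖ ≤ G s := by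
    intro n₁ n₂
    rcases (P n₁ n₂).eq_empty_or_nonempty with hemp | ⟨m₀, hm₀⟩
    · left; rw [hemp]; simp
    right
    obtain ⟨-, ⟨hA1, hA2⟩, ⟨hB1, hB2⟩, hC1, hC2, hC3⟩ := (hPmem _ _ _).1 hm₀
    obtain ⟨hn₁, hn₂⟩ := range_bounds hX hM hM₁ hY (hZ m₀) hA1 hA2 hB1 hC2
    obtain ⟨s, hs⟩ := (Nat.modEq_iff_dvd' hC1.le).1 (modEq_of_mul_mod_eq ha hB2 hC3)
    have hn₂s : n₂ = n₁ + q * s := by omega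
    have hs1 : 1 ≤ s := by
      rcases Nat.eq_zero_or_pos s with rfl | h0
      · omega
      · exact h0
    have hn12 : (n₁ : ℝ) ≤ n₂ := by exact_mod_cast hC1.le
    refine ⟨s, Finset.mem_Icc.2 ⟨hs1, Nat.le_floor ?_⟩,
      Nat.lt_succ_of_le (Nat.le_floor (by linarith)), hn₂s, ?_⟩
    · have : (q : ℝ) * s ≤ 2 * X / M := by
        refine le_trans ?_ hn₂.le
        rw [hn₂s]; push_cast; linarith [Nat.cast_nonneg (α := ℝ) n₁]
      rw [le_div_iff₀ hM] at this
      rw [hL, ← mul_div_assoc, le_div_iff₀ (by positivity)]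
      linarith
    · rw [hn₂s] at hn₂ ⊢
      refine hmain X M h q n₁ s _ hX hh hq hqM hs1 hn₁ hn₂.le ?_ ?_ ?_
      · intro m hm
        obtain ⟨-, ⟨h1, h2⟩, -⟩ := (hPmem _ _ _).1 hm
        exact ⟨h1, h2.trans hM₁⟩
      · intro x hx y hy
        obtain ⟨-, -, ⟨-, h1⟩, -⟩ := (hPmem _ _ _).1 hx
        obtain ⟨-, -, ⟨-, h2⟩, -⟩ := (hPmem _ _ _).1 hy
        rw [mul_comm] at h1 h2
        exact modEq_of_mul_mod_eq ha h1 h2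
      · intro x hx y hy z hxz hzy hzx
        obtain ⟨-, ⟨hx1, -⟩, ⟨hx2, hx3⟩, hx4, -, hx5⟩ := (hPmem _ _ _).1 hx
        obtain ⟨hyI, ⟨-, hy1⟩, -, -, hy2, -⟩ := (hPmem _ _ _).1 hy
        have hx0 : (0 : ℝ) < x := hM.trans hx1
        have hxz' : (x : ℝ) ≤ z := by exact_mod_cast hxz
        have hzy' : (z : ℝ) ≤ y := by exact_mod_cast hzy
        have hz0 : (0 : ℝ) < z := by linarith
        refine (hPmem _ _ _).2 ⟨hI y hyI z hzy, ⟨by linarith, by linarith⟩,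
          ⟨hZmono x z _ (by exact_mod_cast hx0) hxz hx2, (hzx.mul_right _).trans hx3⟩, hx4, ?_,
          (hzx.mul_right _).trans hx5⟩
        rw [lt_div_iff₀ (by linarith)] at hy2 ⊢
        refine lt_of_le_of_lt ?_ hy2
        gcongr
  have hGnn : ∀ s, 0 ≤ G s := fun s => by positivity
  refine (sum_sum_le_of_progression hGnn I I hpair).trans ?_
  rw [hG, ← Finset.mul_sum]
  have hcard : ((⌊2 * X / M⌋₊ + 1 : ℕ) : ℝ) ≤ 3 * X / M := by
    push_cast
    have h1 := Nat.floor_le (show 0 ≤ 2 * X / M by positivity)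
    have h2 : 1 ≤ X / M := (one_le_div hM).2 hMX
    calc (⌊2 * X / M⌋₊ : ℝ) + 1 ≤ 2 * X / M + X / M := by linarith
      _ = _ := by ring
  calc ((⌊2 * X / M⌋₊ + 1 : ℕ) : ℝ) * (C * (M / q) ^ ε * (M / q) *
        ∑ s ∈ Finset.Icc 1 ⌊2 * L⌋₊, (t₁ + t₂ + t₃ * ((s : ℝ) / L) ^ (-τ)))
      ≤ (3 * X / M) * (C * (M / q) ^ ε * (M / q) * (4 * L * (t₁ + t₂ + t₃))) := by
        gcongr
        exact sum_Icc_rpow_div_le hτ0 hτ1 hL0 p1 p2 p3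
    _ = _ := by
        rw [hL]
        field_simp
        ring

set_option maxHeartbeats 1000000 in
/-- The off-diagonal sum in the treatment of the type II sums: for
non-integer `α > 0`, `k ≥ 3`, `δ > 0`, `h ≥ 1`, `2 < q ≤ X`, `V = X^{1/3}`,
`V ≤ M < M₁ ≤ 2M ≤ 2V²`, `X < Y ≤ 2X`, `Z ∈ {X, max(Vm,X)}`, `gcd(a,q) = 1`, and `β`
with `|β_n| ≤ Λ(n)` or `|β_n| ≤ 1`, the sum
`S(M) = ∑_{M < m ≤ M₁} ∑_{Z/m ≤ n₁ < n₂ < Y/m, mnᵢ ≡ a (q)} β_{n₁} β_{n₂}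
  e(h m^α (n₁^α − n₂^α))`
satisfies `S(M) ≪_{k,δ} (X/q)^{2δ} (X²/(Mq²)) (T₄ + T₅ + T₆)` with
`T₄ = (2h q^k X^α/M^k)^{1/(k(k-1))}`, `T₅ = (q/M)^{1/(k(k-1))}`,
`T₆ = (2hX^α)^{-2/(k²(k-1))}`. -/
theorem type_II_off_diagonal_bound
    (α δ : ℝ) (k : ℕ) (hα : 0 < α) (hαnonint : ∀ n : ℤ, α ≠ (n : ℝ))
    (hk : 3 ≤ k) (hδ : 0 < δ) :
    ∃ C : ℝ, 0 < C ∧ ∀ (X q a : ℕ) (h V Y M M₁ : ℝ) (β : ℕ → ℝ) (Z : ℕ → ℝ),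
      1 ≤ h → 2 < q → q ≤ X → V = (X : ℝ) ^ ((1 : ℝ)/3) →
      (X : ℝ) < Y → Y ≤ 2 * X →
      V ≤ M → M < M₁ → M₁ ≤ 2 * M → 2 * M ≤ 2 * V ^ 2 →
      Nat.Coprime a q →
      ((∀ n, |β n| ≤ Λ n) ∨ (∀ n, |β n| ≤ 1)) →
      ((∀ m, Z m = (X : ℝ)) ∨ (∀ m, Z m = max (V * m) (X : ℝ))) →
      ‖∑ m ∈ (Finset.range (2 * X + 1)).filter (fun m : ℕ => M < (m : ℝ) ∧ (m : ℝ) ≤ M₁),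
          ∑ n₁ ∈ (Finset.range (2 * X + 1)).filter
            (fun n₁ : ℕ => Z m / m ≤ (n₁ : ℝ) ∧ (m * n₁) % q = a % q),
            ∑ n₂ ∈ (Finset.range (2 * X + 1)).filter
              (fun n₂ : ℕ => n₁ < n₂ ∧ (n₂ : ℝ) < Y / m ∧ (m * n₂) % q = a % q),
              (Complex.ofReal (β n₁ * β n₂)) *
                e (h * (m : ℝ) ^ α * ((n₁ : ℝ) ^ α - (n₂ : ℝ) ^ α))‖
        ≤ C * ((X : ℝ) / q) ^ (2 * δ) * ((X : ℝ) ^ 2 / (M * (q : ℝ) ^ 2)) *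
          ((2 * h * (q : ℝ) ^ k * (X : ℝ) ^ α / M ^ k) ^ (1 / ((k : ℝ) * (k - 1)))
            + ((q : ℝ) / M) ^ (1 / ((k : ℝ) * (k - 1)))
            + (2 * h * (X : ℝ) ^ α) ^ (-2 / ((k : ℝ) ^ 2 * (k - 1)))) := by
  obtain ⟨K, rfl⟩ : ∃ K, k = K + 1 := ⟨k - 1, by omega⟩
  have hK : 2 ≤ K := by omega
  obtain ⟨C, hC, hmain⟩ := exists_sum_sum_norm_le hαnonint hK hδ
  set σ := ((2 * tri K : ℕ) : ℝ)⁻¹ with hσ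
  have hK0 : (0 : ℝ) < K := by exact_mod_cast (by omega : 0 < K)
  have hσ0 : 0 ≤ σ := by positivity
  have hexp1 : 1 / (((K + 1 : ℕ) : ℝ) * ((K + 1 : ℕ) - 1)) = σ := by
    rw [hσ, two_mul_tri, one_div]
    push_cast
    rw [add_sub_cancel_right, mul_comm]
  have hexp2 : -2 / (((K + 1 : ℕ) : ℝ) ^ 2 * ((K + 1 : ℕ) - 1)) = -(2 * σ / (K + 1 : ℕ)) := by
    rw [hσ, two_mul_tri]
    push_cast
    rw [add_sub_cancel_right]
    field_simp
  rw [hexp1, hexp2]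
  set τ := 2 * σ / (K + 1 : ℕ) with hτ
  set D := 1 + Real.log 16 + 6 / δ with hD
  have hD0 : 0 < D := by
    have := Real.log_nonneg (show (1 : ℝ) ≤ 16 by norm_num)
    positivity
  refine ⟨D ^ 2 * (32 + C * 2 ^ δ), by positivity,
    fun X q a h V Y M M₁ β Z hh hq hqX hV hY hY2 hVM hMM₁ hM₁ hMV ha hβ hZ => ?_⟩
  have hX : 0 < X := by omega
  have hX0 : (0 : ℝ) < X := by exact_mod_cast hX
  have hX1 : (1 : ℝ) ≤ X := by exact_mod_cast hX
  have hq0' : 0 < q := by omega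
  have hq0 : (0 : ℝ) < q := by exact_mod_cast hq0'
  have hqX' : (q : ℝ) ≤ X := by exact_mod_cast hqX
  have hV1 : 1 ≤ V := by rw [hV]; exact Real.one_le_rpow hX1 (by norm_num)
  have hM1 : 1 ≤ M := hV1.trans hVM
  have hM0 : 0 < M := by linarith
  have hh0 : 0 < h := by linarith
  have hMX : M ≤ X := by
    calc M ≤ V ^ 2 := by linarith
      _ ≤ V ^ 3 := pow_le_pow_right₀ hV1 (by norm_num)
      _ = X := by rw [hV, ← Real.rpow_natCast, ← Real.rpow_mul hX0.le]; norm_num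
  have hZX : ∀ m, (X : ℝ) ≤ Z m := by
    rcases hZ with hZ | hZ <;> intro m <;> rw [hZ m]
    exact le_max_right _ _
  have hZmono : ∀ m m' : ℕ, ∀ c : ℝ, 0 < m → m ≤ m' → Z m / m ≤ c → Z m' / m' ≤ c := by
    intro m m' c hm hmm' hc
    have hm0 : (0 : ℝ) < m := by exact_mod_cast hm
    have hmm0 : (m : ℝ) ≤ m' := by exact_mod_cast hmm'
    have hm'0 : (0 : ℝ) < m' := by linarith
    have hc0 : 0 ≤ c := le_trans (div_nonneg (hX0.le.trans (hZX m)) hm0.le) hc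
    rw [div_le_iff₀ hm0] at hc
    rw [div_le_iff₀ hm'0]
    have hXc : (X : ℝ) ≤ c * m' := (hZX m).trans (hc.trans (by gcongr))
    rcases hZ with hZ | hZ
    · rw [hZ m']; exact hXc
    · rw [hZ m']
      rw [hZ m] at hc
      have := le_of_mul_le_mul_right ((le_max_left _ _).trans hc) hm0
      exact max_le (by gcongr) hXc
  have hT1 : 0 ≤ (2 * h * (q : ℝ) ^ (K + 1) * (X : ℝ) ^ α / M ^ (K + 1)) ^ σ := by positivity
  have hT2 : 0 ≤ ((q : ℝ) / M) ^ σ := by positivity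
  have hT3 : 0 ≤ (2 * h * (X : ℝ) ^ α) ^ (-τ) := by positivity
  rcases lt_or_ge (2 * (X : ℝ)) (M * q) with hlarge | hsmall
  · refine le_of_eq_of_le ?_ (show (0 : ℝ) ≤ _ by positivity)
    rw [norm_eq_zero]
    refine Finset.sum_eq_zero fun m hm => Finset.sum_eq_zero fun n₁ h₁ =>
      Finset.sum_eq_zero fun n₂ h₂ => ?_
    obtain ⟨-, hm1, hm2⟩ := Finset.mem_filter.1 hm
    obtain ⟨-, h1, h1'⟩ := Finset.mem_filter.1 h₁
    obtain ⟨-, h2, h2', h2''⟩ := Finset.mem_filter.1 h₂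
    exfalso
    have hlt := (range_bounds hX0 hM0 hM₁ hY2 (hZX m) hm1 hm2 h1 h2').2
    have hdvd := (Nat.modEq_iff_dvd' h2.le).1 (modEq_of_mul_mod_eq ha h1' h2'')
    have hqn : q ≤ n₂ := (Nat.le_of_dvd (by omega) hdvd).trans (Nat.sub_le _ _)
    have hqn' : (q : ℝ) ≤ n₂ := by exact_mod_cast hqn
    rw [lt_div_iff₀ hM0] at hlt
    nlinarith
  set y := (X : ℝ) / q with hy
  have hy1 : 1 ≤ y := (one_le_div hq0).2 hqX'
  have hy0 : 0 < y := by linarith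
  set b := 1 + Real.log (2 * X) with hb
  have hb0 : 0 ≤ b := by
    have := Real.log_nonneg (show (1 : ℝ) ≤ 2 * X by linarith)
    positivity
  have hblog : b ≤ D * y ^ (δ / 2) :=
    one_add_log_le hδ hX0 hq0 hqX' (hV ▸ hVM) hsmall
  have hb2 : b ^ 2 ≤ D ^ 2 * y ^ δ := by
    calc b ^ 2 ≤ (D * y ^ (δ / 2)) ^ 2 := by gcongr
      _ = D ^ 2 * y ^ δ := by
        rw [mul_pow, ← Real.rpow_natCast (y ^ (δ / 2)), ← Real.rpow_mul hy0.le]; norm_num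
  have hβb : ∀ n₁ ∈ Finset.range (2 * X + 1), ∀ n₂ ∈ Finset.range (2 * X + 1),
      ‖Complex.ofReal (β n₁ * β n₂)‖ ≤ b ^ 2 := by
    intro n₁ h₁ n₂ h₂
    rw [Finset.mem_range] at h₁ h₂
    rw [Complex.norm_real, Real.norm_eq_abs, abs_mul, sq]
    exact mul_le_mul (abs_le_one_add_log hβ hX (by omega)) (abs_le_one_add_log hβ hX (by omega))
      (abs_nonneg _) hb0
  have hyδ : 1 ≤ y ^ δ := Real.one_le_rpow hy1 hδ.le
  have hy2 : y ^ (2 * δ) = y ^ δ * y ^ δ := by rw [two_mul, Real.rpow_add hy0]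
  set E := (X : ℝ) ^ 2 / (M * (q : ℝ) ^ 2) with hE
  have hE0 : 0 < E := by positivity
  set T₁ := (2 * h * (q : ℝ) ^ (K + 1) * (X : ℝ) ^ α / M ^ (K + 1)) ^ σ with hT₁
  set T₂ := ((q : ℝ) / M) ^ σ with hT₂
  set T₃ := (2 * h * (X : ℝ) ^ α) ^ (-τ) with hT₃
  have h2δ : 0 < (2 : ℝ) ^ δ := by positivity
  rcases lt_or_ge M (q : ℝ) with hqM | hqM
  · have hT2' : 1 ≤ T₂ := Real.one_le_rpow ((one_le_div hM0).2 hqM.le) hσ0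
    have hcard := sum_sum_card_le (Finset.range (2 * X + 1)) hX0 hM1 hM₁ hY2 hZX hq0' ha hsmall
    calc _ ≤ ∑ m ∈ (Finset.range (2 * X + 1)).filter (fun m : ℕ => M < (m : ℝ) ∧ (m : ℝ) ≤ M₁),
          ∑ n₁ ∈ (Finset.range (2 * X + 1)).filter
            (fun n₁ : ℕ => Z m / m ≤ (n₁ : ℝ) ∧ (m * n₁) % q = a % q),
            ∑ n₂ ∈ (Finset.range (2 * X + 1)).filter
              (fun n₂ : ℕ => n₁ < n₂ ∧ (n₂ : ℝ) < Y / m ∧ (m * n₂) % q = a % q), b ^ 2 := by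
          refine (norm_sum_le _ _).trans (Finset.sum_le_sum fun m _ =>
            (norm_sum_le _ _).trans (Finset.sum_le_sum fun n₁ h₁ =>
              (norm_sum_le _ _).trans (Finset.sum_le_sum fun n₂ h₂ => ?_)))
          rw [norm_mul, norm_e, mul_one]
          exact hβb n₁ (Finset.mem_filter.1 h₁).1 n₂ (Finset.mem_filter.1 h₂).1
      _ ≤ b ^ 2 * (32 * E) := by
          refine le_trans (le_of_eq ?_) (mul_le_mul_of_nonneg_left hcard (sq_nonneg b))
          push_cast
          simp only [Finset.sum_const, nsmul_eq_mul, Finset.mul_sum]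
          simp only [mul_comm (b ^ 2)]
      _ ≤ (D ^ 2 * y ^ δ) * (32 * E) := by gcongr
      _ = D ^ 2 * 32 * (y ^ δ * 1) * E * 1 := by ring
      _ ≤ D ^ 2 * (32 + C * 2 ^ δ) * (y ^ δ * y ^ δ) * E * (T₁ + T₂ + T₃) := by
          gcongr
          · linarith [mul_pos hC h2δ]
          · linarith
      _ = _ := by rw [hy2]
  · have hMy : (M / q) ^ δ ≤ 2 ^ δ * y ^ δ := by
      rw [← Real.mul_rpow (by norm_num) hy0.le]
      gcongr
      rw [hy, ← mul_div_assoc]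
      gcongr
      linarith
    have hsum := hmain (Finset.range (2 * X + 1)) X M M₁ Y h q a Z
      (fun x hx y hy => Finset.mem_range.2 (by rw [Finset.mem_range] at hx; omega))
      hX0 hh0 hq0' hqM hMX hM₁ hY2 ha hZX hZmono
    have hswap := norm_sum_sum_sum_le (s := Finset.range (2 * X + 1))
      (A := fun m : ℕ => M < (m : ℝ) ∧ (m : ℝ) ≤ M₁)
      (B := fun m n₁ : ℕ => Z m / m ≤ (n₁ : ℝ) ∧ (m * n₁) % q = a % q)
      (C := fun m n₁ n₂ : ℕ => n₁ < n₂ ∧ (n₂ : ℝ) < Y / m ∧ (m * n₂) % q = a % q)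
      (b := fun n₁ n₂ => Complex.ofReal (β n₁ * β n₂))
      (f := fun m n₁ n₂ => e (h * (m : ℝ) ^ α * ((n₁ : ℝ) ^ α - (n₂ : ℝ) ^ α))) hβb
    refine hswap.trans ?_
    calc _ ≤ b ^ 2 * (C * (M / q) ^ δ * E * (T₁ + T₂ + T₃)) :=
          mul_le_mul_of_nonneg_left hsum (sq_nonneg b)
      _ ≤ (D ^ 2 * y ^ δ) * (C * (2 ^ δ * y ^ δ) * E * (T₁ + T₂ + T₃)) := by gcongr
      _ = D ^ 2 * (C * 2 ^ δ) * (y ^ δ * y ^ δ) * E * (T₁ + T₂ + T₃) := by ring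
      _ ≤ D ^ 2 * (32 + C * 2 ^ δ) * (y ^ δ * y ^ δ) * E * (T₁ + T₂ + T₃) := by
          gcongr
          linarith
      _ = _ := by rw [hy2]
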